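/- Fix ε∈(0,1/2]. There exist positive constants c', c'', c''' depending only on ε, and a function f_ε:[0,1)→[0,1] depending only on ε with f_ε(δ)→0 as δ→0, such that for all s≥0, δ∈(0,c'], R≥1, L≥R, all admissible families of weights t, and all (u,v)∈ℒ with |u−v| ≥ ε·v and u·L^ν ≥ c'''·log(1/δ), satisfying P(t_z^u ≤ s) ≤ δ·(min(1,u^{1/ν}R))^α for all z∈Λ(R), one has for all x∈Λ(L): P(d_{t,v}(x;L,2L) ≤ c''·sL/max((u^{−1}·log(1/δ))^{1/ν}, R)) ≤ f_ε(δ). -/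

import Mathlib

open MeasureTheory Set Filter
open scoped ENNReal Topology Classical

noncomputable section

namespace Paper

variable {V : Type}

/-- Total weight at a vertex: `λ_x = ∑_y λ_{x,y}`. -/
def lamTot (lam : V → V → ℝ) (x : V) : ℝ := ∑' y, lam x y

/-- Closed ball for the distance `dd`. -/
def vball (dd : V → V → ℝ) (x : V) (r : ℝ) : Set V := {y | dd x y ≤ r}

/-- Trajectories that never return to `A` after time `0`, i.e. `H̃_A = ∞`. -/
def avoidSet (A : Set V) : Set (ℕ → V) := {ω | ∀ k, 1 ≤ k → ω k ∉ A}

variable [MeasurableSpace V]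

/-- Equilibrium measure `e_A(x) = λ_x P_x(H̃_A = ∞) 1{x ∈ A}`. -/
def equi (lam : V → V → ℝ) (P : V → Measure (ℕ → V)) (A : Set V) (x : V) : ℝ :=
  if x ∈ A then lamTot lam x * (P x (avoidSet A)).toReal else 0

/-- Capacity `cap(A) = ∑_{x ∈ A} e_A(x)`. -/
def capa (lam : V → V → ℝ) (P : V → Measure (ℕ → V)) (A : Set V) : ℝ :=
  ∑' x : A, equi lam P A x

/-- Green function `g(x,y) = λ_y⁻¹ E_x[∑_k 1{X_k = y}]`. -/
def green (lam : V → V → ℝ) (P : V → Measure (ℕ → V)) (x y : V) : ℝ :=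
  (lamTot lam y)⁻¹ * ∑' k : ℕ, (P x {ω | ω k = y}).toReal

/-- The standing assumptions on the weighted graph `(G,λ)` with distance `dd`,
random-walk law `P`, volume exponent `α`, Green exponent `ν` and asymptotic
Green constants `c₃ ≤ C₃`. -/
structure Standing (lam dd : V → V → ℝ) (P : V → Measure (ℕ → V))
    (α ν c₃ C₃ : ℝ) : Prop where
  countable : Countable V
  lam_symm : ∀ x y, lam x y = lam y x
  lam_nonneg : ∀ x y, 0 ≤ lam x y
  lam_diag : ∀ x, lam x x = 0
  locFin : ∀ x, {y | 0 < lam x y}.Finite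
  dd_self : ∀ x, dd x x = 0
  dd_pos : ∀ x y, x ≠ y → 0 < dd x y
  dd_symm : ∀ x y, dd x y = dd y x
  dd_triangle : ∀ x y z, dd x z ≤ dd x y + dd y z
  prob : ∀ x, IsProbabilityMeasure (P x)
  start : ∀ x, P x {ω | ω 0 = x} = 1
  step : ∀ x y, P x {ω | ω 1 = y} = ENNReal.ofReal (lam x y / lamTot lam x)
  markov : ∀ (x y : V) (k : ℕ) (S : Set (ℕ → V)), MeasurableSet S →
    P x ({ω | ω k = y} ∩ {ω | (fun n => ω (k + n)) ∈ S}) = P x {ω | ω k = y} * P y S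
  nu_pos : 0 < ν
  nu_le : ν ≤ α - 2
  vol : ∃ c₁ C₁ : ℝ, 0 < c₁ ∧ c₁ ≤ C₁ ∧ ∀ (x : V) (r : ℝ), 1 ≤ r →
    c₁ * r ^ α ≤ ∑' y : vball dd x r, lamTot lam y ∧
      ∑' y : vball dd x r, lamTot lam y ≤ C₁ * r ^ α
  greenBounds : ∃ c₂ C₂ : ℝ, 0 < c₂ ∧ c₂ ≤ C₂ ∧
    (∀ x, c₂ ≤ green lam P x x ∧ green lam P x x ≤ C₂) ∧
    ∀ x y, x ≠ y → c₂ * dd x y ^ (-ν) ≤ green lam P x y ∧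
      green lam P x y ≤ C₂ * dd x y ^ (-ν)
  c₃_pos : 0 < c₃
  c₃_le_C₃ : c₃ ≤ C₃
  greenAsymp : ∀ η' : ℝ, 0 < η' → ∃ M : ℝ, ∀ x y, M ≤ dd x y →
    (1 - η') * c₃ ≤ green lam P x y * dd x y ^ ν ∧
      green lam P x y * dd x y ^ ν ≤ (1 + η') * C₃
  p0 : ∃ c : ℝ, 0 < c ∧ ∀ x y, 0 < lam x y → c ≤ lam x y / lamTot lam x

/-- The geodesic assumption: from every point there is an infinite
nearest-neighbour path along which `dd` is comparable to the index difference. -/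
def Geodesic (lam dd : V → V → ℝ) (c₄ C₄ : ℝ) : Prop :=
  ∀ x : V, ∃ γ : ℕ → V, γ 0 = x ∧ (∀ k : ℕ, 0 < lam (γ k) (γ (k + 1))) ∧
    ∀ k p : ℕ, c₄ * |(k : ℝ) - (p : ℝ)| - C₄ ≤ dd (γ k) (γ p) ∧
      dd (γ k) (γ p) ≤ c₄ * |(k : ℝ) - (p : ℝ)| + C₄

/-- The function `F_ν(x,y)`. -/
def Fnu (ν x y : ℝ) : ℝ :=
  if ν < 1 then x ^ ν
  else if ν = 1 then x / max 1 (Real.log (x / y))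
  else x * y ^ (ν - 1)

/-- `F_ν(x) = F_ν(x,1)`. -/
def Fnu1 (ν x : ℝ) : ℝ := Fnu ν x 1

/-- The constant `π⁻¹ B((1+ν)/2,(1+ν)/2) cos(πν/2)` for `ν < 1` and `1/2` for `ν = 1`
(the Beta function expressed through `Γ`). -/
def kappaNu (ν : ℝ) : ℝ :=
  if ν < 1 then
    Real.Gamma ((1 + ν) / 2) * Real.Gamma ((1 + ν) / 2) / Real.Gamma (1 + ν)
      * Real.cos (Real.pi * ν / 2) / Real.pi
  else 1 / 2

/-- `c_β`, defined by `c_β · C₃ = kappaNu ν`. -/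
def cBeta (ν C₃ : ℝ) : ℝ := kappaNu ν / C₃

/-- `C_β`, defined by `C_β · c₃ = kappaNu ν`. -/
def CBeta (ν c₃ : ℝ) : ℝ := kappaNu ν / c₃

/-- `a` and `b` are joined by a nearest-neighbour path inside `S`. -/
def connIn (lam : V → V → ℝ) (S : Set V) (a b : V) : Prop :=
  ∃ (m : ℕ) (γ : ℕ → V), γ 0 = a ∧ γ m = b ∧ (∀ i ≤ m, γ i ∈ S) ∧
    ∀ i < m, 0 < lam (γ i) (γ (i + 1))

/-- The set `X̄_A` of points visited by a trajectory strictly before exiting `A`. -/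
def visited (A : Set V) (ω : ℕ → V) : Set V :=
  {v | ∃ k : ℕ, (∀ n ≤ k, ω n ∈ A) ∧ ω k = v}

/-- Properties of the renormalised families `Λ(L)`. -/
structure LamFamily (dd : V → V → ℝ) (α : ℝ) (Lam : ℝ → Set V) : Prop where
  cover : ∀ L : ℝ, 1 ≤ L → ∀ x : V, ∃ y ∈ Lam L, dd y x ≤ L
  card : ∃ CΛ : ℝ, 0 < CΛ ∧ ∀ L : ℝ, 1 ≤ L → ∀ (x : V) (N : ℝ), 1 ≤ N →
    (Lam L ∩ vball dd x (L * N)).Finite ∧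
      ((Lam L ∩ vball dd x (L * N)).ncard : ℝ) ≤ CΛ * N ^ α
  one : Lam 1 = Set.univ

/-- `γ 0, …, γ m` is an `L`-nearest-neighbour path in `Λ(L)`. -/
def IsLPath (lam dd : V → V → ℝ) (Lam : ℝ → Set V) (L : ℝ) (γ : ℕ → V) (m : ℕ) : Prop :=
  (∀ i ≤ m, γ i ∈ Lam L) ∧ ∀ i < m,
    (1 < L ∧ ∃ a b, dd (γ i) a ≤ L ∧ dd (γ (i + 1)) b ≤ L ∧ 0 < lam a b) ∨
    (L = 1 ∧ 0 < lam (γ i) (γ (i + 1)))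

/-- FPP distance between `x` and `y` for the weights `t` at level `u`. -/
def fppDist {Ω : Type} (lam dd : V → V → ℝ) (Lam : ℝ → Set V)
    (t : V → ℝ → Ω → ℝ) (R u : ℝ) (ω : Ω) (x y : V) : ℝ≥0∞ :=
  ⨅ (γ : ℕ → V) (m : ℕ) (_ : IsLPath lam dd Lam R γ m ∧ γ 0 = x ∧ γ m = y),
    ∑ i ∈ Finset.range (m + 1), ENNReal.ofReal (t (γ i) u ω)

/-- FPP distance `d_{t,u}(x;L,N)` between `B(x,L) ∩ Λ(R)` and `B(x,N)ᶜ ∩ Λ(R)`. -/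
def fppDistAnn {Ω : Type} (lam dd : V → V → ℝ) (Lam : ℝ → Set V)
    (t : V → ℝ → Ω → ℝ) (R u : ℝ) (ω : Ω) (x : V) (L N : ℝ) : ℝ≥0∞ :=
  ⨅ (y : V) (_ : y ∈ Lam R ∧ dd x y ≤ L) (z : V) (_ : z ∈ Lam R ∧ ¬ dd x z ≤ N),
    fppDist lam dd Lam t R u ω y z

/-- The operator `f ↦ ((GV)f)(x) = ∑_y g(x,y)V(y)f(y)`. -/
def GVop (gr : V → V → ℝ) (Vf : V → ℝ) (f : V → ℝ) : V → ℝ :=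
  fun x => ∑' y, gr x y * Vf y * f y

/-- `(ℓ_{x,u})_{x,u}` is the local-time field of random interlacements:
nonnegative, nondecreasing and right-continuous in the level, with independent
stationary increments, and satisfying the interlacement Laplace identity. -/
structure LocalTimes {Ω : Type} [MeasurableSpace Ω] (μ : Measure Ω)
    (gr : V → V → ℝ) (ℓ : V → ℝ → Ω → ℝ) : Prop where
  nonneg : ∀ x u ω, 0 ≤ ℓ x u ω
  mono : ∀ x ω, MonotoneOn (fun u => ℓ x u ω) (Set.Ioi (0 : ℝ))
  rightCont : ∀ (x : V) (ω : Ω) (u : ℝ), 0 < u →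
    ContinuousWithinAt (fun v => ℓ x v ω) (Set.Ici u) u
  indep : ∀ u v : ℝ, 0 < u → u < v →
    ProbabilityTheory.IndepFun
      (fun ω => (fun x : V => ℓ x v ω - ℓ x u ω))
      (fun ω => (fun q : V × {s : ℝ // 0 < s ∧ s ≤ u} => ℓ q.1 q.2.1 ω)) μ
  stationary : ∀ u v : ℝ, 0 < u → u < v →
    Measure.map (fun ω => (fun x : V => ℓ x v ω - ℓ x u ω)) μ
      = Measure.map (fun ω => (fun x : V => ℓ x (v - u) ω)) μ
  laplace : ∀ u : ℝ, 0 < u → ∀ Vf : V → ℝ, (Function.support Vf).Finite →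
    (∃ r : ℝ, r < 1 ∧ ∀ x : V, ∑' y, |gr x y * Vf y| ≤ r) →
    ∫ ω, Real.exp (∑' x, Vf x * ℓ x u ω) ∂μ
      = Real.exp (u * ∑' x, Vf x * (∑' n : ℕ, (GVop gr Vf)^[n] (fun _ => 1) x))

/-- Admissible family of weights built from the local times in `B(z,3R)`,
all increasing (`inc = true`) or all decreasing (`inc = false`). -/
structure Admissible {Ω : Type} (dd : V → V → ℝ) (Lam : ℝ → Set V)
    (ℓ : V → ℝ → Ω → ℝ) (R : ℝ) (t : V → ℝ → Ω → ℝ) (inc : Bool) : Prop where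
  repr : ∃ gz : V → (V → ℝ) → ℝ,
    (∀ z ∈ Lam R, ∀ f : V → ℝ, (∀ x, 0 ≤ f x) → 0 ≤ gz z f) ∧
    (if inc then ∀ z ∈ Lam R, Monotone (gz z) else ∀ z ∈ Lam R, Antitone (gz z)) ∧
    ∀ z ∈ Lam R, ∀ u : ℝ, 0 < u → ∀ ω : Ω,
      t z u ω = gz z (fun x => if dd z x ≤ 3 * R then ℓ x u ω else 0)

/-- The set `ℒ_Θ` of pairs of levels. -/
def LTheta (inc : Bool) (Θ u v : ℝ) : Prop :=
  if inc then 0 < u ∧ u < v ∧ v < Θ * u else 0 < v ∧ v < u ∧ u < Θ * v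

section Potential

/-- The Laplacian of `f` at `x` on a locally finite weighted graph with neighbour sets `nb`. -/
def lap {G : Type} (lam : G → G → ℝ) (nb : G → Finset G) (f : G → ℝ) (x : G) : ℝ :=
  ∑ z ∈ nb x, lam x z * (f x - f z)

/-- The potential-theoretic data of a transient weighted graph: `g` is the Green function, `m` the
reversible measure, with polynomial volume growth and polynomial decay of the Green function. -/
structure PotData {G : Type} (lam dd g : G → G → ℝ) (m : G → ℝ) (nb : G → Finset G)
    (α ν c C J : ℝ) : Prop where
  mem_nb : ∀ x y, y ∈ nb x ↔ 0 < lam x y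
  lam_symm : ∀ x y, lam x y = lam y x
  dd_nonneg : ∀ x y, 0 ≤ dd x y
  dd_self : ∀ x, dd x x = 0
  dd_symm : ∀ x y, dd x y = dd y x
  dd_triangle : ∀ x y z, dd x z ≤ dd x y + dd y z
  finite_ball : ∀ x r, (vball dd x r).Finite
  one_le_J : 1 ≤ J
  jump : ∀ x y, 0 < lam x y → dd x y ≤ J
  g_symm : ∀ x y, g x y = g y x
  g_pos : ∀ x y, 0 < g x y
  g_diag : ∀ x, g x x ≤ C
  g_far : ∀ x y D, 0 < D → D ≤ dd x y → g x y ≤ C * D ^ (-ν)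
  g_near : ∀ x y D, 1 ≤ D → dd x y ≤ D → c * D ^ (-ν) ≤ g x y
  lap_g : ∀ x y, lap lam nb (fun z => g z y) x = if x = y then 1 else 0
  m_nonneg : ∀ x, 0 ≤ m x
  vol_ge : ∀ x r, 1 ≤ r → c * r ^ α ≤ ∑ y ∈ (finite_ball x r).toFinset, m y
  vol_le : ∀ x r, 1 ≤ r → ∑ y ∈ (finite_ball x r).toFinset, m y ≤ C * r ^ α
  nu_pos : 0 < ν
  nu_lt : ν < α
  c_pos : 0 < c
  c_le : c ≤ C

variable {G : Type} {lam dd g : G → G → ℝ} {m : G → ℝ} {nb : G → Finset G}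
  {α ν c C J : ℝ}

lemma lap_add (f h : G → ℝ) (x : G) :
    lap lam nb (fun z => f z + h z) x = lap lam nb f x + lap lam nb h x := by
  simp only [lap, ← Finset.sum_add_distrib]
  exact Finset.sum_congr rfl fun z _ => by ring

lemma lap_sub (f h : G → ℝ) (x : G) :
    lap lam nb (fun z => f z - h z) x = lap lam nb f x - lap lam nb h x := by
  simp only [lap, ← Finset.sum_sub_distrib]
  exact Finset.sum_congr rfl fun z _ => by ring

lemma lap_mul_left (a : ℝ) (f : G → ℝ) (x : G) :
    lap lam nb (fun z => a * f z) x = a * lap lam nb f x := by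
  simp only [lap, Finset.mul_sum]
  exact Finset.sum_congr rfl fun z _ => by ring

lemma lap_neg (f : G → ℝ) (x : G) :
    lap lam nb (fun z => - f z) x = - lap lam nb f x := by
  simpa using lap_mul_left (lam := lam) (nb := nb) (-1) f x

lemma lap_const (a : ℝ) (x : G) : lap lam nb (fun _ => a) x = 0 := by
  simp [lap]

lemma lap_sum {ι : Type*} (s : Finset ι) (f : ι → G → ℝ) (x : G) :
    lap lam nb (fun z => ∑ i ∈ s, f i z) x = ∑ i ∈ s, lap lam nb (f i) x := by
  simp only [lap, ← Finset.sum_sub_distrib, Finset.mul_sum]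
  exact Finset.sum_comm

lemma PotData.lam_pos (h : PotData lam dd g m nb α ν c C J) {x z : G} (hz : z ∈ nb x) :
    0 < lam x z := (h.mem_nb x z).1 hz

lemma PotData.lap_nonpos (h : PotData lam dd g m nb α ν c C J) {f : G → ℝ} {x : G}
    (hf : ∀ z ∈ nb x, f x ≤ f z) : lap lam nb f x ≤ 0 :=
  Finset.sum_nonpos fun z hz =>
    mul_nonpos_of_nonneg_of_nonpos (h.lam_pos hz).le (sub_nonpos.2 (hf z hz))

lemma PotData.C_pos (h : PotData lam dd g m nb α ν c C J) : 0 < C := h.c_pos.trans_le h.c_le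

/-- The minimum principle on a finite set. -/
lemma PotData.nonneg_of_finset (h : PotData lam dd g m nb α ν c C J) (U : Finset G) {f : G → ℝ}
    (hL : ∀ x ∈ U, 0 ≤ lap lam nb f x) (hb : ∀ x ∈ U, ∀ z ∈ nb x, z ∉ U → 0 ≤ f z) :
    ∀ x ∈ U, 0 ≤ f x := by
  intro x hx
  have hG : ∀ w, 0 ≤ ∑ y ∈ U, g w y := fun w => Finset.sum_nonneg fun y _ => (h.g_pos w y).le
  have key : ∀ t : ℝ, 0 < t → 0 ≤ f x + t * ∑ y ∈ U, g x y := by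
    intro t ht
    obtain ⟨x0, hx0, hmin⟩ := U.exists_min_image (fun w => f w + t * ∑ y ∈ U, g w y) ⟨x, hx⟩
    by_contra hneg
    push Not at hneg
    have h0 : f x0 + t * ∑ y ∈ U, g x0 y < 0 := (hmin x hx).trans_lt hneg
    have h1 : lap lam nb (fun w => f w + t * ∑ y ∈ U, g w y) x0 ≤ 0 := by
      refine h.lap_nonpos fun z hz => ?_
      by_cases hzU : z ∈ U
      · exact hmin z hzU
      · exact h0.le.trans (add_nonneg (hb x0 hx0 z hz hzU) (mul_nonneg ht.le (hG z)))
    rw [lap_add, lap_mul_left, lap_sum] at h1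
    simp only [h.lap_g, Finset.sum_ite_eq, hx0, if_true, mul_one] at h1
    linarith [hL x0 hx0]
  by_contra hneg
  push Not at hneg
  have h2 := key (-f x / (2 * (∑ y ∈ U, g x y + 1)))
    (div_pos (by linarith) (by linarith [hG x]))
  have h3 : -f x / (2 * (∑ y ∈ U, g x y + 1)) * ∑ y ∈ U, g x y ≤ -f x / 2 := by
    rw [div_mul_eq_mul_div, div_le_div_iff₀ (by linarith [hG x]) two_pos]
    nlinarith [hG x]
  linarith

/-- The minimum principle outside a finite set for functions vanishing at infinity. -/
lemma PotData.nonneg_of_vanish (h : PotData lam dd g m nb α ν c C J) (S : Finset G) {f : G → ℝ}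
    (hS : ∀ x ∈ S, 0 ≤ f x) (hL : ∀ x ∉ S, 0 ≤ lap lam nb f x)
    (hv : ∀ t : ℝ, 0 < t → {w | f w < -t}.Finite) (x : G) : 0 ≤ f x := by
  refine le_of_forall_pos_lt_add fun t ht => ?_
  by_contra hneg
  push Not at hneg
  have hfin := hv (t / 2) (by linarith)
  have hx : x ∈ hfin.toFinset := by
    simp only [Finite.mem_toFinset, mem_ofPred_eq]; linarith
  have := h.nonneg_of_finset hfin.toFinset (f := fun w => f w + t / 2) ?_ ?_ x hx
  · linarith
  · intro y hy
    rw [lap_add, lap_const, add_zero]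
    refine hL y fun hyS => ?_
    simp only [Finite.mem_toFinset, mem_ofPred_eq] at hy
    linarith [hS y hyS]
  · intro y _ z _ hz
    simp only [Finite.mem_toFinset, mem_ofPred_eq, not_lt] at hz
    linarith

lemma PotData.finite_ge_green (h : PotData lam dd g m nb α ν c C J) (x : G) {t : ℝ} (ht : 0 < t) :
    {w | t ≤ g w x}.Finite := by
  have h1 : Tendsto (fun D : ℝ => C * D ^ (-ν)) atTop (𝓝 (C * 0)) :=
    (tendsto_rpow_neg_atTop h.nu_pos).const_mul C
  rw [mul_zero] at h1
  obtain ⟨D, hD, hD0⟩ := ((h1.eventually (gt_mem_nhds ht)).and (eventually_gt_atTop 0)).exists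
  refine (h.finite_ball x D).subset fun w hw => ?_
  by_contra hc
  have hc' : D < dd x w := not_le.1 hc
  have := h.g_far w x D hD0 (by rw [h.dd_symm]; exact hc'.le)
  have hw' : t ≤ g w x := hw
  linarith

lemma PotData.finite_green_sum (h : PotData lam dd g m nb α ν c C J) (S : Finset G) (a : G → ℝ)
    {t : ℝ} (ht : 0 < t) : {w | t < |∑ x ∈ S, g w x * a x|}.Finite := by
  have hs : 0 ≤ ∑ x ∈ S, |a x| := Finset.sum_nonneg fun _ _ => abs_nonneg _
  have ht' : 0 < t / (∑ x ∈ S, |a x| + 1) := div_pos ht (by linarith)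
  refine (S.finite_toSet.biUnion fun x _ => h.finite_ge_green x ht').subset fun w hw => ?_
  by_contra hc
  simp only [mem_iUnion, not_exists, mem_ofPred_eq, not_le] at hc
  have : |∑ x ∈ S, g w x * a x| ≤ t := by
    calc |∑ x ∈ S, g w x * a x| ≤ ∑ x ∈ S, |g w x * a x| := Finset.abs_sum_le_sum_abs _ _
      _ ≤ ∑ x ∈ S, t / (∑ x ∈ S, |a x| + 1) * |a x| := by
          refine Finset.sum_le_sum fun x hx => ?_
          rw [abs_mul, abs_of_pos (h.g_pos w x)]
          exact mul_le_mul_of_nonneg_right (hc x hx).le (abs_nonneg _)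
      _ = t * (∑ x ∈ S, |a x|) / (∑ x ∈ S, |a x| + 1) := by rw [← Finset.mul_sum]; ring
      _ ≤ t := by rw [div_le_iff₀ (by linarith)]; nlinarith
  exact absurd hw (not_lt.2 this)

lemma PotData.lap_green_sum (h : PotData lam dd g m nb α ν c C J) (S : Finset G) (a : G → ℝ)
    (w : G) : lap lam nb (fun w => ∑ x ∈ S, g w x * a x) w = if w ∈ S then a w else 0 := by
  have h1 : ∀ i, lap lam nb (fun z => g z i * a i) w = if w = i then a i else 0 := by
    intro i
    have := lap_mul_left (lam := lam) (nb := nb) (a i) (fun z => g z i) w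
    simp only [mul_comm (a i), h.lap_g] at this
    rw [this]; split_ifs <;> simp
  rw [lap_sum]
  simp only [h1, Finset.sum_ite_eq]

/-- The Green function restricted to a finite set is invertible, with symmetric inverse. -/
lemma PotData.exists_inverse (h : PotData lam dd g m nb α ν c C J) (S : Finset G) :
    ∃ A : G → G → ℝ, (∀ x y, A x y = A y x) ∧
      ∀ x ∈ S, ∀ y ∈ S, ∑ z ∈ S, g x z * A z y = if x = y then 1 else 0 := by
  let M : Matrix S S ℝ := Matrix.of fun x y => g x y
  have hdet : M.det ≠ 0 := by
    intro h0
    obtain ⟨v, hv, hMv⟩ := Matrix.exists_mulVec_eq_zero_iff.2 h0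
    apply hv
    let a : G → ℝ := fun x => if hx : x ∈ S then v ⟨x, hx⟩ else 0
    have hsum : ∀ w, ∑ x ∈ S, g w x * a x = ∑ x : S, g w x * v x := by
      intro w
      rw [← Finset.sum_coe_sort S]
      exact Finset.sum_congr rfl fun x _ => by simp [a]
    have hzero : ∀ x ∈ S, ∑ y ∈ S, g x y * a y = 0 := by
      intro x hx
      rw [hsum]
      exact congrFun hMv ⟨x, hx⟩
    have hle : ∀ x, 0 ≤ ∑ y ∈ S, g x y * a y := by
      refine h.nonneg_of_vanish S (fun x hx => (hzero x hx).ge) (fun x hx => ?_) fun t ht =>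
        (h.finite_green_sum S a ht).subset fun w hw => ?_
      · rw [h.lap_green_sum, if_neg hx]
      · exact lt_abs.2 (Or.inr (by rw [mem_ofPred_eq] at hw; exact lt_neg_of_lt_neg hw))
    have hge : ∀ x, 0 ≤ -∑ y ∈ S, g x y * a y := by
      refine h.nonneg_of_vanish S (fun x hx => by rw [hzero x hx, neg_zero]) (fun x hx => ?_)
        fun t ht => (h.finite_green_sum S a ht).subset fun w hw => ?_
      · rw [lap_neg, h.lap_green_sum, if_neg hx, neg_zero]
      · exact lt_abs.2 (Or.inl (by rw [mem_ofPred_eq] at hw; exact neg_lt_neg_iff.1 hw))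
    have h0' : (fun x => ∑ y ∈ S, g x y * a y) = fun _ => 0 :=
      funext fun x => le_antisymm (by linarith [hge x]) (hle x)
    ext x
    have := h.lap_green_sum S a x
    rw [h0', lap_const, if_pos x.2] at this
    simpa [a] using this.symm
  have hu : IsUnit M.det := hdet.isUnit
  have hMs : M.transpose = M := by ext x y; exact h.g_symm _ _
  have hinv : (M⁻¹).transpose = M⁻¹ := by rw [Matrix.transpose_nonsing_inv, hMs]
  refine ⟨fun x y => if hx : x ∈ S ∧ y ∈ S then M⁻¹ ⟨x, hx.1⟩ ⟨y, hx.2⟩ else 0, ?_, ?_⟩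
  · intro x y
    by_cases hx : x ∈ S <;> by_cases hy : y ∈ S <;> simp [hx, hy]
    exact congrFun (congrFun hinv ⟨y, hy⟩) ⟨x, hx⟩
  · intro x hx y hy
    have h1 := congrFun (congrFun (Matrix.mul_nonsing_inv M hu) ⟨x, hx⟩) ⟨y, hy⟩
    rw [Matrix.mul_apply, Matrix.one_apply] at h1
    simp only [Subtype.mk.injEq] at h1
    rw [← h1, ← Finset.sum_coe_sort S]
    exact Finset.sum_congr rfl fun z _ => by simp [hy, M]

end Potential

section Equilibrium

variable {G : Type} {lam dd g : G → G → ℝ} {m : G → ℝ} {nb : G → Finset G}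
  {α ν c C J : ℝ}

/-- `A` is a symmetric matrix inverting the Green function restricted to `S`. -/
structure IsGreenInv (g : G → G → ℝ) (S : Finset G) (A : G → G → ℝ) : Prop where
  symm : ∀ x y, A x y = A y x
  inv : ∀ x ∈ S, ∀ y ∈ S, ∑ z ∈ S, g x z * A z y = if x = y then 1 else 0

/-- The harmonic extension of the indicator of `y ∈ S`. -/
def hext (g : G → G → ℝ) (S : Finset G) (A : G → G → ℝ) (y w : G) : ℝ :=
  ∑ x ∈ S, g w x * A x y

/-- The equilibrium measure of `S`, as the row sums of the inverse of the Green function. -/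
def eqm (S : Finset G) (A : G → G → ℝ) (z : G) : ℝ := ∑ y ∈ S, A z y

/-- The escape probability from `S`. -/
def escp (g : G → G → ℝ) (S : Finset G) (A : G → G → ℝ) (w : G) : ℝ :=
  1 - ∑ x ∈ S, g w x * eqm S A x

variable {S : Finset G} {A : G → G → ℝ}

lemma sum_green_eqm (hA : IsGreenInv g S A) {x : G} (hx : x ∈ S) :
    ∑ y ∈ S, g x y * eqm S A y = 1 := by
  simp only [eqm, Finset.mul_sum]
  rw [Finset.sum_comm]
  calc ∑ y ∈ S, ∑ z ∈ S, g x z * A z y = ∑ y ∈ S, if x = y then 1 else 0 :=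
        Finset.sum_congr rfl fun y hy => hA.inv x hx y hy
    _ = 1 := by simp [hx]

lemma escp_eq_zero (hA : IsGreenInv g S A) {x : G} (hx : x ∈ S) : escp g S A x = 0 := by
  rw [escp, sum_green_eqm hA hx, sub_self]

lemma PotData.lap_hext (h : PotData lam dd g m nb α ν c C J) (y w : G) :
    lap lam nb (hext g S A y) w = if w ∈ S then A w y else 0 :=
  h.lap_green_sum S (fun x => A x y) w

lemma PotData.lap_escp (h : PotData lam dd g m nb α ν c C J) (w : G) :
    lap lam nb (escp g S A) w = if w ∈ S then - eqm S A w else 0 := by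
  have := h.lap_green_sum S (eqm S A) w
  change lap lam nb (fun w => 1 - ∑ x ∈ S, g w x * eqm S A x) w = _
  rw [lap_sub (fun _ => (1 : ℝ)), lap_const, this]
  split_ifs <;> simp

lemma PotData.hext_nonneg (h : PotData lam dd g m nb α ν c C J) (hA : IsGreenInv g S A)
    {y : G} (hy : y ∈ S) (w : G) : 0 ≤ hext g S A y w := by
  refine h.nonneg_of_vanish S (fun x hx => ?_) (fun x hx => ?_) (fun t ht =>
    (h.finite_green_sum S (fun x => A x y) ht).subset fun w hw => ?_) w
  · rw [hext, hA.inv x hx y hy]; split_ifs <;> norm_num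
  · rw [h.lap_hext, if_neg hx]
  · rw [mem_ofPred_eq] at hw
    exact lt_abs.2 (Or.inr (lt_neg_of_lt_neg hw))

lemma PotData.inv_offdiag (h : PotData lam dd g m nb α ν c C J) (hA : IsGreenInv g S A)
    {y z : G} (hy : y ∈ S) (hz : z ∈ S) (hyz : z ≠ y) : A z y ≤ 0 := by
  have h1 := h.lap_hext (S := S) (A := A) y z
  rw [if_pos hz] at h1
  rw [← h1]
  refine h.lap_nonpos fun w _ => ?_
  rw [show hext g S A y z = 0 by rw [hext, hA.inv z hz y hy, if_neg hyz]]
  exact h.hext_nonneg hA hy w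

lemma PotData.escp_nonneg (h : PotData lam dd g m nb α ν c C J) (hA : IsGreenInv g S A)
    (w : G) : 0 ≤ escp g S A w := by
  refine h.nonneg_of_vanish S (fun x hx => (escp_eq_zero hA hx).ge) (fun x hx => ?_) (fun t ht =>
    (h.finite_green_sum S (eqm S A) zero_lt_one).subset fun w hw => ?_) w
  · rw [h.lap_escp, if_neg hx]
  · rw [mem_ofPred_eq, escp] at hw
    have : 1 < ∑ x ∈ S, g w x * eqm S A x := by linarith
    exact lt_abs.2 (Or.inl this)

lemma PotData.eqm_nonneg (h : PotData lam dd g m nb α ν c C J) (hA : IsGreenInv g S A)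
    {z : G} (hz : z ∈ S) : 0 ≤ eqm S A z := by
  have h1 := h.lap_escp (S := S) (A := A) z
  rw [if_pos hz] at h1
  have := h.lap_nonpos (f := escp g S A) (x := z) fun w _ => by
    rw [escp_eq_zero hA hz]; exact h.escp_nonneg hA w
  linarith

lemma PotData.half_le_escp (h : PotData lam dd g m nb α ν c C J) (hA : IsGreenInv g S A)
    {w : G} {D : ℝ} (hD : 0 < D) (hw : ∀ x ∈ S, D ≤ dd w x)
    (hcap : C * D ^ (-ν) * ∑ x ∈ S, eqm S A x ≤ 1 / 2) : 1 / 2 ≤ escp g S A w := by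
  have : ∑ x ∈ S, g w x * eqm S A x ≤ C * D ^ (-ν) * ∑ x ∈ S, eqm S A x := by
    rw [Finset.mul_sum]
    exact Finset.sum_le_sum fun x hx =>
      mul_le_mul_of_nonneg_right (h.g_far w x D hD (hw x hx)) (h.eqm_nonneg hA hx)
  rw [escp]; linarith

/-- The off-diagonal block of the inverse Green function between two distant sets is small compared
with the product of the equilibrium measures. -/
lemma PotData.neg_inv_le (h : PotData lam dd g m nb α ν c C J) (hA : IsGreenInv g S A)
    {x₁ x₂ : G} {r ρ : ℝ} (hρr : r ≤ ρ / 2) (hρJ : J ≤ ρ / 2)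
    (hS : ∀ x ∈ S, dd x₁ x ≤ r ∨ dd x₂ x ≤ r) (hx : 5 * ρ ≤ dd x₁ x₂)
    (hcap : C * (ρ / 2) ^ (-ν) * ∑ x ∈ S, eqm S A x ≤ 1 / 2)
    {z y : G} (hz : z ∈ S) (hz1 : dd x₁ z ≤ r) (hy : y ∈ S) (hy2 : dd x₂ y ≤ r) :
    - A z y ≤ 4 * C * ρ ^ (-ν) * (eqm S A z * eqm S A y) := by
  have hρ : 0 < ρ := by linarith [h.one_le_J]
  have hCρ : 0 < C * ρ ^ (-ν) := mul_pos h.C_pos (Real.rpow_pos_of_pos hρ _)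
  -- points in the annulus `ρ < d(x_i,·) ≤ 2ρ` have escape probability at least `1/2`
  have hesc : ∀ (a b : G), 5 * ρ ≤ dd a b → (∀ x ∈ S, dd a x ≤ r ∨ dd b x ≤ r) →
      ∀ w, ρ < dd a w → dd a w ≤ 2 * ρ → 1 / 2 ≤ escp g S A w := by
    intro a b hab hSab w hw1 hw2
    refine h.half_le_escp hA (half_pos hρ) (fun x hx => ?_) hcap
    rcases hSab x hx with hx' | hx'
    · linarith [h.dd_triangle a x w, h.dd_symm x w]
    · linarith [h.dd_triangle a w b, h.dd_triangle w x b, h.dd_symm x b]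
  have hx' : 5 * ρ ≤ dd x₂ x₁ := by rw [h.dd_symm]; exact hx
  have hS' : ∀ x ∈ S, dd x₂ x ≤ r ∨ dd x₁ x ≤ r := fun x hx => (hS x hx).symm
  have hout : ∀ (a w w' : G), dd a w ≤ ρ → w' ∈ nb w → ¬ dd a w' ≤ ρ →
      ρ < dd a w' ∧ dd a w' ≤ 2 * ρ := by
    intro a w w' hw hw' hn
    have := h.jump w w' (h.lam_pos hw')
    exact ⟨not_le.1 hn, by linarith [h.dd_triangle a w w']⟩
  -- first step: bound on the hitting probability from the boundary of the first ball
  have step1 : ∀ w, ρ < dd x₁ w → dd x₁ w ≤ 2 * ρ →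
      hext g S A y w ≤ 2 * (C * ρ ^ (-ν)) * eqm S A y := by
    intro w hw1 hw2
    let f : G → ℝ := fun y' => 2 * (C * ρ ^ (-ν)) * escp g S A y' -
      (g y' w - ∑ x ∈ S, g y' x * hext g S A x w)
    have hfS : ∀ y' ∈ S, f y' = 0 := by
      intro y' hy'
      have h1 : ∑ x ∈ S, g y' x * hext g S A x w = g y' w := by
        simp only [hext, Finset.mul_sum]
        rw [Finset.sum_comm]
        have : ∀ i ∈ S, ∑ x ∈ S, g y' x * (g w i * A i x) = if y' = i then g w i else 0 := by
          intro i hi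
          have h2 := hA.inv y' hy' i hi
          calc ∑ x ∈ S, g y' x * (g w i * A i x) = g w i * ∑ x ∈ S, g y' x * A x i := by
                rw [Finset.mul_sum]
                exact Finset.sum_congr rfl fun x _ => by rw [hA.symm i x]; ring
            _ = _ := by rw [h2]; split_ifs <;> simp
        rw [Finset.sum_congr rfl this, Finset.sum_ite_eq, if_pos hy', h.g_symm]
      simp only [f, h1, escp_eq_zero hA hy']
      ring
    have hLf : ∀ y', lap lam nb f y' = 2 * (C * ρ ^ (-ν)) * (if y' ∈ S then - eqm S A y' else 0) -
        ((if y' = w then 1 else 0) - if y' ∈ S then hext g S A y' w else 0) := by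
      intro y'
      simp only [f]
      rw [lap_sub (fun y' => 2 * (C * ρ ^ (-ν)) * escp g S A y'), lap_mul_left,
        lap_sub (fun y' => g y' w), h.lap_g, h.lap_green_sum S (fun x => hext g S A x w)]
      have := h.lap_escp (S := S) (A := A) y'
      rw [show lap lam nb (fun z => escp g S A z) y' = lap lam nb (escp g S A) y' from rfl, this]
    have hball : ∀ y', dd x₂ y' ≤ ρ → y' ≠ w := by
      rintro y' hy' rfl
      linarith [h.dd_triangle x₁ y' x₂, h.dd_symm x₂ y']
    have hf : ∀ y', dd x₂ y' ≤ ρ → 0 ≤ f y' := by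
      intro y' hy'
      by_cases hyS : y' ∈ S
      · exact (hfS y' hyS).ge
      refine h.nonneg_of_finset ((h.finite_ball x₂ ρ).toFinset \ S) ?_ ?_ y' (by simp [hyS]; exact hy')
      · intro p hp
        simp only [Finset.mem_sdiff, Finite.mem_toFinset] at hp
        rw [hLf, if_neg hp.2, if_neg hp.2, if_neg (hball p hp.1)]
        simp
      · intro p hp q hq hqU
        simp only [Finset.mem_sdiff, Finite.mem_toFinset] at hp hqU
        by_cases hqS : q ∈ S
        · exact (hfS q hqS).ge
        · have hq2 : ¬ dd x₂ q ≤ ρ := fun hc => hqU ⟨hc, hqS⟩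
          obtain ⟨ha, hb⟩ := hout x₂ p q hp.1 hq hq2
          have he := hesc x₂ x₁ hx' hS' q ha hb
          have hg : g q w ≤ C * ρ ^ (-ν) := by
            refine h.g_far q w ρ hρ ?_
            linarith [h.dd_triangle x₁ w x₂, h.dd_triangle w q x₂, h.dd_symm q x₂, h.dd_symm q w]
          have hn : 0 ≤ ∑ x ∈ S, g q x * hext g S A x w := Finset.sum_nonneg fun x hx =>
            mul_nonneg (h.g_pos _ _).le (h.hext_nonneg hA hx w)
          have : C * ρ ^ (-ν) ≤ 2 * (C * ρ ^ (-ν)) * escp g S A q := by nlinarith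
          simp only [f]
          linarith
    have hfy := h.lap_nonpos (f := f) (x := y) fun q hq => by
      rw [hfS y hy]
      refine hf q ?_
      linarith [h.dd_triangle x₂ y q, h.jump y q (h.lam_pos hq)]
    rw [hLf, if_pos hy, if_pos hy, if_neg (hball y (by linarith))] at hfy
    linarith
  -- second step: minimum principle in the first ball
  have hey := h.eqm_nonneg hA hy
  let f : G → ℝ := fun w => 4 * (C * ρ ^ (-ν)) * eqm S A y * escp g S A w - hext g S A y w
  have hdist : ∀ w, dd x₁ w ≤ ρ → w ≠ y := by
    rintro w hw rfl
    linarith [h.dd_triangle x₁ w x₂, h.dd_symm x₂ w]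
  have hfS : ∀ w ∈ S, dd x₁ w ≤ ρ → f w = 0 := by
    intro w hw hw1
    have h1 : hext g S A y w = 0 := by rw [hext, hA.inv w hw y hy, if_neg (hdist w hw1)]
    simp only [f, h1, escp_eq_zero hA hw]; ring
  have hLf : ∀ w, lap lam nb f w = 4 * (C * ρ ^ (-ν)) * eqm S A y *
      (if w ∈ S then - eqm S A w else 0) - if w ∈ S then A w y else 0 := by
    intro w
    simp only [f]
    rw [lap_sub (fun w => 4 * (C * ρ ^ (-ν)) * eqm S A y * escp g S A w), lap_mul_left]
    rw [← h.lap_escp (S := S) (A := A) w, ← h.lap_hext (S := S) (A := A) y w]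
  have hf : ∀ w, dd x₁ w ≤ ρ → 0 ≤ f w := by
    intro w hw
    by_cases hwS : w ∈ S
    · exact (hfS w hwS hw).ge
    refine h.nonneg_of_finset ((h.finite_ball x₁ ρ).toFinset \ S) ?_ ?_ w (by simp [hwS]; exact hw)
    · intro p hp
      simp only [Finset.mem_sdiff, Finite.mem_toFinset] at hp
      rw [hLf, if_neg hp.2, if_neg hp.2]
      simp
    · intro p hp q hq hqU
      simp only [Finset.mem_sdiff, Finite.mem_toFinset] at hp hqU
      by_cases hq1 : dd x₁ q ≤ ρ
      · have hqS : q ∈ S := by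
          by_contra hc
          exact hqU ⟨hq1, hc⟩
        exact (hfS q hqS hq1).ge
      · obtain ⟨ha, hb⟩ := hout x₁ p q hp.1 hq hq1
        have he := hesc x₁ x₂ hx hS q ha hb
        have h1 := step1 q ha hb
        have : 2 * (C * ρ ^ (-ν)) * eqm S A y ≤
            4 * (C * ρ ^ (-ν)) * eqm S A y * escp g S A q := by
          have := mul_nonneg hCρ.le hey
          nlinarith
        simp only [f]; linarith
  have hfz := h.lap_nonpos (f := f) (x := z) fun q hq => by
    rw [hfS z hz (by linarith)]
    refine hf q ?_
    linarith [h.dd_triangle x₁ z q, h.jump z q (h.lam_pos hq)]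
  rw [hLf, if_pos hz, if_pos hz] at hfz
  linarith

end Equilibrium

section Capacity

variable {G : Type} {lam dd g : G → G → ℝ} {m : G → ℝ} {nb : G → Finset G}
  {α ν c C J : ℝ} {S : Finset G} {A : G → G → ℝ}

lemma PotData.green_le (h : PotData lam dd g m nb α ν c C J) (x y : G) : g x y ≤ C := by
  have h1 : 0 ≤ g y y - g x y := by
    refine h.nonneg_of_vanish {y} (f := fun w => g y y - g w y) (fun w hw => ?_) (fun w hw => ?_)
      (fun t ht => (h.finite_ge_green y ht).subset fun w hw => ?_) x
    · rw [Finset.mem_singleton.1 hw, sub_self]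
    · rw [lap_sub (fun _ => g y y), lap_const, h.lap_g, if_neg (by simpa using hw), sub_zero]
    · rw [mem_ofPred_eq] at hw ⊢
      linarith [h.g_pos y y]
  linarith [h.g_diag y]

lemma PotData.sum_ball_le (h : PotData lam dd g m nb α ν c C J)
    (hA : IsGreenInv g S A) (x₁ : G) {r : ℝ} (hr : 1 ≤ r) :
    ∑ x ∈ S.filter (fun x => dd x₁ x ≤ r), eqm S A x ≤ c⁻¹ * (2 * r) ^ ν := by
  rcases (S.filter (fun x => dd x₁ x ≤ r)).eq_empty_or_nonempty with h0 | ⟨x, hx⟩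
  · rw [h0, Finset.sum_empty]
    exact mul_nonneg (inv_nonneg.2 h.c_pos.le) (Real.rpow_nonneg (by linarith) _)
  · have hx' := Finset.mem_filter.1 hx
    have h1 := sum_green_eqm hA hx'.1
    have h2 : c * (2 * r) ^ (-ν) * ∑ y ∈ S.filter (fun x => dd x₁ x ≤ r), eqm S A y ≤ 1 := by
      rw [← h1, Finset.mul_sum]
      calc ∑ y ∈ S.filter (fun x => dd x₁ x ≤ r), c * (2 * r) ^ (-ν) * eqm S A y
          ≤ ∑ y ∈ S.filter (fun x => dd x₁ x ≤ r), g x y * eqm S A y := by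
            refine Finset.sum_le_sum fun y hy => ?_
            have hy' := Finset.mem_filter.1 hy
            refine mul_le_mul_of_nonneg_right (h.g_near x y _ (by linarith) ?_)
              (h.eqm_nonneg hA hy'.1)
            linarith [h.dd_triangle x x₁ y, h.dd_symm x x₁]
        _ ≤ _ := Finset.sum_le_sum_of_subset_of_nonneg (Finset.filter_subset _ _)
            fun y hy _ => mul_nonneg (h.g_pos _ _).le (h.eqm_nonneg hA hy)
    have hpos : 0 < (2 * r) ^ ν := Real.rpow_pos_of_pos (by linarith) _
    rw [Real.rpow_neg (by linarith)] at h2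
    have hc := h.c_pos
    field_simp at h2 ⊢
    linarith

lemma PotData.cap_le (h : PotData lam dd g m nb α ν c C J)
    (hA : IsGreenInv g S A) {x₁ x₂ : G} {r : ℝ} (hr : 1 ≤ r)
    (hS : ∀ x ∈ S, dd x₁ x ≤ r ∨ dd x₂ x ≤ r) :
    ∑ x ∈ S, eqm S A x ≤ 2 * (c⁻¹ * (2 * r) ^ ν) := by
  have h1 := h.sum_ball_le hA x₁ hr
  have h2 := h.sum_ball_le hA x₂ hr
  have : ∑ x ∈ S, eqm S A x ≤ ∑ x ∈ S.filter (fun x => dd x₁ x ≤ r), eqm S A x +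
      ∑ x ∈ S.filter (fun x => dd x₂ x ≤ r), eqm S A x := by
    rw [Finset.sum_filter, Finset.sum_filter, ← Finset.sum_add_distrib]
    refine Finset.sum_le_sum fun x hx => ?_
    have := h.eqm_nonneg hA hx
    rcases hS x hx with h' | h' <;> simp only [h', if_true] <;> split_ifs <;> linarith
  linarith

/-- The potential of a ball grows at most like `r ^ (α - ν)`. -/
lemma PotData.exists_potential_le (h : PotData lam dd g m nb α ν c C J) :
    ∃ K : ℝ, 0 < K ∧ ∀ (y : G) (ρ : ℝ), 1 ≤ ρ →
      ∑ x ∈ (h.finite_ball y ρ).toFinset, m x * g x y ≤ K * ρ ^ (α - ν) := by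
  have hαν : 0 < α - ν := sub_pos.2 h.nu_lt
  have hC := h.C_pos
  set q : ℝ := (1 / 2 : ℝ) ^ (α - ν) with hq
  have hq1 : q < 1 := Real.rpow_lt_one (by norm_num) (by norm_num) hαν
  have hq0 : 0 < q := Real.rpow_pos_of_pos (by norm_num) _
  set K : ℝ := C * C * 2 ^ α + C * C * 2 ^ ν / (1 - q) with hK
  have h1q : 0 < 1 - q := by linarith
  have hCC : 0 < C * C := mul_pos hC hC
  have h2a : (0:ℝ) < 2 ^ α := Real.rpow_pos_of_pos two_pos _
  have h2n : (0:ℝ) < 2 ^ ν := Real.rpow_pos_of_pos two_pos _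
  have hKpos : 0 < K := add_pos (mul_pos hCC h2a) (div_pos (mul_pos hCC h2n) h1q)
  refine ⟨K, hKpos, fun y => ?_⟩
  have key : ∀ n : ℕ, ∀ ρ : ℝ, 1 ≤ ρ → ρ ≤ 2 ^ (n + 1) →
      ∑ x ∈ (h.finite_ball y ρ).toFinset, m x * g x y ≤ K * ρ ^ (α - ν) := by
    intro n
    induction n with
    | zero =>
      intro ρ h1 h2
      have h3 : ∑ x ∈ (h.finite_ball y ρ).toFinset, m x * g x y ≤
          (∑ x ∈ (h.finite_ball y ρ).toFinset, m x) * C := by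
        rw [Finset.sum_mul]
        exact Finset.sum_le_sum fun x _ => mul_le_mul_of_nonneg_left (h.green_le x y) (h.m_nonneg x)
      have h4 := h.vol_le y ρ h1
      have h5 : ρ ^ α ≤ 2 ^ α :=
        Real.rpow_le_rpow (by linarith) (by simpa using h2) (by linarith [h.nu_pos])
      have h6 : 1 ≤ ρ ^ (α - ν) := Real.one_le_rpow h1 hαν.le
      have h7 : C * C * 2 ^ α ≤ K := by
        rw [hK]; linarith [div_pos (mul_pos hCC h2n) h1q]
      calc _ ≤ C * ρ ^ α * C := h3.trans (mul_le_mul_of_nonneg_right h4 hC.le)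
        _ ≤ C * C * 2 ^ α := by nlinarith
        _ ≤ K * ρ ^ (α - ν) := by nlinarith
    | succ n ih =>
      intro ρ h1 h2
      by_cases h3 : ρ ≤ 2 ^ (n + 1)
      · exact ih ρ h1 h3
      push Not at h3
      have hρ2 : 1 ≤ ρ / 2 := by
        have : (2:ℝ) ≤ 2 ^ (n + 1) := by
          calc (2:ℝ) = 2 ^ 1 := by norm_num
            _ ≤ _ := pow_le_pow_right₀ (by norm_num) (by omega)
        linarith
      have ih' := ih (ρ / 2) hρ2 (by rw [pow_succ] at h2; linarith)
      have hsub : (h.finite_ball y (ρ / 2)).toFinset ⊆ (h.finite_ball y ρ).toFinset := by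
        intro x hx
        simp only [Finite.mem_toFinset, vball, mem_ofPred_eq] at hx ⊢
        linarith
      rw [← Finset.sum_sdiff hsub]
      have hann : ∑ x ∈ (h.finite_ball y ρ).toFinset \ (h.finite_ball y (ρ / 2)).toFinset,
          m x * g x y ≤ C * ρ ^ α * (C * (ρ / 2) ^ (-ν)) := by
        have hm : ∑ x ∈ (h.finite_ball y ρ).toFinset \ (h.finite_ball y (ρ / 2)).toFinset, m x ≤
            C * ρ ^ α :=
          (Finset.sum_le_sum_of_subset_of_nonneg Finset.sdiff_subset
            fun x _ _ => h.m_nonneg x).trans (h.vol_le y ρ h1)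
        refine le_trans ?_ (mul_le_mul_of_nonneg_right hm
          (mul_nonneg hC.le (Real.rpow_nonneg (by linarith) _)))
        rw [Finset.sum_mul]
        refine Finset.sum_le_sum fun x hx => mul_le_mul_of_nonneg_left ?_ (h.m_nonneg x)
        simp only [Finset.mem_sdiff, Finite.mem_toFinset, vball, mem_ofPred_eq, not_le] at hx
        exact h.g_far x y _ (by linarith) (by rw [h.dd_symm]; exact hx.2.le)
      have e1 : (ρ / 2) ^ (α - ν) = q * ρ ^ (α - ν) := by
        rw [hq, div_eq_mul_one_div, Real.mul_rpow (by linarith) (by norm_num), mul_comm]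
      have e2 : C * ρ ^ α * (C * (ρ / 2) ^ (-ν)) = C * C * 2 ^ ν * ρ ^ (α - ν) := by
        rw [Real.div_rpow (by linarith) (by norm_num), Real.rpow_neg two_pos.le, sub_eq_add_neg,
          Real.rpow_add (by linarith)]
        field_simp
      have e3 : C * C * 2 ^ ν ≤ K * (1 - q) := by
        rw [hK, add_mul, div_mul_cancel₀ _ h1q.ne']
        nlinarith [mul_pos hCC h2a]
      have e4 : 0 < ρ ^ (α - ν) := Real.rpow_pos_of_pos (by linarith) _
      rw [e2] at hann
      rw [e1] at ih'
      nlinarith [mul_le_mul_of_nonneg_right e3 e4.le]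
  intro ρ hρ
  obtain ⟨n, hn⟩ := pow_unbounded_of_one_lt ρ (one_lt_two : (1:ℝ) < 2)
  exact key n ρ hρ (hn.le.trans (pow_le_pow_right₀ (by norm_num) (by omega)))

/-- A finite set containing a ball of radius `r` has capacity at least of order `r ^ ν`. -/
lemma PotData.exists_le_cap (h : PotData lam dd g m nb α ν c C J) :
    ∃ K : ℝ, 0 < K ∧ ∀ (S : Finset G) (A : G → G → ℝ), IsGreenInv g S A →
      ∀ (x₁ : G) (r : ℝ), 1 ≤ r → (∀ x, dd x₁ x ≤ r → x ∈ S) →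
      K * r ^ ν ≤ ∑ x ∈ S, eqm S A x := by
  obtain ⟨K, hK, hpot⟩ := h.exists_potential_le
  have hC := h.C_pos
  have hK' : 0 < K + C * C := by nlinarith
  refine ⟨c / (K + C * C), div_pos h.c_pos hK', fun S A hA x₁ r hr hS => ?_⟩
  have hrn : 0 < r ^ (α - ν) := Real.rpow_pos_of_pos (by linarith) _
  set B := (h.finite_ball x₁ r).toFinset with hB
  have hBS : ∀ x ∈ B, x ∈ S := by
    intro x hx
    simp only [hB, Finite.mem_toFinset, vball, mem_ofPred_eq] at hx
    exact hS x hx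
  have hy : ∀ y, ∑ x ∈ B, m x * g x y ≤ (K + C * C) * r ^ (α - ν) := by
    intro y
    rw [← Finset.sum_filter_add_sum_filter_not B (fun x => dd y x ≤ r)]
    have h1 : ∑ x ∈ B.filter (fun x => dd y x ≤ r), m x * g x y ≤ K * r ^ (α - ν) := by
      refine (Finset.sum_le_sum_of_subset_of_nonneg ?_ fun x _ _ =>
        mul_nonneg (h.m_nonneg x) (h.g_pos x y).le).trans (hpot y r hr)
      intro x hx
      simp only [Finite.mem_toFinset, vball, mem_ofPred_eq]
      exact (Finset.mem_filter.1 hx).2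
    have h2 : ∑ x ∈ B.filter (fun x => ¬ dd y x ≤ r), m x * g x y ≤ C * r ^ α * (C * r ^ (-ν)) := by
      have hm : ∑ x ∈ B.filter (fun x => ¬ dd y x ≤ r), m x ≤ C * r ^ α :=
        (Finset.sum_le_sum_of_subset_of_nonneg (Finset.filter_subset _ _)
          fun x _ _ => h.m_nonneg x).trans (h.vol_le x₁ r hr)
      refine le_trans ?_ (mul_le_mul_of_nonneg_right hm
        (mul_nonneg hC.le (Real.rpow_nonneg (by linarith) _)))
      rw [Finset.sum_mul]
      refine Finset.sum_le_sum fun x hx => mul_le_mul_of_nonneg_left ?_ (h.m_nonneg x)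
      have := (Finset.mem_filter.1 hx).2
      exact h.g_far x y _ (by linarith) (by rw [h.dd_symm]; linarith)
    have e : C * r ^ α * (C * r ^ (-ν)) = C * C * r ^ (α - ν) := by
      rw [sub_eq_add_neg, Real.rpow_add (by linarith)]; ring
    linarith
  have hmass : ∑ x ∈ B, m x = ∑ y ∈ S, eqm S A y * ∑ x ∈ B, m x * g x y := by
    calc ∑ x ∈ B, m x = ∑ x ∈ B, m x * ∑ y ∈ S, g x y * eqm S A y :=
          Finset.sum_congr rfl fun x hx => by rw [sum_green_eqm hA (hBS x hx), mul_one]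
      _ = _ := by
          simp only [Finset.mul_sum]
          rw [Finset.sum_comm]
          exact Finset.sum_congr rfl fun y _ => Finset.sum_congr rfl fun x _ => by ring
  have h3 : c * r ^ α ≤ (∑ y ∈ S, eqm S A y) * ((K + C * C) * r ^ (α - ν)) := by
    refine (h.vol_ge x₁ r hr).trans ?_
    rw [← hB, hmass, Finset.sum_mul]
    exact Finset.sum_le_sum fun y hyS => mul_le_mul_of_nonneg_left (hy y) (h.eqm_nonneg hA hyS)
  have e : r ^ α = r ^ ν * r ^ (α - ν) := by
    rw [← Real.rpow_add (by linarith)]; congr 1; ring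
  rw [e, ← mul_assoc, ← mul_assoc] at h3
  have h4 := le_of_mul_le_mul_right h3 hrn
  rw [div_mul_eq_mul_div, div_le_iff₀ hK']
  exact h4

end Capacity

section Series

variable {K : Type}

/-- The pairing of a power series with nonnegative coefficients, viewed as a measure on
multi-indices, with a nonnegative function. -/
def psInt (p : MvPowerSeries K ℝ≥0∞) (F : (K →₀ ℕ) → ℝ≥0∞) : ℝ≥0∞ :=
  ∑' d, MvPowerSeries.coeff d p * F d

/-- The total mass of a power series with nonnegative coefficients. -/
def psMass (p : MvPowerSeries K ℝ≥0∞) : ℝ≥0∞ := psInt p fun _ => 1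

/-- The coefficientwise order on power series. -/
def PsLe (p q : MvPowerSeries K ℝ≥0∞) : Prop :=
  ∀ d, MvPowerSeries.coeff d p ≤ MvPowerSeries.coeff d q

lemma PsLe.refl (p : MvPowerSeries K ℝ≥0∞) : PsLe p p := fun _ => le_rfl

lemma PsLe.trans {p q r : MvPowerSeries K ℝ≥0∞} (h : PsLe p q) (h' : PsLe q r) : PsLe p r :=
  fun d => (h d).trans (h' d)

lemma PsLe.add {p q p' q' : MvPowerSeries K ℝ≥0∞} (h : PsLe p q) (h' : PsLe p' q') :
    PsLe (p + p') (q + q') := fun d => by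
  simp only [map_add]; exact add_le_add (h d) (h' d)

lemma PsLe.mul {p q p' q' : MvPowerSeries K ℝ≥0∞} (h : PsLe p q) (h' : PsLe p' q') :
    PsLe (p * p') (q * q') := fun d => by
  simp only [MvPowerSeries.coeff_mul]
  exact Finset.sum_le_sum fun a _ => mul_le_mul' (h a.1) (h' a.2)

lemma PsLe.smul {p q : MvPowerSeries K ℝ≥0∞} {a b : ℝ≥0∞} (hab : a ≤ b) (h : PsLe p q) :
    PsLe (a • p) (b • q) := fun d => by
  simp only [map_smul, smul_eq_mul]; exact mul_le_mul' hab (h d)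

lemma PsLe.sum {ι : Type*} (s : Finset ι) {p q : ι → MvPowerSeries K ℝ≥0∞}
    (h : ∀ i ∈ s, PsLe (p i) (q i)) : PsLe (∑ i ∈ s, p i) (∑ i ∈ s, q i) := fun d => by
  simp only [map_sum]; exact Finset.sum_le_sum fun i hi => h i hi d

lemma PsLe.exists_add {p q : MvPowerSeries K ℝ≥0∞} (h : PsLe p q) : ∃ r, q = p + r := by
  let r : MvPowerSeries K ℝ≥0∞ := fun d => MvPowerSeries.coeff d q - MvPowerSeries.coeff d p
  have hr : ∀ d, MvPowerSeries.coeff d r = MvPowerSeries.coeff d q - MvPowerSeries.coeff d p :=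
    fun _ => rfl
  refine ⟨r, MvPowerSeries.ext fun d => ?_⟩
  rw [map_add, hr, add_tsub_cancel_of_le (h d)]

lemma psInt_mono_left {p q : MvPowerSeries K ℝ≥0∞} (h : PsLe p q) (F : (K →₀ ℕ) → ℝ≥0∞) :
    psInt p F ≤ psInt q F := ENNReal.tsum_le_tsum fun d => mul_le_mul_left (h d) _

lemma psInt_mono_right (p : MvPowerSeries K ℝ≥0∞) {F F' : (K →₀ ℕ) → ℝ≥0∞} (h : ∀ d, F d ≤ F' d) :
    psInt p F ≤ psInt p F' := ENNReal.tsum_le_tsum fun d => mul_le_mul_right (h d) _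

lemma psInt_add (p q : MvPowerSeries K ℝ≥0∞) (F : (K →₀ ℕ) → ℝ≥0∞) :
    psInt (p + q) F = psInt p F + psInt q F := by
  simp only [psInt, map_add, add_mul, ENNReal.tsum_add]

lemma psInt_add_right (p : MvPowerSeries K ℝ≥0∞) (F F' : (K →₀ ℕ) → ℝ≥0∞) :
    psInt p (fun d => F d + F' d) = psInt p F + psInt p F' := by
  simp only [psInt, mul_add, ENNReal.tsum_add]

lemma psInt_smul (a : ℝ≥0∞) (p : MvPowerSeries K ℝ≥0∞) (F : (K →₀ ℕ) → ℝ≥0∞) :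
    psInt (a • p) F = a * psInt p F := by
  simp only [psInt, map_smul, smul_eq_mul, mul_assoc, ENNReal.tsum_mul_left]

lemma psInt_const_mul (a : ℝ≥0∞) (p : MvPowerSeries K ℝ≥0∞) (F : (K →₀ ℕ) → ℝ≥0∞) :
    psInt p (fun d => a * F d) = a * psInt p F := by
  simp only [psInt, mul_left_comm _ a, ENNReal.tsum_mul_left]

lemma psInt_zero (F : (K →₀ ℕ) → ℝ≥0∞) : psInt 0 F = 0 := by simp [psInt]

lemma psInt_sum {ι : Type*} (s : Finset ι) (p : ι → MvPowerSeries K ℝ≥0∞)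
    (F : (K →₀ ℕ) → ℝ≥0∞) : psInt (∑ i ∈ s, p i) F = ∑ i ∈ s, psInt (p i) F := by
  induction s using Finset.induction_on with
  | empty => simp [psInt_zero]
  | insert i s hi ih => rw [Finset.sum_insert hi, Finset.sum_insert hi, psInt_add, ih]

lemma psInt_monomial (e : K →₀ ℕ) (a : ℝ≥0∞) (F : (K →₀ ℕ) → ℝ≥0∞) :
    psInt (MvPowerSeries.monomial e a) F = a * F e := by
  rw [psInt, tsum_eq_single e fun d hd => by rw [MvPowerSeries.coeff_monomial_ne hd, zero_mul],
    MvPowerSeries.coeff_monomial_same]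

lemma psInt_one (F : (K →₀ ℕ) → ℝ≥0∞) : psInt 1 F = F 0 := by
  rw [← MvPowerSeries.monomial_zero_one, psInt_monomial, one_mul]

lemma tsum_sum_antidiagonal {A : Type*} [AddCommMonoid A] [Finset.HasAntidiagonal A]
    (f : A → A → ℝ≥0∞) :
    ∑' n, ∑ x ∈ Finset.HasAntidiagonal.antidiagonal n, f x.1 x.2 = ∑' a, ∑' b, f a b := by
  have h1 : ∀ n : A, ∑ x ∈ Finset.HasAntidiagonal.antidiagonal n, f x.1 x.2 =
      ∑' x : Finset.HasAntidiagonal.antidiagonal n, f x.1.1 x.1.2 := by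
    intro n
    rw [tsum_fintype, Finset.sum_coe_sort (Finset.HasAntidiagonal.antidiagonal n)
      (fun x => f x.1 x.2)]
  rw [tsum_congr h1, ← ENNReal.tsum_sigma' (fun s : (Σ n : A,
    {x // x ∈ Finset.HasAntidiagonal.antidiagonal n}) => f s.2.1.1 s.2.1.2),
    ← (Finset.HasAntidiagonal.sigmaAntidiagonalEquivProd (A := A)).symm.tsum_eq, ← ENNReal.tsum_prod]
  rfl

lemma psInt_mul (p q : MvPowerSeries K ℝ≥0∞) (F : (K →₀ ℕ) → ℝ≥0∞) :
    psInt (p * q) F = ∑' a, MvPowerSeries.coeff a p * psInt q fun b => F (a + b) := by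
  have h1 : psInt (p * q) F = ∑' d, ∑ x ∈ Finset.HasAntidiagonal.antidiagonal d,
      MvPowerSeries.coeff x.1 p * (MvPowerSeries.coeff x.2 q * F (x.1 + x.2)) := by
    refine tsum_congr fun d => ?_
    rw [MvPowerSeries.coeff_mul, Finset.sum_mul]
    exact Finset.sum_congr rfl fun x hx => by
      rw [Finset.HasAntidiagonal.mem_antidiagonal.1 hx, mul_assoc]
  rw [h1, tsum_sum_antidiagonal (fun a b =>
    MvPowerSeries.coeff a p * (MvPowerSeries.coeff b q * F (a + b)))]
  exact tsum_congr fun a => by rw [psInt, ENNReal.tsum_mul_left]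

lemma psInt_mul_of_multiplicative {F : (K →₀ ℕ) → ℝ≥0∞} (hF : ∀ a b, F (a + b) = F a * F b)
    (p q : MvPowerSeries K ℝ≥0∞) : psInt (p * q) F = psInt p F * psInt q F := by
  simp only [psInt_mul, hF, psInt_const_mul]
  rw [psInt.eq_1 p, ← ENNReal.tsum_mul_right]
  exact tsum_congr fun a => by ring

lemma psInt_pow_of_multiplicative {F : (K →₀ ℕ) → ℝ≥0∞} (hF : ∀ a b, F (a + b) = F a * F b)
    (hF0 : F 0 = 1) (p : MvPowerSeries K ℝ≥0∞) (k : ℕ) : psInt (p ^ k) F = psInt p F ^ k := by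
  induction k with
  | zero => rw [pow_zero, pow_zero, psInt_one, hF0]
  | succ k ih => rw [pow_succ, pow_succ, psInt_mul_of_multiplicative hF, ih]

lemma psMass_mul (p q : MvPowerSeries K ℝ≥0∞) : psMass (p * q) = psMass p * psMass q :=
  psInt_mul_of_multiplicative (fun _ _ => (one_mul 1).symm) p q

lemma psMass_pow (p : MvPowerSeries K ℝ≥0∞) (k : ℕ) : psMass (p ^ k) = psMass p ^ k :=
  psInt_pow_of_multiplicative (fun _ _ => (one_mul 1).symm) rfl p k

lemma psInt_le_mass (p : MvPowerSeries K ℝ≥0∞) {F : (K →₀ ℕ) → ℝ≥0∞} (hF : ∀ d, F d ≤ 1) :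
    psInt p F ≤ psMass p := psInt_mono_right p hF

lemma le_psInt_mul (p q : MvPowerSeries K ℝ≥0∞) {F : (K →₀ ℕ) → ℝ≥0∞} (hF : Monotone F) :
    psInt p F * psMass q ≤ psInt (p * q) F := by
  rw [psInt_mul, psInt, ← ENNReal.tsum_mul_right]
  refine ENNReal.tsum_le_tsum fun a => ?_
  rw [mul_assoc]
  refine mul_le_mul_right ?_ _
  rw [psMass, ← psInt_const_mul]
  exact psInt_mono_right q fun b => by rw [mul_one]; exact hF le_self_add

/-- The exponential series on `ℝ≥0∞`. -/
def eexp (a : ℝ≥0∞) : ℝ≥0∞ := ∑' k : ℕ, ((k.factorial : ℝ≥0∞))⁻¹ * a ^ k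

lemma eexp_ofReal {t : ℝ} (ht : 0 ≤ t) : eexp (ENNReal.ofReal t) = ENNReal.ofReal (Real.exp t) := by
  have h := NormedSpace.expSeries_div_hasSum_exp (𝔸 := ℝ) t
  rw [← Real.exp_eq_exp_ℝ] at h
  rw [← h.tsum_eq, ENNReal.ofReal_tsum_of_nonneg (fun n => by positivity) h.summable]
  refine tsum_congr fun k => ?_
  rw [ENNReal.ofReal_div_of_pos (by positivity), ENNReal.ofReal_pow ht, ENNReal.ofReal_natCast,
    ENNReal.div_eq_inv_mul]

lemma eexp_eq {a : ℝ≥0∞} (ha : a ≠ ⊤) : eexp a = ENNReal.ofReal (Real.exp a.toReal) := by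
  rw [← eexp_ofReal ENNReal.toReal_nonneg, ENNReal.ofReal_toReal ha]

lemma eexp_ne_zero {a : ℝ≥0∞} (ha : a ≠ ⊤) : eexp a ≠ 0 := by
  rw [eexp_eq ha]; simp [Real.exp_pos]

lemma eexp_ne_top {a : ℝ≥0∞} (ha : a ≠ ⊤) : eexp a ≠ ⊤ := by
  rw [eexp_eq ha]; exact ENNReal.ofReal_ne_top

lemma eexp_add {a b : ℝ≥0∞} (ha : a ≠ ⊤) (hb : b ≠ ⊤) : eexp (a + b) = eexp a * eexp b := by
  rw [eexp_eq ha, eexp_eq hb, eexp_eq (ENNReal.add_ne_top.2 ⟨ha, hb⟩), ENNReal.toReal_add ha hb,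
    Real.exp_add, ENNReal.ofReal_mul (Real.exp_pos _).le]

/-- The (unnormalised) compound Poisson pairing with jump measure `p`. -/
def cpInt (p : MvPowerSeries K ℝ≥0∞) (F : (K →₀ ℕ) → ℝ≥0∞) : ℝ≥0∞ :=
  ∑' k : ℕ, ((k.factorial : ℝ≥0∞))⁻¹ * psInt (p ^ k) F

/-- The compound Poisson expectation with jump measure `p`. -/
def cpLaw (p : MvPowerSeries K ℝ≥0∞) (F : (K →₀ ℕ) → ℝ≥0∞) : ℝ≥0∞ :=
  (eexp (psMass p))⁻¹ * cpInt p F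

lemma cpInt_of_multiplicative {F : (K →₀ ℕ) → ℝ≥0∞} (hF : ∀ a b, F (a + b) = F a * F b)
    (hF0 : F 0 = 1) (p : MvPowerSeries K ℝ≥0∞) : cpInt p F = eexp (psInt p F) := by
  simp only [cpInt, eexp, psInt_pow_of_multiplicative hF hF0]

lemma cpInt_one (p : MvPowerSeries K ℝ≥0∞) : cpInt p (fun _ => 1) = eexp (psMass p) :=
  cpInt_of_multiplicative (fun _ _ => (one_mul 1).symm) rfl p

lemma cpLaw_one {p : MvPowerSeries K ℝ≥0∞} (hp : psMass p ≠ ⊤) : cpLaw p (fun _ => 1) = 1 := by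
  rw [cpLaw, cpInt_one, ENNReal.inv_mul_cancel (eexp_ne_zero hp) (eexp_ne_top hp)]

lemma cpLaw_add_right (p : MvPowerSeries K ℝ≥0∞) (F F' : (K →₀ ℕ) → ℝ≥0∞) :
    cpLaw p (fun d => F d + F' d) = cpLaw p F + cpLaw p F' := by
  simp only [cpLaw, cpInt, psInt_add_right, mul_add, ENNReal.tsum_add]

lemma cpLaw_compl {p : MvPowerSeries K ℝ≥0∞} (hp : psMass p ≠ ⊤) {F : (K →₀ ℕ) → ℝ≥0∞}
    (hF : ∀ d, F d ≤ 1) : cpLaw p F + cpLaw p (fun d => 1 - F d) = 1 := by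
  rw [← cpLaw_add_right]
  simp only [add_tsub_cancel_of_le (hF _)]
  exact cpLaw_one hp

lemma cpLaw_le_one {p : MvPowerSeries K ℝ≥0∞} (hp : psMass p ≠ ⊤) {F : (K →₀ ℕ) → ℝ≥0∞}
    (hF : ∀ d, F d ≤ 1) : cpLaw p F ≤ 1 := by
  rw [← cpLaw_compl hp hF]; exact le_self_add

lemma cpInt_add (p q : MvPowerSeries K ℝ≥0∞) (F : (K →₀ ℕ) → ℝ≥0∞) :
    cpInt (p + q) F = ∑' i : ℕ, ∑' j : ℕ, ((i.factorial : ℝ≥0∞))⁻¹ * ((j.factorial : ℝ≥0∞))⁻¹ *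
      psInt (p ^ i * q ^ j) F := by
  have h1 : ∀ k : ℕ, ((k.factorial : ℝ≥0∞))⁻¹ * psInt ((p + q) ^ k) F =
      ∑ x ∈ Finset.HasAntidiagonal.antidiagonal k, ((x.1.factorial : ℝ≥0∞))⁻¹ *
        ((x.2.factorial : ℝ≥0∞))⁻¹ * psInt (p ^ x.1 * q ^ x.2) F := by
    intro k
    rw [Commute.add_pow' (Commute.all p q), psInt_sum, Finset.mul_sum]
    refine Finset.sum_congr rfl fun x hx => ?_
    have hk := Finset.HasAntidiagonal.mem_antidiagonal.1 hx
    rw [← Nat.cast_smul_eq_nsmul ℝ≥0∞, psInt_smul, ← mul_assoc]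
    congr 1
    have hfac : ((k.choose x.1 : ℕ) : ℝ≥0∞) * (x.1.factorial : ℝ≥0∞) * (x.2.factorial : ℝ≥0∞) =
        (k.factorial : ℝ≥0∞) := by
      have := Nat.choose_mul_factorial_mul_factorial (Nat.le_add_right x.1 x.2)
      rw [Nat.add_sub_cancel_left, hk] at this
      exact_mod_cast this
    have hn : ∀ n : ℕ, (n.factorial : ℝ≥0∞) ≠ 0 := fun n => by
      exact_mod_cast n.factorial_ne_zero
    have ht : ∀ n : ℕ, (n.factorial : ℝ≥0∞) ≠ ⊤ := fun n => ENNReal.natCast_ne_top _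
    rw [← ENNReal.mul_inv (Or.inl (hn _)) (Or.inl (ht _)), ← hfac, mul_assoc,
      ENNReal.mul_inv (Or.inr (ENNReal.mul_ne_top (ht _) (ht _)))
        (Or.inr (mul_ne_zero (hn _) (hn _))), mul_comm, ← mul_assoc,
      ENNReal.mul_inv_cancel, one_mul]
    · exact_mod_cast (Nat.choose_pos (by omega)).ne'
    · exact ENNReal.natCast_ne_top _
  rw [cpInt, tsum_congr h1, tsum_sum_antidiagonal (A := ℕ) (fun i j : ℕ => ((i.factorial : ℝ≥0∞))⁻¹ *
    ((j.factorial : ℝ≥0∞))⁻¹ * psInt (p ^ i * q ^ j) F)]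

lemma psMass_add (p q : MvPowerSeries K ℝ≥0∞) : psMass (p + q) = psMass p + psMass q :=
  psInt_add p q _

/-- Compound Poisson laws increase stochastically with the jump measure. -/
lemma cpLaw_mono_left {p q : MvPowerSeries K ℝ≥0∞} (h : PsLe p q) (hq : psMass q ≠ ⊤)
    {F : (K →₀ ℕ) → ℝ≥0∞} (hF : Monotone F) : cpLaw p F ≤ cpLaw q F := by
  obtain ⟨r, rfl⟩ := h.exists_add
  rw [psMass_add] at hq
  obtain ⟨hp, hr⟩ := ENNReal.add_ne_top.1 hq
  have h1 : cpInt p F * eexp (psMass r) ≤ cpInt (p + r) F := by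
    rw [cpInt_add, cpInt, ← ENNReal.tsum_mul_right]
    refine ENNReal.tsum_le_tsum fun i => ?_
    rw [eexp, ← ENNReal.tsum_mul_left]
    refine ENNReal.tsum_le_tsum fun j => ?_
    calc _ = ((i.factorial : ℝ≥0∞))⁻¹ * ((j.factorial : ℝ≥0∞))⁻¹ *
          (psInt (p ^ i) F * psMass (r ^ j)) := by rw [psMass_pow]; ring
      _ ≤ _ := mul_le_mul_right (le_psInt_mul _ _ hF) _
  rw [cpLaw, cpLaw, psMass_add, eexp_add hp hr, ENNReal.mul_inv (Or.inl (eexp_ne_zero hp))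
    (Or.inl (eexp_ne_top hp)), mul_assoc]
  refine mul_le_mul_right ?_ _
  rw [mul_comm]
  calc cpInt p F = cpInt p F * eexp (psMass r) * (eexp (psMass r))⁻¹ := by
        rw [mul_assoc, ENNReal.mul_inv_cancel (eexp_ne_zero hr) (eexp_ne_top hr), mul_one]
    _ ≤ _ := mul_le_mul_left h1 _

/-- A power series only involving the variables in `T`. -/
def PsDep (T : Set K) (p : MvPowerSeries K ℝ≥0∞) : Prop :=
  ∀ d : K →₀ ℕ, MvPowerSeries.coeff d p ≠ 0 → ∀ x ∉ T, d x = 0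

lemma PsDep.mul {T : Set K} {p q : MvPowerSeries K ℝ≥0∞} (hp : PsDep T p) (hq : PsDep T q) :
    PsDep T (p * q) := by
  intro d hd x hx
  rw [MvPowerSeries.coeff_mul] at hd
  obtain ⟨a, ha, hne⟩ := Finset.exists_ne_zero_of_sum_ne_zero hd
  rw [← Finset.HasAntidiagonal.mem_antidiagonal.1 ha, Finsupp.add_apply, hp _ (left_ne_zero_of_mul hne) x hx,
    hq _ (right_ne_zero_of_mul hne) x hx]

lemma PsDep.monomial {T : Set K} (e : K →₀ ℕ) (a : ℝ≥0∞) (he : ∀ x ∉ T, e x = 0) :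
    PsDep T (MvPowerSeries.monomial e a) := by
  intro d hd
  by_cases h : d = e
  · rwa [h]
  · exact absurd (MvPowerSeries.coeff_monomial_ne h a) hd

lemma PsDep.one (T : Set K) : PsDep T 1 := by
  rw [← MvPowerSeries.monomial_zero_one]
  exact PsDep.monomial 0 1 fun _ _ => rfl

lemma PsDep.pow {T : Set K} {p : MvPowerSeries K ℝ≥0∞} (hp : PsDep T p) (k : ℕ) :
    PsDep T (p ^ k) := by
  induction k with
  | zero => rw [pow_zero]; exact PsDep.one T
  | succ k ih => rw [pow_succ]; exact ih.mul hp

lemma PsDep.smul {T : Set K} {p : MvPowerSeries K ℝ≥0∞} (a : ℝ≥0∞) (hp : PsDep T p) :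
    PsDep T (a • p) := by
  intro d hd
  rw [map_smul, smul_eq_mul] at hd
  exact hp d (right_ne_zero_of_mul hd)

lemma PsDep.sum {T : Set K} {ι : Type*} (s : Finset ι) {p : ι → MvPowerSeries K ℝ≥0∞}
    (hp : ∀ i ∈ s, PsDep T (p i)) : PsDep T (∑ i ∈ s, p i) := by
  intro d hd
  rw [map_sum] at hd
  obtain ⟨i, hi, hne⟩ := Finset.exists_ne_zero_of_sum_ne_zero hd
  exact hp i hi d hne

lemma PsDep.add {T : Set K} {p q : MvPowerSeries K ℝ≥0∞} (hp : PsDep T p) (hq : PsDep T q) :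
    PsDep T (p + q) := by
  intro d hd
  rw [map_add] at hd
  by_cases h : MvPowerSeries.coeff d p = 0
  · rw [h, zero_add] at hd; exact hq d hd
  · exact hp d h

/-- Under a compound Poisson law whose jumps live on two disjoint blocks, functions of the two blocks
are independent. -/
lemma cpLaw_mul {T₁ T₂ : Set K} {p q : MvPowerSeries K ℝ≥0∞} (hp : PsDep T₁ p) (hq : PsDep T₂ q)
    (hpm : psMass p ≠ ⊤) (hqm : psMass q ≠ ⊤) {F₁ F₂ : (K →₀ ℕ) → ℝ≥0∞}
    (h₁ : ∀ a b : K →₀ ℕ, (∀ x ∉ T₂, b x = 0) → F₁ (a + b) = F₁ a)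
    (h₂ : ∀ a b : K →₀ ℕ, (∀ x ∉ T₁, a x = 0) → F₂ (a + b) = F₂ b) :
    cpLaw (p + q) (fun d => F₁ d * F₂ d) = cpLaw (p + q) F₁ * cpLaw (p + q) F₂ := by
  have key : ∀ F₁ F₂ : (K →₀ ℕ) → ℝ≥0∞,
      (∀ a b : K →₀ ℕ, (∀ x ∉ T₂, b x = 0) → F₁ (a + b) = F₁ a) →
      (∀ a b : K →₀ ℕ, (∀ x ∉ T₁, a x = 0) → F₂ (a + b) = F₂ b) →
      cpInt (p + q) (fun d => F₁ d * F₂ d) = cpInt p F₁ * cpInt q F₂ := by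
    intro F₁ F₂ h₁ h₂
    rw [cpInt_add, cpInt, ← ENNReal.tsum_mul_right]
    refine tsum_congr fun i => ?_
    rw [cpInt, ← ENNReal.tsum_mul_left]
    refine tsum_congr fun j => ?_
    have : psInt (p ^ i * q ^ j) (fun d => F₁ d * F₂ d) = psInt (p ^ i) F₁ * psInt (q ^ j) F₂ := by
      rw [psInt_mul, psInt, ← ENNReal.tsum_mul_right]
      refine tsum_congr fun a => ?_
      by_cases ha : MvPowerSeries.coeff a (p ^ i) = 0
      · simp [ha]
      have hb : psInt (q ^ j) (fun b => F₁ (a + b) * F₂ (a + b)) =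
          psInt (q ^ j) (fun b => F₁ a * F₂ b) := by
        unfold psInt
        refine tsum_congr fun b => ?_
        by_cases hb : MvPowerSeries.coeff b (q ^ j) = 0
        · simp [hb]
        simp only [h₁ a b (hq.pow j b hb), h₂ a b (hp.pow i a ha)]
      rw [mul_assoc, hb, psInt_const_mul]
    rw [this]; ring
  have e1 := key F₁ (fun _ => 1) h₁ fun _ _ _ => rfl
  have e2 := key (fun _ => 1) F₂ (fun _ _ _ => rfl) h₂
  simp only [mul_one, one_mul, cpInt_one] at e1 e2
  rw [cpLaw, cpLaw, cpLaw, key F₁ F₂ h₁ h₂, e1, e2, psMass_add, eexp_add hpm hqm,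
    ENNReal.mul_inv (Or.inl (eexp_ne_zero hpm)) (Or.inl (eexp_ne_top hpm))]
  have hp1 := ENNReal.inv_mul_cancel (eexp_ne_zero hpm) (eexp_ne_top hpm)
  have hq1 := ENNReal.inv_mul_cancel (eexp_ne_zero hqm) (eexp_ne_top hqm)
  calc _ = (eexp (psMass p))⁻¹ * (eexp (psMass q))⁻¹ * (cpInt p F₁ * cpInt q F₂) *
        ((eexp (psMass p))⁻¹ * eexp (psMass p)) * ((eexp (psMass q))⁻¹ * eexp (psMass q)) := by
        rw [hp1, hq1, mul_one, mul_one]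
    _ = _ := by ring

lemma cpLaw_antitone_le {p q : MvPowerSeries K ℝ≥0∞} (hp : psMass p ≠ ⊤) (hq : psMass q ≠ ⊤)
    {F : (K →₀ ℕ) → ℝ≥0∞} (hF1 : ∀ d, F d ≤ 1) {err : ℝ≥0∞}
    (h : cpLaw q (fun d => 1 - F d) ≤ cpLaw p (fun d => 1 - F d) + err) :
    cpLaw p F ≤ cpLaw q F + err := by
  have hfin : cpLaw p (fun d => 1 - F d) ≠ ⊤ :=
    ne_top_of_le_ne_top ENNReal.one_ne_top (cpLaw_le_one hp fun d => tsub_le_self)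
  refine ENNReal.le_of_add_le_add_right hfin ?_
  rw [cpLaw_compl hp hF1, add_assoc, add_comm err]
  exact (cpLaw_compl hq hF1).symm.le.trans (add_le_add le_rfl h)

end Series

section Threshold

variable {K : Type}

/-- The geometric series `∑ⱼ η^j N^(j+1)`. -/
def psGeom (η : ℝ≥0∞) (N : MvPowerSeries K ℝ≥0∞) : MvPowerSeries K ℝ≥0∞ :=
  fun d => ∑' j : ℕ, η ^ j * MvPowerSeries.coeff d (N ^ (j + 1))

lemma psInt_psGeom_mul (η : ℝ≥0∞) (N p : MvPowerSeries K ℝ≥0∞) (F : (K →₀ ℕ) → ℝ≥0∞) :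
    psInt (psGeom η N * p) F = ∑' j : ℕ, η ^ j * psInt (N ^ (j + 1) * p) F := by
  have h : ∀ d, MvPowerSeries.coeff d (psGeom η N) =
      ∑' j : ℕ, η ^ j * MvPowerSeries.coeff d (N ^ (j + 1)) := fun _ => rfl
  simp only [psInt_mul, h, ← ENNReal.tsum_mul_right, ← ENNReal.tsum_mul_left]
  rw [ENNReal.tsum_comm]
  simp only [mul_assoc]

lemma psMass_psGeom (η : ℝ≥0∞) (N : MvPowerSeries K ℝ≥0∞) :
    psMass (psGeom η N) = ∑' j : ℕ, η ^ j * psMass N ^ (j + 1) := by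
  have := psInt_psGeom_mul η N 1 fun _ => 1
  simp only [mul_one] at this
  simp only [← psMass_pow]
  exact this

lemma PsLe.psGeom {n N : MvPowerSeries K ℝ≥0∞} {η : ℝ≥0∞} (h : PsLe n (N + η • (N * n)))
    (hn : psMass n ≠ ⊤) (hθ : η * psMass N < 1) : PsLe n (psGeom η N) := by
  have hstep : ∀ M : ℕ, PsLe n (∑ j ∈ Finset.range M, η ^ j • N ^ (j + 1) + η ^ M • (N ^ M * n)) := by
    intro M
    induction M with
    | zero => simpa using PsLe.refl n
    | succ M ih =>
      refine ih.trans ?_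
      rw [Finset.sum_range_succ, add_assoc]
      refine (PsLe.refl _).add ?_
      have h2 : PsLe (η ^ M • (N ^ M * n)) (η ^ M • (N ^ M * (N + η • (N * n)))) :=
        PsLe.smul le_rfl ((PsLe.refl _).mul h)
      convert h2 using 1
      rw [mul_add, smul_add, mul_smul_comm, smul_smul, ← pow_succ, ← mul_assoc, ← pow_succ,
        pow_succ N M]
  intro d
  have hlim : Tendsto (fun M : ℕ => ∑ j ∈ Finset.range M, η ^ j * MvPowerSeries.coeff d (N ^ (j + 1)) +
      (η * psMass N) ^ M * psMass n) atTop
      (𝓝 (∑' j : ℕ, η ^ j * MvPowerSeries.coeff d (N ^ (j + 1)) + 0 * psMass n)) := by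
    refine Tendsto.add (ENNReal.tendsto_nat_tsum _) (ENNReal.Tendsto.mul_const ?_ (Or.inr hn))
    exact ENNReal.tendsto_pow_atTop_nhds_zero_of_lt_one hθ
  rw [zero_mul, add_zero] at hlim
  refine ge_of_tendsto' hlim fun M => (hstep M d).trans ?_
  simp only [map_add, map_sum, map_smul, smul_eq_mul]
  refine add_le_add le_rfl ?_
  rw [mul_pow, mul_assoc, ← psMass_pow, ← psMass_mul]
  refine mul_le_mul_right ?_ _
  rw [psMass, psInt]
  simp only [mul_one]
  exact ENNReal.le_tsum d

lemma psInt_psGeom_pow_le {N : MvPowerSeries K ℝ≥0∞} {η s : ℝ≥0∞} {F : (K →₀ ℕ) → ℝ≥0∞}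
    (hF : Monotone F) (hF1 : ∀ d, F d ≤ 1) (hs : 1 ≤ s) (hst : s ≠ ⊤) (hN0 : psMass N ≠ 0)
    (hNt : psMass N ≠ ⊤) (a₀ k : ℕ) : ∀ a : ℕ,
    psInt (psGeom η N ^ k * N ^ a) F ≤
      psInt (N ^ a₀) F * (psMass N ^ a₀)⁻¹ * psMass (psGeom η N) ^ k * psMass N ^ a +
        s⁻¹ ^ a₀ * (∑' j : ℕ, η ^ j * (s * psMass N) ^ (j + 1)) ^ k * (s * psMass N) ^ a := by
  have hs0 : s ≠ 0 := (zero_lt_one.trans_le hs).ne'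
  induction k with
  | zero =>
    intro a
    simp only [pow_zero, one_mul, mul_one]
    rcases le_total a a₀ with h | h
    · refine le_trans ?_ le_self_add
      have h1 := le_psInt_mul (N ^ a) (N ^ (a₀ - a)) hF
      rw [← pow_add, Nat.add_sub_cancel' h, psMass_pow] at h1
      calc psInt (N ^ a) F = psInt (N ^ a) F * psMass N ^ (a₀ - a) * (psMass N ^ a₀)⁻¹ *
            psMass N ^ a := by
            have : psMass N ^ (a₀ - a) * psMass N ^ a = psMass N ^ a₀ := by
              rw [← pow_add, Nat.sub_add_cancel h]
            calc _ = psInt (N ^ a) F * ((psMass N ^ a₀)⁻¹ * psMass N ^ a₀) := by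
                  rw [ENNReal.inv_mul_cancel (pow_ne_zero _ hN0) (ENNReal.pow_ne_top hNt), mul_one]
              _ = _ := by rw [← this]; ring
        _ ≤ _ := by gcongr
    · refine le_trans ?_ le_add_self
      have h1 := psInt_le_mass (N ^ a) hF1
      rw [psMass_pow] at h1
      refine h1.trans ?_
      rw [mul_pow, ← mul_assoc]
      refine le_mul_of_one_le_left (by positivity) ?_
      calc (1 : ℝ≥0∞) = s⁻¹ ^ a₀ * s ^ a₀ := by
            rw [← mul_pow, ENNReal.inv_mul_cancel hs0 hst, one_pow]
        _ ≤ _ := mul_le_mul_right (pow_le_pow_right₀ hs h) _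
  | succ k ih =>
    intro a
    rw [pow_succ', mul_assoc, psInt_psGeom_mul]
    have h1 : ∀ j : ℕ, N ^ (j + 1) * (psGeom η N ^ k * N ^ a) = psGeom η N ^ k * N ^ (j + 1 + a) :=
      fun j => by rw [pow_add]; ring
    simp only [h1]
    refine (ENNReal.tsum_le_tsum fun j => mul_le_mul_right (ih (j + 1 + a)) _).trans_eq ?_
    simp only [mul_add, ENNReal.tsum_add]
    congr 1
    · rw [pow_succ _ k, psMass_psGeom]
      generalize (∑' j : ℕ, η ^ j * psMass N ^ (j + 1)) ^ k = X
      rw [← mul_assoc _ X, ← ENNReal.tsum_mul_left, ← ENNReal.tsum_mul_right]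
      exact tsum_congr fun j => by ring
    · rw [pow_succ _ k]
      generalize (∑' j : ℕ, η ^ j * (s * psMass N) ^ (j + 1)) ^ k = X
      rw [← mul_assoc _ X, ← ENNReal.tsum_mul_left, ← ENNReal.tsum_mul_right]
      exact tsum_congr fun j => by ring

lemma cpInt_smul (u : ℝ≥0∞) (p : MvPowerSeries K ℝ≥0∞) (F : (K →₀ ℕ) → ℝ≥0∞) :
    cpInt (u • p) F = ∑' k : ℕ, ((k.factorial : ℝ≥0∞))⁻¹ * (u ^ k * psInt (p ^ k) F) := by
  simp only [cpInt, smul_pow, psInt_smul]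

lemma psMass_smul (u : ℝ≥0∞) (p : MvPowerSeries K ℝ≥0∞) : psMass (u • p) = u * psMass p :=
  psInt_smul u p _

lemma cpLaw_psGeom_le {N : MvPowerSeries K ℝ≥0∞} {η s u : ℝ≥0∞} {F : (K →₀ ℕ) → ℝ≥0∞}
    (hF : Monotone F) (hF1 : ∀ d, F d ≤ 1) (hs : 1 ≤ s) (hst : s ≠ ⊤) (hN0 : psMass N ≠ 0)
    (hNt : psMass N ≠ ⊤) (hG : psMass (psGeom η N) ≠ ⊤) (hu : u ≠ ⊤) (a₀ : ℕ) :
    cpLaw (u • psGeom η N) F ≤ psInt (N ^ a₀) F * (psMass N ^ a₀)⁻¹ +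
      s⁻¹ ^ a₀ * eexp (u * ∑' j : ℕ, η ^ j * (s * psMass N) ^ (j + 1)) *
        (eexp (u * psMass (psGeom η N)))⁻¹ := by
  have hm := ENNReal.mul_ne_top hu hG
  have h1 : cpInt (u • psGeom η N) F ≤
      psInt (N ^ a₀) F * (psMass N ^ a₀)⁻¹ * eexp (u * psMass (psGeom η N)) +
        s⁻¹ ^ a₀ * eexp (u * ∑' j : ℕ, η ^ j * (s * psMass N) ^ (j + 1)) := by
    rw [cpInt_smul, eexp, eexp, ← ENNReal.tsum_mul_left, ← ENNReal.tsum_mul_left, ← ENNReal.tsum_add]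
    refine ENNReal.tsum_le_tsum fun k => ?_
    have h := psInt_psGeom_pow_le (η := η) hF hF1 hs hst hN0 hNt a₀ k 0
    simp only [pow_zero, mul_one] at h
    refine (mul_le_mul_right (mul_le_mul_right h _) _).trans_eq ?_
    rw [mul_pow, mul_pow]
    ring
  rw [cpLaw, psMass_smul]
  refine (mul_le_mul_right h1 _).trans_eq ?_
  rw [mul_add]
  congr 1
  · rw [mul_comm, mul_assoc, ENNReal.mul_inv_cancel (eexp_ne_zero hm) (eexp_ne_top hm), mul_one]
  · rw [mul_comm]

lemma le_cpLaw_add {N : MvPowerSeries K ℝ≥0∞} {s u : ℝ≥0∞} {F : (K →₀ ℕ) → ℝ≥0∞}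
    (hF : Monotone F) (hF1 : ∀ d, F d ≤ 1) (hs : 1 ≤ s) (hst : s ≠ ⊤) (hN0 : psMass N ≠ 0)
    (hNt : psMass N ≠ ⊤) (hu : u ≠ ⊤) (a₀ : ℕ) :
    psInt (N ^ a₀) F * (psMass N ^ a₀)⁻¹ ≤ cpLaw (u • N) F +
      s ^ a₀ * eexp (u * psMass N * s⁻¹) * (eexp (u * psMass N))⁻¹ := by
  have hs0 : s ≠ 0 := (zero_lt_one.trans_le hs).ne'
  have hm := ENNReal.mul_ne_top hu hNt
  have hcan : ∀ a : ℕ, (psMass N ^ a)⁻¹ * psMass N ^ a = 1 := fun a =>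
    ENNReal.inv_mul_cancel (pow_ne_zero _ hN0) (ENNReal.pow_ne_top hNt)
  have hle1 : psInt (N ^ a₀) F * (psMass N ^ a₀)⁻¹ ≤ 1 := by
    have h1 := psInt_le_mass (N ^ a₀) hF1
    rw [psMass_pow] at h1
    rw [← hcan a₀, mul_comm]
    exact mul_le_mul_right h1 _
  have h1 : psInt (N ^ a₀) F * (psMass N ^ a₀)⁻¹ * eexp (u * psMass N) ≤
      cpInt (u • N) F + s ^ a₀ * eexp (u * psMass N * s⁻¹) := by
    rw [cpInt_smul, eexp, eexp, ← ENNReal.tsum_mul_left, ← ENNReal.tsum_mul_left, ← ENNReal.tsum_add]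
    refine ENNReal.tsum_le_tsum fun k => ?_
    have key : psInt (N ^ a₀) F * (psMass N ^ a₀)⁻¹ * psMass N ^ k ≤
        psInt (N ^ k) F + s ^ a₀ * psMass N ^ k * s⁻¹ ^ k := by
      rcases le_total a₀ k with h | h
      · refine le_trans ?_ le_self_add
        have h1 := le_psInt_mul (N ^ a₀) (N ^ (k - a₀)) hF
        rw [← pow_add, Nat.add_sub_cancel' h, psMass_pow] at h1
        refine le_trans (le_of_eq ?_) h1
        calc _ = psInt (N ^ a₀) F * psMass N ^ (k - a₀) * ((psMass N ^ a₀)⁻¹ * psMass N ^ a₀) := by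
              conv_lhs => rw [← Nat.add_sub_cancel' h, pow_add]
              ring
          _ = _ := by rw [hcan, mul_one]
      · refine le_trans ?_ le_add_self
        calc _ ≤ 1 * psMass N ^ k := mul_le_mul_left hle1 _
          _ ≤ s ^ (a₀ - k) * psMass N ^ k := mul_le_mul_left (one_le_pow₀ hs) _
          _ = s ^ a₀ * psMass N ^ k * s⁻¹ ^ k := by
              conv_rhs => rw [← Nat.sub_add_cancel h, pow_add]
              have : s ^ k * s⁻¹ ^ k = 1 := by
                rw [← mul_pow, ENNReal.mul_inv_cancel hs0 hst, one_pow]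
              calc _ = s ^ (a₀ - k) * psMass N ^ k * (s ^ k * s⁻¹ ^ k) := by rw [this, mul_one]
                _ = _ := by ring
    calc _ = ((k.factorial : ℝ≥0∞))⁻¹ * (u ^ k *
          (psInt (N ^ a₀) F * (psMass N ^ a₀)⁻¹ * psMass N ^ k)) := by rw [mul_pow]; ring
      _ ≤ ((k.factorial : ℝ≥0∞))⁻¹ * (u ^ k *
          (psInt (N ^ k) F + s ^ a₀ * psMass N ^ k * s⁻¹ ^ k)) := by gcongr
      _ = _ := by rw [mul_pow, mul_pow]; ring
  rw [cpLaw, psMass_smul]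
  calc _ = psInt (N ^ a₀) F * (psMass N ^ a₀)⁻¹ * eexp (u * psMass N) * (eexp (u * psMass N))⁻¹ := by
        rw [mul_assoc _ (eexp _), ENNReal.mul_inv_cancel (eexp_ne_zero hm) (eexp_ne_top hm), mul_one]
    _ ≤ _ := mul_le_mul_left h1 _
    _ = _ := by ring

lemma exp_threshold_left {x e : ℝ} (hx : 0 ≤ x) (he : 0 < e) (he' : e ≤ 1 / 4) {u : ℝ}
    (hu : (1 + 4 * e) * x ≤ u) {a : ℕ} (ha : (a : ℝ) ≤ x * (1 + 2 * e) + 1) :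
    (1 + e) ^ a * Real.exp (u * (1 + e)⁻¹) * (Real.exp u)⁻¹ ≤
      2 * Real.exp (-(x * e ^ 2 / 4)) := by
  have hl : Real.log (1 + e) ≤ e := by
    have := Real.log_le_sub_one_of_pos (show 0 < 1 + e by linarith); linarith
  have hl0 : 0 ≤ Real.log (1 + e) := Real.log_nonneg (by linarith)
  have h2 : (1 + e) ^ a = Real.exp (a * Real.log (1 + e)) := by
    rw [Real.exp_nat_mul, Real.exp_log (by linarith)]
  have h3 : Real.log (1 + e) ≤ Real.log 2 := Real.log_le_log (by linarith) (by linarith)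
  have h4 : (2 : ℝ) = Real.exp (Real.log 2) := (Real.exp_log (by norm_num)).symm
  rw [h2, ← Real.exp_neg, ← Real.exp_add, ← Real.exp_add, h4, ← Real.exp_add]
  apply Real.exp_le_exp.2
  have h5 : (a : ℝ) * Real.log (1 + e) ≤ x * (1 + 2 * e) * e + Real.log 2 := by
    calc (a : ℝ) * Real.log (1 + e) ≤ (x * (1 + 2 * e) + 1) * Real.log (1 + e) := by gcongr
      _ = x * (1 + 2 * e) * Real.log (1 + e) + Real.log (1 + e) := by ring
      _ ≤ _ := by gcongr
  have h6 : u * (1 + e)⁻¹ - u = -(u * (e / (1 + e))) := by field_simp; ring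
  have h7 : (1 + 4 * e) * x * (e / (1 + e)) ≤ u * (e / (1 + e)) := by gcongr
  have h8 : x * (1 + 2 * e) * e - (1 + 4 * e) * x * (e / (1 + e)) =
      -(x * e ^ 2 * ((1 - 2 * e) / (1 + e))) := by field_simp; ring
  have h9 : 1 / 4 ≤ (1 - 2 * e) / (1 + e) := by rw [le_div_iff₀ (by linarith)]; linarith
  have h10 : x * e ^ 2 * (1 / 4) ≤ x * e ^ 2 * ((1 - 2 * e) / (1 + e)) := by gcongr
  linarith

lemma exp_threshold_right {x e θ : ℝ} (hx : 0 ≤ x) (he : 0 < e) (he' : e ≤ 1 / 4) (hθ : 0 ≤ θ)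
    (hθ' : θ ≤ e / 8) {a : ℕ} (ha : x * (1 + 2 * e) ≤ a) :
    (1 + e)⁻¹ ^ a * Real.exp (x * ((1 + e) / (1 - (1 + e) * θ))) * (Real.exp (x * (1 / (1 - θ))))⁻¹ ≤
      Real.exp (-(x * e ^ 2 / 4)) := by
  have hl : e - e ^ 2 / 2 ≤ Real.log (1 + e) := by
    have h := Real.le_log_one_add_of_nonneg he.le
    refine le_trans ?_ h
    rw [le_div_iff₀ (by linarith)]
    nlinarith [pow_pos he 3]
  have h2 : (1 + e)⁻¹ ^ a = Real.exp (-(a * Real.log (1 + e))) := by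
    rw [Real.exp_neg, Real.exp_nat_mul, Real.exp_log (by linarith), inv_pow]
  rw [h2, ← Real.exp_neg, ← Real.exp_add, ← Real.exp_add]
  apply Real.exp_le_exp.2
  have hl0 : 0 ≤ Real.log (1 + e) := Real.log_nonneg (by linarith)
  have h3 : x * (1 + 2 * e) * (e - e ^ 2 / 2) ≤ a * Real.log (1 + e) := by
    calc _ ≤ x * (1 + 2 * e) * Real.log (1 + e) := by gcongr
      _ ≤ _ := by gcongr
  have hA : 0 < 1 - (1 + e) * θ := by nlinarith
  have hB : 0 < 1 - θ := by linarith
  have h4 : (1 + e) / (1 - (1 + e) * θ) - 1 / (1 - θ) = e / ((1 - (1 + e) * θ) * (1 - θ)) := by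
    field_simp; ring
  have h5 : e / ((1 - (1 + e) * θ) * (1 - θ)) ≤ e * (1 + e / 2) := by
    rw [div_le_iff₀ (mul_pos hA hB), mul_assoc]
    refine le_mul_of_one_le_right he.le ?_
    have h6 : 1 - 9 / 32 * e ≤ (1 - (1 + e) * θ) * (1 - θ) := by
      nlinarith [mul_nonneg hθ hθ, mul_nonneg (mul_nonneg he.le hθ) hθ]
    have h7 : 1 ≤ (1 + e / 2) * (1 - 9 / 32 * e) := by nlinarith
    exact h7.trans (mul_le_mul_of_nonneg_left h6 (by linarith))
  have h6 : x * ((1 + e) / (1 - (1 + e) * θ)) - x * (1 / (1 - θ)) ≤ x * (e * (1 + e / 2)) := by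
    rw [← mul_sub, h4]; gcongr
  have h7 : x * (e * (1 + e / 2)) + x * e ^ 2 / 4 ≤ x * (1 + 2 * e) * (e - e ^ 2 / 2) := by
    have : 0 ≤ x * e ^ 2 * (3 / 4 - e) := by
      have : 0 ≤ 3 / 4 - e := by linarith
      positivity
    nlinarith
  linarith

lemma tsum_geometric_ofReal {η k : ℝ} (hη : 0 ≤ η) (hk : 0 ≤ k) (h : η * k < 1) :
    ∑' j : ℕ, ENNReal.ofReal η ^ j * ENNReal.ofReal k ^ (j + 1) = ENNReal.ofReal (k / (1 - η * k)) := by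
  have hs := (hasSum_geometric_of_lt_one (mul_nonneg hη hk) h).mul_left k
  rw [div_eq_mul_inv, ← hs.tsum_eq, ENNReal.ofReal_tsum_of_nonneg (fun n => by positivity) hs.summable]
  refine tsum_congr fun j => ?_
  rw [ENNReal.ofReal_mul hk, ENNReal.ofReal_pow (by positivity), ENNReal.ofReal_mul hη]
  ring

/-- If `n ≤ N + η N n` then the compound Poisson law with jump measure `u' n` is dominated, up to an
exponentially small error, by the one with jump measure `u N`, when `u` is slightly larger than `u'`. -/
lemma cpLaw_le_cpLaw_add {n N : MvPowerSeries K ℝ≥0∞} {η κ u u' e : ℝ} {F : (K →₀ ℕ) → ℝ≥0∞}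
    (hF : Monotone F) (hF1 : ∀ d, F d ≤ 1) (hη : 0 ≤ η) (hκ : 0 < κ)
    (hN : psMass N = ENNReal.ofReal κ) (hn : psMass n ≠ ⊤)
    (h : PsLe n (N + ENNReal.ofReal η • (N * n))) (he : 0 < e) (he' : e ≤ 1 / 4) (hθ : η * κ ≤ e / 8)
    (hu' : 0 ≤ u') (hu : (1 + 4 * e) * u' ≤ u) :
    cpLaw (ENNReal.ofReal u' • n) F ≤ cpLaw (ENNReal.ofReal u • N) F +
      ENNReal.ofReal (3 * Real.exp (-(u' * κ * e ^ 2 / 4))) := by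
  have hN0 : psMass N ≠ 0 := by rw [hN]; simpa using hκ
  have hNt : psMass N ≠ ⊤ := by rw [hN]; exact ENNReal.ofReal_ne_top
  have hu0 : 0 ≤ u := le_trans (by positivity) hu
  have hx : 0 ≤ u' * κ := by positivity
  have hθ0 : 0 ≤ η * κ := by positivity
  have hθ1 : η * κ < 1 := by linarith
  have hθs : η * ((1 + e) * κ) < 1 := by nlinarith
  have hQ : psMass (psGeom (ENNReal.ofReal η) N) = ENNReal.ofReal (κ / (1 - η * κ)) := by
    rw [psMass_psGeom, hN, tsum_geometric_ofReal hη hκ.le hθ1]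
  have hQs : ∑' j : ℕ, ENNReal.ofReal η ^ j * (ENNReal.ofReal (1 + e) * psMass N) ^ (j + 1) =
      ENNReal.ofReal ((1 + e) * κ / (1 - η * ((1 + e) * κ))) := by
    rw [hN, ← ENNReal.ofReal_mul (by linarith),
      tsum_geometric_ofReal hη (by positivity) hθs]
  have hG : PsLe n (psGeom (ENNReal.ofReal η) N) := h.psGeom hn (by
    rw [hN, ← ENNReal.ofReal_mul hη]; exact ENNReal.ofReal_lt_one.2 hθ1)
  have hGt : psMass (psGeom (ENNReal.ofReal η) N) ≠ ⊤ := by rw [hQ]; exact ENNReal.ofReal_ne_top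
  have hut : ENNReal.ofReal u' ≠ ⊤ := ENNReal.ofReal_ne_top
  set a₀ : ℕ := ⌈u' * κ * (1 + 2 * e)⌉₊ with ha₀
  have hs1 : (1 : ℝ≥0∞) ≤ ENNReal.ofReal (1 + e) := by
    rw [ENNReal.one_le_ofReal]; linarith
  have b1 : cpLaw (ENNReal.ofReal u' • n) F ≤ cpLaw (ENNReal.ofReal u' • psGeom (ENNReal.ofReal η) N) F :=
    cpLaw_mono_left (PsLe.smul le_rfl hG)
      (by rw [psMass_smul]; exact ENNReal.mul_ne_top hut hGt) hF
  have b2 := cpLaw_psGeom_le (s := ENNReal.ofReal (1 + e)) hF hF1 hs1 ENNReal.ofReal_ne_top hN0 hNt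
    hGt hut a₀
  have b3 := le_cpLaw_add (s := ENNReal.ofReal (1 + e)) (u := ENNReal.ofReal u) hF hF1 hs1
    ENNReal.ofReal_ne_top hN0 hNt ENNReal.ofReal_ne_top a₀
  have e1 : ENNReal.ofReal (1 + e) ^ a₀ * eexp (ENNReal.ofReal u * psMass N * (ENNReal.ofReal (1 + e))⁻¹) *
      (eexp (ENNReal.ofReal u * psMass N))⁻¹ ≤
      ENNReal.ofReal (2 * Real.exp (-(u' * κ * e ^ 2 / 4))) := by
    rw [hN, ← ENNReal.ofReal_mul hu0, ← ENNReal.ofReal_inv_of_pos (by linarith),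
      ← ENNReal.ofReal_mul (by positivity), eexp_ofReal (by positivity), eexp_ofReal (by positivity),
      ← ENNReal.ofReal_inv_of_pos (Real.exp_pos _), ← ENNReal.ofReal_pow (by linarith),
      ← ENNReal.ofReal_mul (by positivity), ← ENNReal.ofReal_mul (by positivity)]
    refine ENNReal.ofReal_le_ofReal (exp_threshold_left hx he he' ?_ ?_)
    · nlinarith
    · exact (Nat.ceil_lt_add_one (by positivity)).le
  have e2 : (ENNReal.ofReal (1 + e))⁻¹ ^ a₀ * eexp (ENNReal.ofReal u' *
      ∑' j : ℕ, ENNReal.ofReal η ^ j * (ENNReal.ofReal (1 + e) * psMass N) ^ (j + 1)) *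
      (eexp (ENNReal.ofReal u' * psMass (psGeom (ENNReal.ofReal η) N)))⁻¹ ≤
      ENNReal.ofReal (Real.exp (-(u' * κ * e ^ 2 / 4))) := by
    have p1 : 0 < 1 - η * κ := by linarith
    have p2 : 0 < 1 - η * ((1 + e) * κ) := by linarith
    rw [hQs, hQ, ← ENNReal.ofReal_mul hu', ← ENNReal.ofReal_mul hu',
      ← ENNReal.ofReal_inv_of_pos (by linarith), eexp_ofReal (by positivity), eexp_ofReal (by positivity),
      ← ENNReal.ofReal_inv_of_pos (Real.exp_pos _), ← ENNReal.ofReal_pow (by positivity),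
      ← ENNReal.ofReal_mul (by positivity), ← ENNReal.ofReal_mul (by positivity)]
    refine ENNReal.ofReal_le_ofReal ?_
    have := exp_threshold_right hx he he' hθ0 hθ (a := a₀) (Nat.le_ceil _)
    convert this using 4
    · rw [mul_assoc u', mul_div_assoc', mul_comm κ]; ring
    · rw [mul_assoc u', mul_one_div, mul_div_assoc']
  refine b1.trans (b2.trans ((add_le_add b3 le_rfl).trans ?_))
  refine (add_le_add (add_le_add le_rfl e1) e2).trans_eq ?_
  rw [add_assoc, ← ENNReal.ofReal_add (by positivity) (by positivity)]
  congr 2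
  ring

end Threshold

section Loops

variable {K : Type}

lemma PsLe.zero_le (p : MvPowerSeries K ℝ≥0∞) : PsLe 0 p := fun d => by simp

variable [Fintype K]

/-- Finite-step approximations of the generating series of killed trajectories: `w x` is the weight of
a visit at `x`, `a x y` the rate of jumps and `e x` the rate of killing. -/
def loopIter (w : K → ℝ≥0∞) (a : K → K → ℝ≥0∞) (e : K → ℝ≥0∞) : ℕ → K → MvPowerSeries K ℝ≥0∞
  | 0, _ => 0
  | m + 1, x => MvPowerSeries.monomial (Finsupp.single x 1) (w x) *
      (e x • 1 + ∑ y, a x y • loopIter w a e m y)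

/-- The generating series of the visits of a killed trajectory started at `x`. -/
def loopSer (w : K → ℝ≥0∞) (a : K → K → ℝ≥0∞) (e : K → ℝ≥0∞) (x : K) : MvPowerSeries K ℝ≥0∞ :=
  fun d => ⨆ m, MvPowerSeries.coeff d (loopIter w a e m x)

variable {w : K → ℝ≥0∞} {a a' : K → K → ℝ≥0∞} {e : K → ℝ≥0∞}

lemma coeff_loopSer (x : K) (d : K →₀ ℕ) : MvPowerSeries.coeff d (loopSer w a e x) =
    ⨆ m, MvPowerSeries.coeff d (loopIter w a e m x) := rfl

lemma loopIter_succ (m : ℕ) (x : K) : loopIter w a e (m + 1) x =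
    MvPowerSeries.monomial (Finsupp.single x 1) (w x) *
      (e x • 1 + ∑ y, a x y • loopIter w a e m y) := rfl

lemma loopIter_le_succ (m : ℕ) : ∀ x, PsLe (loopIter w a e m x) (loopIter w a e (m + 1) x) := by
  induction m with
  | zero => exact fun x => PsLe.zero_le _
  | succ m ih =>
    intro x
    rw [loopIter_succ, loopIter_succ]
    exact (PsLe.refl _).mul ((PsLe.refl _).add (PsLe.sum _ fun y _ => PsLe.smul le_rfl (ih y)))

lemma monotone_coeff_loopIter (x : K) (d : K →₀ ℕ) :
    Monotone fun m => MvPowerSeries.coeff d (loopIter w a e m x) :=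
  monotone_nat_of_le_succ fun m => loopIter_le_succ m x d

lemma loopIter_le_loopSer (m : ℕ) (x : K) : PsLe (loopIter w a e m x) (loopSer w a e x) :=
  fun d => le_iSup (fun m => MvPowerSeries.coeff d (loopIter w a e m x)) m

lemma loopSer_le {x : K} {p : MvPowerSeries K ℝ≥0∞} (h : ∀ m, PsLe (loopIter w a e m x) p) :
    PsLe (loopSer w a e x) p := fun d => iSup_le fun m => h m d

lemma tendsto_coeff_loopIter (x : K) (d : K →₀ ℕ) :
    Tendsto (fun m => MvPowerSeries.coeff d (loopIter w a e m x)) atTop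
      (𝓝 (MvPowerSeries.coeff d (loopSer w a e x))) :=
  tendsto_atTop_iSup (monotone_coeff_loopIter x d)

lemma loopSer_eq (hw : ∀ x, w x ≠ ⊤) (ha : ∀ x y, a x y ≠ ⊤) (x : K) : loopSer w a e x =
    MvPowerSeries.monomial (Finsupp.single x 1) (w x) * (e x • 1 + ∑ y, a x y • loopSer w a e y) := by
  ext d
  have h1 := (tendsto_coeff_loopIter (w := w) (a := a) (e := e) x d).comp (tendsto_add_atTop_nat 1)
  refine tendsto_nhds_unique h1 ?_
  simp only [Function.comp_def, loopIter_succ, MvPowerSeries.coeff_monomial_mul]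
  split_ifs with h
  · simp only [map_add, map_sum, map_smul, smul_eq_mul]
    refine ENNReal.Tendsto.const_mul (Tendsto.add tendsto_const_nhds (tendsto_finsetSum _ fun y _ => ?_))
      (Or.inr (hw x))
    exact ENNReal.Tendsto.const_mul (tendsto_coeff_loopIter y _) (Or.inr (ha x y))
  · exact tendsto_const_nhds

lemma psInt_loopIter_succ {F : (K →₀ ℕ) → ℝ≥0∞} (hF : ∀ a b, F (a + b) = F a * F b) (hF0 : F 0 = 1)
    (m : ℕ) (x : K) : psInt (loopIter w a e (m + 1) x) F =
      w x * F (Finsupp.single x 1) * (e x + ∑ y, a x y * psInt (loopIter w a e m y) F) := by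
  rw [loopIter_succ, psInt_mul_of_multiplicative hF, psInt_monomial, psInt_add, psInt_smul, psInt_one,
    psInt_sum, hF0, mul_one]
  simp only [psInt_smul]

lemma psInt_loopSer_eq {F : (K →₀ ℕ) → ℝ≥0∞} (hF : ∀ a b, F (a + b) = F a * F b) (hF0 : F 0 = 1)
    (hw : ∀ x, w x ≠ ⊤) (ha : ∀ x y, a x y ≠ ⊤) (x : K) : psInt (loopSer w a e x) F =
      w x * F (Finsupp.single x 1) * (e x + ∑ y, a x y * psInt (loopSer w a e y) F) := by
  conv_lhs => rw [loopSer_eq hw ha]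
  rw [psInt_mul_of_multiplicative hF, psInt_monomial, psInt_add, psInt_smul, psInt_one,
    psInt_sum, hF0, mul_one]
  simp only [psInt_smul]

lemma psInt_loopSer_le {F : (K →₀ ℕ) → ℝ≥0∞} (hF : ∀ a b, F (a + b) = F a * F b) (hF0 : F 0 = 1)
    (hFt : ∀ d, F d ≠ ⊤) {f : K → ℝ≥0∞}
    (hf : ∀ x, w x * F (Finsupp.single x 1) * (e x + ∑ y, a x y * f y) ≤ f x) (x : K) :
    psInt (loopSer w a e x) F ≤ f x := by
  have h1 : ∀ m x, psInt (loopIter w a e m x) F ≤ f x := by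
    intro m
    induction m with
    | zero => intro x; rw [loopIter, psInt_zero]; exact bot_le
    | succ m ih =>
      intro x
      rw [psInt_loopIter_succ hF hF0]
      refine le_trans ?_ (hf x)
      gcongr
      exact ih _
  rw [psInt, ENNReal.tsum_eq_iSup_sum]
  refine iSup_le fun s => ?_
  have h2 : Tendsto (fun m => ∑ d ∈ s, MvPowerSeries.coeff d (loopIter w a e m x) * F d) atTop
      (𝓝 (∑ d ∈ s, MvPowerSeries.coeff d (loopSer w a e x) * F d)) :=
    tendsto_finsetSum _ fun d _ =>
      ENNReal.Tendsto.mul_const (tendsto_coeff_loopIter x d) (Or.inr (hFt d))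
  exact le_of_tendsto' h2 fun m => (ENNReal.sum_le_tsum s).trans (h1 m x)

lemma loopSer_mono (haa : ∀ x y, a x y ≤ a' x y) (x : K) :
    PsLe (loopSer w a e x) (loopSer w a' e x) := by
  have h1 : ∀ m x, PsLe (loopIter w a e m x) (loopIter w a' e m x) := by
    intro m
    induction m with
    | zero => exact fun x => PsLe.refl _
    | succ m ih =>
      intro x
      rw [loopIter_succ, loopIter_succ]
      exact (PsLe.refl _).mul ((PsLe.refl _).add
        (PsLe.sum _ fun y _ => PsLe.smul (haa x y) (ih y)))
  exact loopSer_le fun m => (h1 m x).trans (loopIter_le_loopSer m x)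

lemma PsDep.loopSer {T : Set K} (hT : ∀ x ∈ T, ∀ y, a x y ≠ 0 → y ∈ T) {x : K} (hx : x ∈ T) :
    PsDep T (loopSer w a e x) := by
  have h1 : ∀ m, ∀ x ∈ T, PsDep T (loopIter w a e m x) := by
    intro m
    induction m with
    | zero => intro x _ d hd; exact absurd (by rw [loopIter]; simp) hd
    | succ m ih =>
      intro x hx
      rw [loopIter_succ]
      refine PsDep.mul (PsDep.monomial _ _ fun y hy => ?_) (PsDep.add (PsDep.smul _ (PsDep.one T))
        (PsDep.sum _ fun y _ => ?_))
      · exact Finsupp.single_eq_of_ne fun h => hy (h ▸ hx)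
      · by_cases h : a x y = 0
        · rw [h, zero_smul]; intro d hd; exact absurd (by simp) hd
        · exact PsDep.smul _ (ih y (hT x hx y h))
  intro d hd y hy
  rw [coeff_loopSer] at hd
  by_contra hne
  refine hd (ENNReal.iSup_eq_zero.2 fun m => ?_)
  by_contra h
  exact hne (h1 m x hx d h y hy)

/-- The generating series of excursions, weighted by the killing rates. -/
def loopMeas (w : K → ℝ≥0∞) (a : K → K → ℝ≥0∞) (e : K → ℝ≥0∞) : MvPowerSeries K ℝ≥0∞ :=
  ∑ x, e x • loopSer w a e x

lemma psInt_loopMeas (F : (K →₀ ℕ) → ℝ≥0∞) :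
    psInt (loopMeas w a e) F = ∑ x, e x * psInt (loopSer w a e x) F := by
  simp only [loopMeas, psInt_sum, psInt_smul]

lemma loopMeas_mono (haa : ∀ x y, a x y ≤ a' x y) : PsLe (loopMeas w a e) (loopMeas w a' e) :=
  PsLe.sum _ fun x _ => PsLe.smul le_rfl (loopSer_mono haa x)

/-- If all the jump rates that are in `a` but not in `a'` are at most `η e e`, the generating series of
excursions are comparable. -/
lemma loopMeas_le {η : ℝ≥0∞} (hw : ∀ x, w x ≠ ⊤) (ha' : ∀ x y, a' x y ≠ ⊤)
    (haa : ∀ x y, a x y ≤ a' x y + η * (e x * e y)) :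
    PsLe (loopMeas w a e)
      (loopMeas w a' e + η • (loopMeas w a' e * loopMeas w a e)) := by
  set n := loopMeas w a e with hn
  have h1 : ∀ m x, PsLe (loopIter w a e m x) (loopSer w a' e x * (1 + η • n)) := by
    intro m
    induction m with
    | zero => exact fun x => PsLe.zero_le _
    | succ m ih =>
      intro x
      rw [loopIter_succ, loopSer_eq hw ha', mul_assoc]
      refine (PsLe.refl _).mul ?_
      have h2 : PsLe (∑ y, a x y • loopIter w a e m y)
          (∑ y, (a' x y • (loopSer w a' e y * (1 + η • n)) + (η * (e x * e y)) • loopSer w a e y)) := by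
        refine PsLe.sum _ fun y _ => (PsLe.smul (haa x y) (PsLe.refl _)).trans ?_
        rw [add_smul]
        exact (PsLe.smul le_rfl (ih y)).add (PsLe.smul le_rfl (loopIter_le_loopSer m y))
      refine ((PsLe.refl _).add h2).trans ?_
      have h3 : ∑ y, (a' x y • (loopSer w a' e y * (1 + η • n)) +
          (η * (e x * e y)) • loopSer w a e y) =
          (∑ y, a' x y • loopSer w a' e y) * (1 + η • n) + (η * e x) • n := by
        rw [Finset.sum_add_distrib, Finset.sum_mul]
        congr 1
        · exact Finset.sum_congr rfl fun y _ => by rw [smul_mul_assoc]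
        · rw [hn, loopMeas, Finset.smul_sum]
          exact Finset.sum_congr rfl fun y _ => by rw [smul_smul, mul_assoc]
      rw [h3]
      have h4 : e x • 1 + ((∑ y, a' x y • loopSer w a' e y) * (1 + η • n) + (η * e x) • n) =
          (e x • 1 + ∑ y, a' x y • loopSer w a' e y) * (1 + η • n) := by
        rw [add_mul, smul_mul_assoc, one_mul, smul_add, smul_smul, mul_comm η]
        abel
      rw [h4]
      exact PsLe.refl _
  have h2 : PsLe n (∑ x, e x • (loopSer w a' e x * (1 + η • n))) :=
    PsLe.sum _ fun x _ => PsLe.smul le_rfl (loopSer_le fun m => h1 m x)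
  convert h2 using 1
  simp only [← smul_mul_assoc]
  rw [← Finset.sum_mul, ← loopMeas, mul_add, mul_one, mul_smul_comm, smul_mul_assoc]

end Loops

section Killed

variable {K : Type}

/-- Jump rates. -/
def killA (A : K → K → ℝ) (x y : K) : ℝ≥0∞ := if x = y then 0 else ENNReal.ofReal (-A x y)

/-- Jump rates restricted to jumps inside `T` or inside its complement. -/
def killB (A : K → K → ℝ) (T : Set K) (x y : K) : ℝ≥0∞ := if (x ∈ T ↔ y ∈ T) then killA A x y else 0

lemma killA_ne_top (A : K → K → ℝ) (x y : K) : killA A x y ≠ ⊤ := by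
  unfold killA; split_ifs
  · exact ENNReal.zero_ne_top
  · exact ENNReal.ofReal_ne_top

lemma killB_ne_top (A : K → K → ℝ) (T : Set K) (x y : K) : killB A T x y ≠ ⊤ := by
  unfold killB; split_ifs
  · exact killA_ne_top A x y
  · exact ENNReal.zero_ne_top

variable [Fintype K]

/-- A finite symmetric matrix `A` with inverse `G` which is the generator of a killed chain. -/
structure IsKilled (G A : K → K → ℝ) : Prop where
  symm : ∀ x y, A x y = A y x
  green_nonneg : ∀ x y, 0 ≤ G x y
  inv_left : ∀ x y, ∑ z, A x z * G z y = if x = y then 1 else 0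
  inv_right : ∀ x y, ∑ z, G x z * A z y = if x = y then 1 else 0
  offdiag : ∀ x y, x ≠ y → A x y ≤ 0
  esc_nonneg : ∀ x, 0 ≤ ∑ y, A x y

/-- Visit weights. -/
def killW (A : K → K → ℝ) (x : K) : ℝ≥0∞ := ENNReal.ofReal (A x x)⁻¹

/-- Killing rates. -/
def killE (A : K → K → ℝ) (x : K) : ℝ≥0∞ := ENNReal.ofReal (∑ y, A x y)

/-- The excursion measure of the killed chain. -/
def killN (A : K → K → ℝ) : MvPowerSeries K ℝ≥0∞ := loopMeas (killW A) (killA A) (killE A)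

/-- The excursion measure of the killed chain conditioned not to jump between `T` and `Tᶜ`. -/
def killNB (A : K → K → ℝ) (T : Set K) : MvPowerSeries K ℝ≥0∞ :=
  loopMeas (killW A) (killB A T) (killE A)

/-- The multiplicative function `d ↦ ∏ W x ^ d x`. -/
def wtF (W : K → ℝ) (d : K →₀ ℕ) : ℝ≥0∞ := ∏ x, ENNReal.ofReal (W x) ^ d x

lemma wtF_add (W : K → ℝ) (a b : K →₀ ℕ) : wtF W (a + b) = wtF W a * wtF W b := by
  simp only [wtF, Finsupp.add_apply, pow_add, Finset.prod_mul_distrib]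

lemma wtF_zero (W : K → ℝ) : wtF W 0 = 1 := by simp [wtF]

lemma wtF_single (W : K → ℝ) (x : K) : wtF W (Finsupp.single x 1) = ENNReal.ofReal (W x) := by
  rw [wtF, Finset.prod_eq_single x]
  · simp
  · intro y _ hy; rw [Finsupp.single_eq_of_ne hy, pow_zero]
  · intro h; exact absurd (Finset.mem_univ x) h

lemma wtF_ne_top (W : K → ℝ) (d : K →₀ ℕ) : wtF W d ≠ ⊤ :=
  ENNReal.prod_ne_top fun _ _ => ENNReal.pow_ne_top ENNReal.ofReal_ne_top

lemma sum_killA_mul (A : K → K → ℝ) (hA : ∀ x y, x ≠ y → A x y ≤ 0) (x : K) {f : K → ℝ}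
    (hf : ∀ y, 0 ≤ f y) : ∑ y, killA A x y * ENNReal.ofReal (f y) =
      ENNReal.ofReal (A x x * f x - ∑ y, A x y * f y) := by
  have h1 : A x x * f x - ∑ y, A x y * f y = ∑ y, (if x = y then 0 else -A x y * f y) := by
    rw [← Finset.add_sum_erase _ _ (Finset.mem_univ x), ← Finset.add_sum_erase _
      (fun y => if x = y then (0 : ℝ) else -A x y * f y) (Finset.mem_univ x), if_pos rfl]
    have : ∑ y ∈ Finset.univ.erase x, (if x = y then (0 : ℝ) else -A x y * f y) =
        -∑ y ∈ Finset.univ.erase x, A x y * f y := by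
      rw [← Finset.sum_neg_distrib]
      refine Finset.sum_congr rfl fun y hy => ?_
      rw [if_neg (Finset.ne_of_mem_erase hy).symm, neg_mul]
    rw [this]; ring
  rw [h1, ENNReal.ofReal_sum_of_nonneg]
  · refine Finset.sum_congr rfl fun y _ => ?_
    by_cases h : x = y
    · simp [killA, h]
    · rw [killA, if_neg h, if_neg h, ENNReal.ofReal_mul (neg_nonneg.2 (hA x y h))]
  · intro y _
    split_ifs with h
    · exact le_rfl
    · exact mul_nonneg (neg_nonneg.2 (hA x y h)) (hf y)

variable {G A : K → K → ℝ}

lemma IsKilled.one_le_diag (h : IsKilled G A) (x : K) : 1 ≤ A x x * G x x := by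
  have h1 := h.inv_left x x
  rw [if_pos rfl, ← Finset.add_sum_erase _ _ (Finset.mem_univ x)] at h1
  have : ∑ z ∈ Finset.univ.erase x, A x z * G z x ≤ 0 := Finset.sum_nonpos fun z hz =>
    mul_nonpos_of_nonpos_of_nonneg (h.offdiag x z (Finset.ne_of_mem_erase hz).symm)
      (h.green_nonneg z x)
  linarith

lemma IsKilled.diag_pos (h : IsKilled G A) (x : K) : 0 < A x x := by
  have h1 := h.one_le_diag x
  by_contra hc
  have := mul_nonpos_of_nonpos_of_nonneg (not_lt.1 hc) (h.green_nonneg x x)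
  linarith

/-- Evaluation of the excursion measure on multiplicative functions. -/
lemma IsKilled.psInt_killN (h : IsKilled G A) {Vf f : K → ℝ} (hV : ∀ x, Vf x < A x x)
    (hf : ∀ x, 0 ≤ f x) (heq : ∀ x, ∑ y, A x y * f y - Vf x * f x = ∑ y, A x y)
    (hinj : ∀ f : K → ℝ, (∀ x, ∑ y, A x y * f y = Vf x * f x) → ∀ x, f x = 0) :
    psInt (killN A) (wtF fun x => A x x / (A x x - Vf x)) =
      ENNReal.ofReal (∑ x, (∑ y, A x y) * f x) := by
  set W : K → ℝ := fun x => A x x / (A x x - Vf x) with hW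
  have hW0 : ∀ x, 0 < A x x - Vf x := fun x => sub_pos.2 (hV x)
  have hd := h.diag_pos
  have hstep : ∀ g : K → ℝ, (∀ x, 0 ≤ g x) → ∀ x, killW A x * wtF W (Finsupp.single x 1) *
      (killE A x + ∑ y, killA A x y * ENNReal.ofReal (g y)) =
      ENNReal.ofReal ((A x x - Vf x)⁻¹ * (∑ y, A x y + (A x x * g x - ∑ y, A x y * g y))) := by
    intro g hg x
    have hnn : 0 ≤ A x x * g x - ∑ y, A x y * g y := by
      rw [← Finset.add_sum_erase _ _ (Finset.mem_univ x)]
      have : ∑ z ∈ Finset.univ.erase x, A x z * g z ≤ 0 := Finset.sum_nonpos fun z hz =>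
        mul_nonpos_of_nonpos_of_nonneg (h.offdiag x z (Finset.ne_of_mem_erase hz).symm) (hg z)
      linarith
    rw [wtF_single, sum_killA_mul A h.offdiag x hg, killW, killE,
      ← ENNReal.ofReal_add (h.esc_nonneg x) hnn, ← ENNReal.ofReal_mul (inv_nonneg.2 (hd x).le),
      ← ENNReal.ofReal_mul (mul_nonneg (inv_nonneg.2 (hd x).le)
        (div_nonneg (hd x).le (hW0 x).le))]
    congr 2
    have := (hd x).ne'
    have := (hW0 x).ne'
    field_simp
  have hle : ∀ x, psInt (loopSer (killW A) (killA A) (killE A) x) (wtF W) ≤ ENNReal.ofReal (f x) := by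
    intro x
    refine psInt_loopSer_le (f := fun x => ENNReal.ofReal (f x)) (wtF_add W) (wtF_zero W)
      (wtF_ne_top W) (fun x => ?_) x
    rw [hstep f hf x]
    refine ENNReal.ofReal_le_ofReal (le_of_eq ?_)
    have := (hW0 x).ne'
    rw [inv_mul_eq_iff_eq_mul₀ this, ← heq x]; ring
  set p : K → ℝ := fun x => (psInt (loopSer (killW A) (killA A) (killE A) x) (wtF W)).toReal with hp
  have hpt : ∀ x, psInt (loopSer (killW A) (killA A) (killE A) x) (wtF W) = ENNReal.ofReal (p x) :=
    fun x => (ENNReal.ofReal_toReal (ne_top_of_le_ne_top ENNReal.ofReal_ne_top (hle x))).symm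
  have hp0 : ∀ x, 0 ≤ p x := fun x => ENNReal.toReal_nonneg
  have hpeq : ∀ x, ∑ y, A x y * p y - Vf x * p x = ∑ y, A x y := by
    intro x
    have h1 := psInt_loopSer_eq (w := killW A) (a := killA A) (e := killE A) (wtF_add W) (wtF_zero W)
      (fun x => ENNReal.ofReal_ne_top) (killA_ne_top A) x
    simp only [hpt] at h1
    rw [hstep p hp0 x] at h1
    have hnn : 0 ≤ A x x * p x - ∑ y, A x y * p y := by
      rw [← Finset.add_sum_erase _ _ (Finset.mem_univ x)]
      have : ∑ z ∈ Finset.univ.erase x, A x z * p z ≤ 0 := Finset.sum_nonpos fun z hz =>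
        mul_nonpos_of_nonpos_of_nonneg (h.offdiag x z (Finset.ne_of_mem_erase hz).symm) (hp0 z)
      linarith
    rw [ENNReal.ofReal_eq_ofReal_iff (hp0 x) (mul_nonneg (inv_nonneg.2 (hW0 x).le)
      (add_nonneg (h.esc_nonneg x) hnn)), eq_inv_mul_iff_mul_eq₀ (hW0 x).ne'] at h1
    linarith
  have hpf : ∀ x, p x = f x := by
    intro x
    have := hinj (fun x => p x - f x) (fun x => by
      simp only [mul_sub, Finset.sum_sub_distrib]
      linarith [hpeq x, heq x]) x
    linarith
  rw [killN, psInt_loopMeas, ENNReal.ofReal_sum_of_nonneg fun x _ => mul_nonneg (h.esc_nonneg x) (hf x)]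
  refine Finset.sum_congr rfl fun x _ => ?_
  rw [hpt, hpf, ENNReal.ofReal_mul (h.esc_nonneg x), killE]

lemma IsKilled.eq_zero (h : IsKilled G A) {f : K → ℝ} (hf : ∀ x, ∑ y, A x y * f y = 0) (x : K) :
    f x = 0 := by
  have h1 : ∑ z, G x z * ∑ y, A z y * f y = f x := by
    simp only [Finset.mul_sum, ← mul_assoc]
    rw [Finset.sum_comm]
    simp only [← Finset.sum_mul, h.inv_right, ite_mul, one_mul, zero_mul]
    simp
  rw [← h1]
  simp [hf]

lemma IsKilled.psMass_killN (h : IsKilled G A) :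
    psMass (killN A) = ENNReal.ofReal (∑ x, ∑ y, A x y) := by
  have h1 := h.psInt_killN (Vf := fun _ => 0) (f := fun _ => 1) h.diag_pos (fun _ => zero_le_one)
    (fun x => by simp) (fun f hf => h.eq_zero fun x => by rw [hf x, zero_mul])
  have h2 : wtF (fun x => A x x / (A x x - (fun _ => (0 : ℝ)) x)) = fun _ => 1 := by
    funext d
    rw [wtF]
    refine Finset.prod_eq_one fun x _ => ?_
    simp only [sub_zero]
    rw [div_self (h.diag_pos x).ne', ENNReal.ofReal_one, one_pow]
  rw [h2] at h1
  simp only [mul_one] at h1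
  exact h1

lemma killNB_le (A : K → K → ℝ) (T : Set K) : PsLe (killNB A T) (killN A) :=
  loopMeas_mono fun x y => by
    unfold killB; split_ifs
    · exact le_rfl
    · exact bot_le

lemma killN_le {η : ℝ} (hη : 0 ≤ η) (he : ∀ x, 0 ≤ ∑ y, A x y) {T : Set K}
    (hA : ∀ x y, ¬(x ∈ T ↔ y ∈ T) → -A x y ≤ η * ((∑ z, A x z) * ∑ z, A y z)) :
    PsLe (killN A) (killNB A T + ENNReal.ofReal η • (killNB A T * killN A)) := by
  refine loopMeas_le (fun _ => ENNReal.ofReal_ne_top) (killB_ne_top A T) fun x y => ?_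
  unfold killB
  split_ifs with h
  · exact le_self_add
  · have hxy : x ≠ y := fun hxy => h (by rw [hxy])
    rw [zero_add, killA, if_neg hxy, killE, killE, ← ENNReal.ofReal_mul (he x),
      ← ENNReal.ofReal_mul hη]
    exact ENNReal.ofReal_le_ofReal (hA x y h)

lemma killNB_eq_add (A : K → K → ℝ) (T : Set K) : ∃ p q, killNB A T = p + q ∧ PsDep T p ∧ PsDep Tᶜ q := by
  refine ⟨∑ x ∈ Finset.univ.filter (· ∈ T), killE A x • loopSer (killW A) (killB A T) (killE A) x,
    ∑ x ∈ Finset.univ.filter (¬ · ∈ T), killE A x • loopSer (killW A) (killB A T) (killE A) x,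
    (Finset.sum_filter_add_sum_filter_not _ _ _).symm, PsDep.sum _ fun x hx => PsDep.smul _ ?_,
    PsDep.sum _ fun x hx => PsDep.smul _ ?_⟩
  · refine PsDep.loopSer (fun x hx y hy => ?_) (Finset.mem_filter.1 hx).2
    by_contra hc
    exact hy (if_neg fun h => hc (h.1 hx))
  · refine PsDep.loopSer (fun x hx y hy => ?_) (Finset.mem_filter.1 hx).2
    intro hc
    exact hy (if_neg fun h => hx (h.2 hc))

lemma cpLaw_killNB_mul {T : Set K} {c : ℝ≥0∞} (hm : psMass (c • killNB A T) ≠ ⊤)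
    {F₁ F₂ : (K →₀ ℕ) → ℝ≥0∞}
    (h₁ : ∀ d d' : K →₀ ℕ, (∀ x ∈ T, d x = d' x) → F₁ d = F₁ d')
    (h₂ : ∀ d d' : K →₀ ℕ, (∀ x ∉ T, d x = d' x) → F₂ d = F₂ d') :
    cpLaw (c • killNB A T) (fun d => F₁ d * F₂ d) =
      cpLaw (c • killNB A T) F₁ * cpLaw (c • killNB A T) F₂ := by
  obtain ⟨p, q, hpq, hp, hq⟩ := killNB_eq_add A T
  rw [hpq, smul_add] at hm ⊢
  rw [psMass_add] at hm
  obtain ⟨hm1, hm2⟩ := ENNReal.add_ne_top.1 hm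
  refine cpLaw_mul (hp.smul c) (hq.smul c) hm1 hm2 (fun a b hb => h₁ _ _ fun x hx => ?_)
    (fun a b ha => h₂ _ _ fun x hx => ?_)
  · rw [Finsupp.add_apply, hb x (fun h => h hx), add_zero]
  · rw [Finsupp.add_apply, ha x hx, zero_add]

/-- Decoupling for the compound Poisson laws of the excursion measure. -/
lemma IsKilled.decoupling (h : IsKilled G A) {η κ u u' e : ℝ} {T : Set K} (hη : 0 ≤ η)
    (hA : ∀ x y, ¬(x ∈ T ↔ y ∈ T) → -A x y ≤ η * ((∑ z, A x z) * ∑ z, A y z))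
    (hκ : ∑ x, ∑ y, A x y = κ) (hκ0 : 0 < κ) (he : 0 < e) (he' : e ≤ 1 / 4) (hθ : η * κ ≤ e / 8)
    (hu' : 0 ≤ u') (hu : (1 + 4 * e) * u' ≤ u) {F₁ F₂ : (K →₀ ℕ) → ℝ≥0∞}
    (h₁ : ∀ d d' : K →₀ ℕ, (∀ x ∈ T, d x = d' x) → F₁ d = F₁ d')
    (h₂ : ∀ d d' : K →₀ ℕ, (∀ x ∉ T, d x = d' x) → F₂ d = F₂ d')
    (hF₁ : ∀ d, F₁ d ≤ 1) (hF₂ : ∀ d, F₂ d ≤ 1) :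
    (Monotone F₁ → Monotone F₂ →
      cpLaw (ENNReal.ofReal u' • killN A) (fun d => F₁ d * F₂ d) ≤
        cpLaw (ENNReal.ofReal u • killN A) F₁ * cpLaw (ENNReal.ofReal u • killN A) F₂ +
        ENNReal.ofReal (9 * Real.exp (-(u' * κ * e ^ 2 / 8)))) ∧
    (Antitone F₁ → Antitone F₂ →
      cpLaw (ENNReal.ofReal u • killN A) (fun d => F₁ d * F₂ d) ≤
        cpLaw (ENNReal.ofReal u' • killN A) F₁ * cpLaw (ENNReal.ofReal u' • killN A) F₂ +
        ENNReal.ofReal (9 * Real.exp (-(u' * κ * e ^ 2 / 8)))) := by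
  set n := killN A with hn
  set N := killNB A T with hN
  have hnm : psMass n = ENNReal.ofReal κ := by rw [hn, h.psMass_killN, hκ]
  have hnt : psMass n ≠ ⊤ := by rw [hnm]; exact ENNReal.ofReal_ne_top
  have hNn : PsLe N n := killNB_le A T
  have hnN : PsLe n (N + ENNReal.ofReal η • (N * n)) := killN_le hη h.esc_nonneg hA
  have hNmn : psMass N ≤ psMass n := psInt_mono_left hNn _
  have hNt : psMass N ≠ ⊤ := ne_top_of_le_ne_top hnt hNmn
  set k : ℝ := (psMass N).toReal with hk
  have hNk : psMass N = ENNReal.ofReal k := (ENNReal.ofReal_toReal hNt).symm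
  have hk0 : 0 ≤ k := ENNReal.toReal_nonneg
  have hkκ : k ≤ κ := by
    rw [hNk, hnm] at hNmn
    exact (ENNReal.ofReal_le_ofReal_iff hκ0.le).1 hNmn
  have hκk : κ ≤ k + η * (k * κ) := by
    have h1 := psInt_mono_left hnN fun _ => 1
    rw [psInt_add, psInt_smul] at h1
    change psMass n ≤ psMass N + _ * psMass (N * n) at h1
    rw [psMass_mul, hnm, hNk, ← ENNReal.ofReal_mul hk0, ← ENNReal.ofReal_mul hη,
      ← ENNReal.ofReal_add hk0 (by positivity)] at h1
    exact (ENNReal.ofReal_le_ofReal_iff (by positivity)).1 h1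
  have hk2 : κ / 2 ≤ k := by nlinarith
  have hkpos : 0 < k := by linarith
  have hu0 : 0 ≤ u := le_trans (by positivity) hu
  have hmass : ∀ (c : ℝ) (p : MvPowerSeries K ℝ≥0∞), psMass p ≠ ⊤ →
      psMass (ENNReal.ofReal c • p) ≠ ⊤ := fun c p hp => by
    rw [psMass_smul]; exact ENNReal.mul_ne_top ENNReal.ofReal_ne_top hp
  have herr : 3 * Real.exp (-(u' * k * e ^ 2 / 4)) ≤ 3 * Real.exp (-(u' * κ * e ^ 2 / 8)) := by
    have : u' * κ * e ^ 2 / 8 ≤ u' * k * e ^ 2 / 4 := by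
      have : u' * (κ / 2) * e ^ 2 ≤ u' * k * e ^ 2 := by gcongr
      linarith
    gcongr
  set E : ℝ≥0∞ := ENNReal.ofReal (3 * Real.exp (-(u' * κ * e ^ 2 / 8))) with hE
  have hE9 : ENNReal.ofReal (9 * Real.exp (-(u' * κ * e ^ 2 / 8))) = 3 * E := by
    rw [hE, show (3 : ℝ≥0∞) = ENNReal.ofReal 3 by norm_num, ← ENNReal.ofReal_mul (by norm_num)]
    congr 1; ring
  have hup : ∀ F : (K →₀ ℕ) → ℝ≥0∞, Monotone F → (∀ d, F d ≤ 1) →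
      cpLaw (ENNReal.ofReal u' • n) F ≤ cpLaw (ENNReal.ofReal u • N) F + E := by
    intro F hF hF1
    refine (cpLaw_le_cpLaw_add hF hF1 hη hkpos hNk hnt hnN he he'
      ((mul_le_mul_of_nonneg_left hkκ hη).trans hθ) hu' hu).trans ?_
    exact add_le_add le_rfl (ENNReal.ofReal_le_ofReal herr)
  have hlow : ∀ F : (K →₀ ℕ) → ℝ≥0∞, Monotone F →
      cpLaw (ENNReal.ofReal u • N) F ≤ cpLaw (ENNReal.ofReal u • n) F := fun F hF =>
    cpLaw_mono_left (PsLe.smul le_rfl hNn) (hmass u n hnt) hF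
  have hprod1 : ∀ d, F₁ d * F₂ d ≤ 1 := fun d => mul_le_one' (hF₁ d) (hF₂ d)
  have hfac : cpLaw (ENNReal.ofReal u • N) (fun d => F₁ d * F₂ d) =
      cpLaw (ENNReal.ofReal u • N) F₁ * cpLaw (ENNReal.ofReal u • N) F₂ :=
    cpLaw_killNB_mul (hmass u N hNt) h₁ h₂
  have hcompl : ∀ F : (K →₀ ℕ) → ℝ≥0∞, Antitone F → Monotone fun d => 1 - F d :=
    fun F hF d d' hd => tsub_le_tsub_left (hF hd) 1
  constructor
  · intro m₁ m₂
    refine (hup _ (fun d d' hd => mul_le_mul' (m₁ hd) (m₂ hd)) hprod1).trans ?_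
    rw [hfac, hE9]
    refine add_le_add (mul_le_mul' (hlow _ m₁) (hlow _ m₂)) ?_
    exact le_mul_of_one_le_left bot_le (by norm_num)
  · intro m₁ m₂
    have s1 : cpLaw (ENNReal.ofReal u • n) (fun d => F₁ d * F₂ d) ≤
        cpLaw (ENNReal.ofReal u • N) (fun d => F₁ d * F₂ d) := by
      have := cpLaw_antitone_le (hmass u n hnt) (hmass u N hNt) hprod1 (err := 0) (by
        rw [add_zero]
        exact hlow _ (hcompl _ fun d d' hd => mul_le_mul' (m₁ hd) (m₂ hd)))
      rwa [add_zero] at this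
    have s2 : ∀ F : (K →₀ ℕ) → ℝ≥0∞, Antitone F → (∀ d, F d ≤ 1) →
        cpLaw (ENNReal.ofReal u • N) F ≤ cpLaw (ENNReal.ofReal u' • n) F + E := fun F hF hF1 =>
      cpLaw_antitone_le (hmass u N hNt) (hmass u' n hnt) hF1
        (hup _ (hcompl F hF) fun d => tsub_le_self)
    rw [hE9]
    rcases le_total 1 E with hE1 | hE1
    · refine (cpLaw_le_one (hmass u n hnt) hprod1).trans (le_add_left (hE1.trans ?_))
      exact le_mul_of_one_le_left bot_le (by norm_num)
    · refine s1.trans ?_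
      rw [hfac]
      have l1 := cpLaw_le_one (hmass u' n hnt) hF₁
      have l2 := cpLaw_le_one (hmass u' n hnt) hF₂
      refine (mul_le_mul' (s2 F₁ m₁ hF₁) (s2 F₂ m₂ hF₂)).trans ?_
      generalize cpLaw (ENNReal.ofReal u' • n) F₁ = a at *
      generalize cpLaw (ENNReal.ofReal u' • n) F₂ = b at *
      calc (a + E) * (b + E) = a * b + (a * E + E * b + E * E) := by ring
        _ ≤ a * b + (1 * E + E * 1 + E * 1) := by gcongr
        _ = _ := by ring

end Killed

section GammaSums

lemma pi_fin_absolutelyContinuous : ∀ (n : ℕ) (μ ν : Fin n → Measure ℝ) [∀ i, SigmaFinite (μ i)]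
    [∀ i, SigmaFinite (ν i)], (∀ i, μ i ≪ ν i) → Measure.pi μ ≪ Measure.pi ν := by
  intro n
  induction n with
  | zero =>
    intro μ ν _ _ _
    rw [Measure.pi_of_empty μ 0, Measure.pi_of_empty ν 0]
  | succ n ih =>
    intro μ ν _ _ h
    have h1 := (measurePreserving_piFinSuccAbove μ 0).symm _
    have h2 := (measurePreserving_piFinSuccAbove ν 0).symm _
    rw [← h1.map_eq, ← h2.map_eq]
    exact ((h 0).prod (ih _ _ fun i => h _)).map h1.measurable

/-- Partial sums of independent variables, `d x` of them at the site `x`. -/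
def gsum {K : Type} (d : K →₀ ℕ) (ω : K → ℕ → ℝ) (x : K) : ℝ := ∑ i ∈ Finset.range (d x), ω x i

lemma measurable_gsum {K : Type} (d : K →₀ ℕ) : Measurable (gsum d) := by
  unfold gsum; fun_prop

variable {K : Type} [Fintype K]

lemma pi_absolutelyContinuous {μ ν : K → Measure ℝ} [∀ i, SigmaFinite (μ i)]
    [∀ i, SigmaFinite (ν i)] (h : ∀ i, μ i ≪ ν i) : Measure.pi μ ≪ Measure.pi ν := by
  have e := (Fintype.equivFin K).symm
  have h1 := measurePreserving_piCongrLeft μ e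
  have h2 := measurePreserving_piCongrLeft ν e
  rw [← h1.map_eq, ← h2.map_eq]
  exact (pi_fin_absolutelyContinuous _ _ _ fun i => h _).map h1.measurable

/-- Independent sequences of independent variables with laws `E x`. -/
def gPr (E : K → Measure ℝ) : Measure (K → ℕ → ℝ) :=
  Measure.pi fun x => Measure.infinitePi fun _ => E x

/-- The probability that the field of partial sums lies in `S`. -/
def gF (E : K → Measure ℝ) (S : Set (K → ℝ)) (d : K →₀ ℕ) : ℝ≥0∞ := gPr E {ω | gsum d ω ∈ S}

lemma gF_congr {E : K → Measure ℝ} {T : Set K} {S : Set (K → ℝ)}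
    (hS : ∀ f f' : K → ℝ, (∀ x ∈ T, f x = f' x) → f ∈ S → f' ∈ S)
    {d d' : K →₀ ℕ} (hd : ∀ x ∈ T, d x = d' x) : gF E S d = gF E S d' := by
  have : {ω | gsum d ω ∈ S} = {ω | gsum d' ω ∈ S} := by
    ext ω
    simp only [mem_ofPred_eq]
    exact ⟨hS _ _ fun x hx => by simp [gsum, hd x hx], hS _ _ fun x hx => by simp [gsum, hd x hx]⟩
  unfold gF; rw [this]

variable {E : K → Measure ℝ} [∀ x, IsProbabilityMeasure (E x)]

instance : IsProbabilityMeasure (gPr E) := by unfold gPr; infer_instance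

lemma gF_le_one (S : Set (K → ℝ)) (d : K →₀ ℕ) : gF E S d ≤ 1 := prob_le_one

lemma ae_gPr_nonneg (hE : ∀ x, E x (Iio 0) = 0) : ∀ᵐ ω ∂(gPr E), ∀ x i, 0 ≤ ω x i := by
  rw [ae_all_iff]
  intro x
  have h1 : ∀ᵐ z ∂(Measure.infinitePi fun _ : ℕ => E x), ∀ i, 0 ≤ z i := by
    rw [ae_all_iff]
    intro i
    have h2 : ∀ᵐ z ∂(E x), 0 ≤ z := by
      rw [ae_iff]; simpa [Iio] using hE x
    have h3 := Measure.infinitePi_map_eval (fun _ : ℕ => E x) i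
    rw [← h3] at h2
    exact ae_of_ae_map (measurable_pi_apply i).aemeasurable h2
  have h4 := (measurePreserving_eval (fun x => Measure.infinitePi fun _ : ℕ => E x) x)
  exact h4.quasiMeasurePreserving.ae h1

lemma gF_mono (hE : ∀ x, E x (Iio 0) = 0) {S : Set (K → ℝ)} (hS : IsUpperSet S) :
    Monotone (gF E S) := by
  intro d d' hd
  refine measure_mono_ae ?_
  filter_upwards [ae_gPr_nonneg hE] with ω hω h
  refine hS (fun x => ?_) h
  exact Finset.sum_le_sum_of_subset_of_nonneg (by simpa using hd x) fun i _ _ => hω x i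

lemma gF_anti (hE : ∀ x, E x (Iio 0) = 0) {S : Set (K → ℝ)} (hS : IsLowerSet S) :
    Antitone (gF E S) := by
  intro d d' hd
  refine measure_mono_ae ?_
  filter_upwards [ae_gPr_nonneg hE] with ω hω h
  refine hS (fun x => ?_) h
  exact Finset.sum_le_sum_of_subset_of_nonneg (by simpa using hd x) fun i _ _ => hω x i

lemma gF_inter {T : Set K} {S₁ S₂ : Set (K → ℝ)}
    (h₁ : ∀ f f' : K → ℝ, (∀ x ∈ T, f x = f' x) → f ∈ S₁ → f' ∈ S₁)
    (h₂ : ∀ f f' : K → ℝ, (∀ x ∉ T, f x = f' x) → f ∈ S₂ → f' ∈ S₂) (d : K →₀ ℕ) :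
    gF E (S₁ ∩ S₂) d = gF E S₁ d * gF E S₂ d := by
  set ν : (x : K) → Measure (ℕ → ℝ) := fun x => Measure.infinitePi fun _ => E x
  have hmp := measurePreserving_piEquivPiSubtypeProd ν (fun x => x ∈ T)
  set e := MeasurableEquiv.piEquivPiSubtypeProd (fun _ : K => ℕ → ℝ) (fun x => x ∈ T)
  set U₁ : Set (({x // x ∈ T}) → ℕ → ℝ) :=
    {a | gsum d (fun x => if h : x ∈ T then a ⟨x, h⟩ else 0) ∈ S₁}
  set U₂ : Set (({x // x ∉ T}) → ℕ → ℝ) :=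
    {a | gsum d (fun x => if h : x ∉ T then a ⟨x, h⟩ else 0) ∈ S₂}
  have e1 : {ω | gsum d ω ∈ S₁} = e ⁻¹' (U₁ ×ˢ univ) := by
    ext ω
    simp only [mem_ofPred_eq, mem_preimage, mem_prod, mem_univ, and_true, U₁]
    exact ⟨h₁ _ _ fun x hx => by simp [gsum, hx, e, MeasurableEquiv.piEquivPiSubtypeProd],
      h₁ _ _ fun x hx => by simp [gsum, hx, e, MeasurableEquiv.piEquivPiSubtypeProd]⟩
  have e2 : {ω | gsum d ω ∈ S₂} = e ⁻¹' (univ ×ˢ U₂) := by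
    ext ω
    simp only [mem_ofPred_eq, mem_preimage, mem_prod, mem_univ, true_and, U₂]
    exact ⟨h₂ _ _ fun x hx => by simp [gsum, hx, e, MeasurableEquiv.piEquivPiSubtypeProd],
      h₂ _ _ fun x hx => by simp [gsum, hx, e, MeasurableEquiv.piEquivPiSubtypeProd]⟩
  have e3 : {ω | gsum d ω ∈ S₁ ∩ S₂} = e ⁻¹' (U₁ ×ˢ U₂) := by
    have : {ω | gsum d ω ∈ S₁ ∩ S₂} = {ω | gsum d ω ∈ S₁} ∩ {ω | gsum d ω ∈ S₂} := rfl
    rw [this, e1, e2, ← preimage_inter, prod_inter_prod, inter_univ, univ_inter]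
  unfold gF gPr
  rw [e1, e2, e3, hmp.measure_preimage_equiv, hmp.measure_preimage_equiv,
    hmp.measure_preimage_equiv, Measure.prod_prod, Measure.prod_prod, Measure.prod_prod,
    measure_univ, measure_univ, mul_one, one_mul]

lemma sum_range_absolutelyContinuous {ρ : Measure ℝ} [IsProbabilityMeasure ρ] (hρ : ρ ≪ volume) (n : ℕ) :
    (Measure.infinitePi fun _ : ℕ => ρ).map (fun z => ∑ i ∈ Finset.range (n + 1), z i) ≪ volume := by
  have hi : ProbabilityTheory.iIndepFun (fun (i : ℕ) (z : ℕ → ℝ) => z i)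
      (Measure.infinitePi fun _ : ℕ => ρ) :=
    ProbabilityTheory.iIndepFun_infinitePi (X := fun _ x => x) (fun _ => measurable_id)
  have h1 := hi.indepFun_finsetSum_of_notMem (s := Finset.range n) (i := n)
    (fun i => measurable_pi_apply i) (by simp)
  have h2 := h1.map_add_eq_map_conv_map (by fun_prop) (measurable_pi_apply n)
  have h3 : (fun z : ℕ → ℝ => ∑ i ∈ Finset.range (n + 1), z i)
      = (∑ i ∈ Finset.range n, fun z : ℕ → ℝ => z i) + fun z => z n := by
    ext z; simp [Finset.sum_range_succ]
  rw [h3, h2]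
  have h4 := Measure.infinitePi_map_eval (fun _ : ℕ => ρ) n
  have h5 : (Measure.infinitePi fun _ : ℕ => ρ).map (fun z => z n) ≪ volume := by rw [h4]; exact hρ
  have : SFinite ((Measure.infinitePi fun _ : ℕ => ρ).map (fun z => z n)) := by
    rw [h4]; infer_instance
  exact Measure.conv_absolutelyContinuous h5

lemma gsum_notMem_frontier (hE : ∀ x, E x ≪ volume) (d : K →₀ ℕ) {N : Set (K → ℝ)}
    (hN : volume N = 0) (hmeas : MeasurableSet N)
    (hinv : ∀ f f' : K → ℝ, (∀ x, d x ≠ 0 → f x = f' x) → f ∈ N → f' ∈ N) :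
    gPr E {ω | gsum d ω ∈ N} = 0 := by
  set L : (K → ℕ → ℝ) → K → ℝ := fun ω x => ∑ i ∈ Finset.range ((d x - 1) + 1), ω x i
  have h1 : (gPr E).map L ≪ volume := by
    have h2 : (gPr E).map L = Measure.pi fun x => (Measure.infinitePi fun _ : ℕ => E x).map
        (fun z => ∑ i ∈ Finset.range ((d x - 1) + 1), z i) := by
      have : ∀ x, IsProbabilityMeasure ((Measure.infinitePi fun _ : ℕ => E x).map
        (fun z => ∑ i ∈ Finset.range ((d x - 1) + 1), z i)) := fun x =>
          Measure.isProbabilityMeasure_map (by fun_prop)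
      exact Measure.pi_map_pi (fun x => by fun_prop)
    have : ∀ x, IsProbabilityMeasure ((Measure.infinitePi fun _ : ℕ => E x).map
        (fun z => ∑ i ∈ Finset.range ((d x - 1) + 1), z i)) := fun x =>
          Measure.isProbabilityMeasure_map (by fun_prop)
    rw [h2, volume_pi]
    exact pi_absolutelyContinuous fun x => sum_range_absolutelyContinuous (hE x) _
  have h3 := h1 hN
  rw [Measure.map_apply (by fun_prop) hmeas] at h3
  refine measure_mono_null (fun ω hω => ?_) h3
  refine hinv _ _ (fun x hx => ?_) hω
  simp only [L, gsum]
  rw [Nat.sub_add_cancel (Nat.one_le_iff_ne_zero.2 hx)]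

lemma nullMeasurableSet_gsum (hE : ∀ x, E x ≪ volume) {S : Set (K → ℝ)} (hS : IsUpperSet S ∨ IsLowerSet S)
    (d : K →₀ ℕ) : NullMeasurableSet S ((gPr E).map (gsum d)) := by
  set p : (K → ℝ) → K → ℝ := fun f x => if d x = 0 then 0 else f x
  have hp : Monotone p := fun f f' h x => by
    simp only [p]; split_ifs
    · exact le_rfl
    · exact h x
  set U : Set (K → ℝ) := p ⁻¹' S
  have hU : volume (frontier U) = 0 := by
    rcases hS with hS | hS
    · exact IsUpperSet.null_frontier fun a b hab ha => hS (hp hab) ha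
    · exact IsLowerSet.null_frontier fun a b hab ha => hS (hp hab) ha
  have hinv : ∀ f f' : K → ℝ, (∀ x, d x ≠ 0 → f x = f' x) → f ∈ frontier U → f' ∈ frontier U := by
    intro f f' hff hf
    have h1 : (Homeomorph.addRight (f - f')) ⁻¹' U = U := by
      ext a
      have : p ((Homeomorph.addRight (f - f')) a) = p a := by
        ext x
        simp only [p, Homeomorph.coe_addRight, Pi.add_apply, Pi.sub_apply]
        split_ifs with hx
        · rfl
        · rw [hff x hx]; ring
      simp only [U, mem_preimage, this]
    have h2 := (Homeomorph.addRight (f - f')).preimage_frontier U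
    rw [h1] at h2
    rw [← h2, mem_preimage]
    simpa using hf
  have h3 := gsum_notMem_frontier hE d hU isClosed_frontier.measurableSet hinv
  have h4 : (gPr E).map (gsum d) (frontier U) = 0 := by
    rw [Measure.map_apply (measurable_gsum d) isClosed_frontier.measurableSet]; exact h3
  have h5 : NullMeasurableSet U ((gPr E).map (gsum d)) := nullMeasurableSet_of_null_frontier h4
  refine h5.congr ?_
  have h6 : MeasurableSet {f : K → ℝ | p f = f} :=
    measurableSet_eq_fun (measurable_pi_lambda _ fun x => by
      simp only [p]; split_ifs
      · exact measurable_const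
      · exact measurable_pi_apply x) measurable_id
  have h7 : ∀ᵐ f ∂((gPr E).map (gsum d)), p f = f := by
    rw [ae_map_iff (measurable_gsum d).aemeasurable h6]
    refine Eventually.of_forall fun ω => ?_
    ext x
    simp only [p]; split_ifs with hx
    · simp [gsum, hx]
    · rfl
  filter_upwards [h7] with f hf
  exact propext (show p f ∈ S ↔ f ∈ S by rw [hf])

lemma gF_eq_map (hE : ∀ x, E x ≪ volume) {S : Set (K → ℝ)} (hS : IsUpperSet S ∨ IsLowerSet S)
    (d : K →₀ ℕ) : gF E S d = (gPr E).map (gsum d) S :=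
  (Measure.map_apply₀ (measurable_gsum d).aemeasurable (nullMeasurableSet_gsum hE hS d)).symm

lemma lintegral_gsum (Vf : K → ℝ) (d : K →₀ ℕ) :
    ∫⁻ f, ENNReal.ofReal (Real.exp (∑ x, Vf x * f x)) ∂((gPr E).map (gsum d))
      = ∏ x, (∫⁻ z, ENNReal.ofReal (Real.exp (Vf x * z)) ∂(E x)) ^ d x := by
  rw [lintegral_map (by fun_prop) (measurable_gsum d)]
  have h1 : ∀ ω : K → ℕ → ℝ, ENNReal.ofReal (Real.exp (∑ x, Vf x * gsum d ω x))
      = ∏ x, ∏ i ∈ Finset.range (d x), ENNReal.ofReal (Real.exp (Vf x * ω x i)) := by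
    intro ω
    simp only [gsum]
    rw [Real.exp_sum, ENNReal.ofReal_prod_of_nonneg fun x _ => (Real.exp_pos _).le]
    refine Finset.prod_congr rfl fun x _ => ?_
    rw [Finset.mul_sum, Real.exp_sum, ENNReal.ofReal_prod_of_nonneg fun x _ => (Real.exp_pos _).le]
  simp only [h1]
  have hX : ∀ x, Measurable fun z : ℕ → ℝ =>
      ∏ i ∈ Finset.range (d x), ENNReal.ofReal (Real.exp (Vf x * z i)) := fun x => by fun_prop
  have hi := ProbabilityTheory.iIndepFun_pi (μ := fun x => Measure.infinitePi fun _ : ℕ => E x)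
    (X := fun x z => ∏ i ∈ Finset.range (d x), ENNReal.ofReal (Real.exp (Vf x * z i)))
    (fun x => (hX x).aemeasurable)
  have h2 := ProbabilityTheory.lintegral_prod_eq_prod_lintegral_of_indepFun Finset.univ _ hi
    (fun x => (hX x).comp (measurable_pi_apply x))
  unfold gPr
  rw [h2]
  refine Finset.prod_congr rfl fun x _ => ?_
  have h3 := (measurePreserving_eval (fun x => Measure.infinitePi fun _ : ℕ => E x) x)
  have h4 := h3.lintegral_comp (hX x)
  rw [h4]
  have hj : ProbabilityTheory.iIndepFun
      (fun (i : ℕ) (z : ℕ → ℝ) => ENNReal.ofReal (Real.exp (Vf x * z i)))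
      (Measure.infinitePi fun _ : ℕ => E x) :=
    ProbabilityTheory.iIndepFun_infinitePi
      (X := fun _ y => ENNReal.ofReal (Real.exp (Vf x * y))) (fun _ => by fun_prop)
  rw [ProbabilityTheory.lintegral_prod_eq_prod_lintegral_of_indepFun _ _ hj (fun i => by fun_prop)]
  rw [Finset.prod_congr rfl (g := fun _ => ∫⁻ z, ENNReal.ofReal (Real.exp (Vf x * z)) ∂(E x))]
  · simp
  · intro i _
    have h5 := Measure.infinitePi_map_eval (fun _ : ℕ => E x) i
    rw [← h5, lintegral_map (by fun_prop) (measurable_pi_apply i)]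
    rw [h5]

end GammaSums

section Uniqueness

variable {K : Type} [Fintype K]

lemma eqOn_complexMGF {Ω' : Type*} [MeasurableSpace Ω'] {X : Ω' → ℝ} {M N : Measure Ω'} {r : ℝ} (hr : 0 < r)
    (hM : ∀ t ∈ Ioo (-r) r, Integrable (fun w => Real.exp (t * X w)) M)
    (hN : ∀ t ∈ Ioo (-r) r, Integrable (fun w => Real.exp (t * X w)) N)
    (h : ∀ t ∈ Ioo (-r) r, ProbabilityTheory.mgf X M t = ProbabilityTheory.mgf X N t) :
    Set.EqOn (ProbabilityTheory.complexMGF X M) (ProbabilityTheory.complexMGF X N)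
      {z : ℂ | z.re ∈ Ioo (-r) r} := by
  have iM : Ioo (-r) r ⊆ interior (ProbabilityTheory.integrableExpSet X M) :=
    interior_maximal (fun t ht => hM t ht) isOpen_Ioo
  have iN : Ioo (-r) r ⊆ interior (ProbabilityTheory.integrableExpSet X N) :=
    interior_maximal (fun t ht => hN t ht) isOpen_Ioo
  have aM : AnalyticOnNhd ℂ (ProbabilityTheory.complexMGF X M) {z | z.re ∈ Ioo (-r) r} :=
    ProbabilityTheory.analyticOnNhd_complexMGF.mono fun z hz => iM hz
  have aN : AnalyticOnNhd ℂ (ProbabilityTheory.complexMGF X N) {z | z.re ∈ Ioo (-r) r} :=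
    ProbabilityTheory.analyticOnNhd_complexMGF.mono fun z hz => iN hz
  refine AnalyticOnNhd.eqOn_of_preconnected_of_frequently_eq aM aN
    ((convex_Ioo _ _).linear_preimage Complex.reLm).isPreconnected
    (z₀ := ((0 : ℝ) : ℂ)) (by simp [hr]) ?_
  have h_real : ∃ᶠ (x : ℝ) in 𝓝[≠] 0, ProbabilityTheory.complexMGF X M x
      = ProbabilityTheory.complexMGF X N x := by
    refine Eventually.frequently ?_
    refine eventually_nhdsWithin_of_eventually_nhds ?_
    filter_upwards [Ioo_mem_nhds (neg_lt_zero.2 hr) hr] with t ht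
    rw [ProbabilityTheory.complexMGF_ofReal, ProbabilityTheory.complexMGF_ofReal, h t ht]
  rw [frequently_iff_seq_forall] at h_real ⊢
  obtain ⟨xs, hx_tendsto, hx_eq⟩ := h_real
  refine ⟨fun n => xs n, ?_, fun n => ?_⟩
  · rw [tendsto_nhdsWithin_iff] at hx_tendsto ⊢
    constructor
    · rw [Filter.tendsto_ofReal_iff]
      exact hx_tendsto.1
    · simpa using hx_tendsto.2
  · simp [hx_eq]

lemma ext_of_exp_moments {M N : Measure (K → ℝ)} [IsFiniteMeasure M] [IsFiniteMeasure N] {ρ : ℝ} (hρ : 0 < ρ)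
    (htop : ∀ Vf : K → ℝ, (∀ x, |Vf x| ≤ ρ) → ∫⁻ f, ENNReal.ofReal (Real.exp (∑ x, Vf x * f x)) ∂M ≠ ⊤)
    (h : ∀ Vf : K → ℝ, (∀ x, |Vf x| ≤ ρ) → ∫⁻ f, ENNReal.ofReal (Real.exp (∑ x, Vf x * f x)) ∂M
      = ∫⁻ f, ENNReal.ofReal (Real.exp (∑ x, Vf x * f x)) ∂N) : M = N := by
  refine Measure.ext_of_charFunDual (funext fun L => ?_)
  set w : K → ℝ := fun x => L (Pi.single x 1)
  have hL : ∀ f : K → ℝ, L f = ∑ x, w x * f x := by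
    intro f
    conv_lhs => rw [← Finset.univ_sum_single f]
    rw [map_sum]
    refine Finset.sum_congr rfl fun x _ => ?_
    have : (Pi.single x (f x) : K → ℝ) = f x • Pi.single x 1 := by
      rw [← Pi.single_smul]; simp
    rw [this, map_smul, smul_eq_mul, mul_comm]
  set s : ℝ := 1 + ∑ x, |w x|
  have hs : 0 < s := by
    have : 0 ≤ ∑ x, |w x| := Finset.sum_nonneg fun _ _ => abs_nonneg _
    simp only [s]; linarith
  have hw : ∀ t ∈ Ioo (-(ρ / s)) (ρ / s), ∀ x, |t * w x| ≤ ρ := by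
    intro t ht x
    have h1 : |w x| ≤ s := by
      have := Finset.single_le_sum (fun y _ => abs_nonneg (w y)) (Finset.mem_univ x)
      simp only [s]; linarith
    have h2 : |t| ≤ ρ / s := (abs_lt.2 ht).le
    rw [abs_mul]
    calc |t| * |w x| ≤ ρ / s * s := mul_le_mul h2 h1 (abs_nonneg _) (by positivity)
      _ = ρ := div_mul_cancel₀ _ hs.ne'
  have hexp : ∀ t (f : K → ℝ), t * L f = ∑ x, t * w x * f x := fun t f => by
    rw [hL, Finset.mul_sum]; exact Finset.sum_congr rfl fun x _ => by ring
  have hmeas : ∀ t, Measurable fun f : K → ℝ => Real.exp (t * L f) := fun t => by fun_prop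
  have iM : ∀ t ∈ Ioo (-(ρ / s)) (ρ / s), Integrable (fun f => Real.exp (t * L f)) M := by
    intro t ht
    refine ⟨(hmeas t).aestronglyMeasurable, ?_⟩
    rw [hasFiniteIntegral_iff_ofReal (Eventually.of_forall fun f => (Real.exp_pos _).le)]
    simp only [hexp]
    exact lt_top_iff_ne_top.2 (htop _ (hw t ht))
  have iN : ∀ t ∈ Ioo (-(ρ / s)) (ρ / s), Integrable (fun f => Real.exp (t * L f)) N := by
    intro t ht
    refine ⟨(hmeas t).aestronglyMeasurable, ?_⟩
    rw [hasFiniteIntegral_iff_ofReal (Eventually.of_forall fun f => (Real.exp_pos _).le)]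
    simp only [hexp]
    rw [← h _ (hw t ht)]
    exact lt_top_iff_ne_top.2 (htop _ (hw t ht))
  have hmgf : ∀ t ∈ Ioo (-(ρ / s)) (ρ / s),
      ProbabilityTheory.mgf (fun f => L f) M t = ProbabilityTheory.mgf (fun f => L f) N t := by
    intro t ht
    simp only [ProbabilityTheory.mgf]
    rw [integral_eq_lintegral_of_nonneg_ae (Eventually.of_forall fun f => (Real.exp_pos _).le)
      (hmeas t).aestronglyMeasurable,
      integral_eq_lintegral_of_nonneg_ae (Eventually.of_forall fun f => (Real.exp_pos _).le)
      (hmeas t).aestronglyMeasurable]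
    simp only [hexp]
    rw [h _ (hw t ht)]
  have key := eqOn_complexMGF (by positivity : 0 < ρ / s) iM iN hmgf
    (show Complex.I ∈ {z : ℂ | z.re ∈ Ioo (-(ρ / s)) (ρ / s)} by
      rw [mem_ofPred_eq]; simp only [Complex.I_re, mem_Ioo]
      exact ⟨neg_lt_zero.2 (by positivity), by positivity⟩)
  simp only [ProbabilityTheory.complexMGF] at key
  simp only [charFunDual_apply]
  simpa only [mul_comm] using key

end Uniqueness

section ExponentialVisits

/-- The probability of the visit vector `d` under the compound Poisson law. -/
def cpWt {K : Type} (p : MvPowerSeries K ℝ≥0∞) (d : K →₀ ℕ) : ℝ≥0∞ :=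
  (eexp (psMass p))⁻¹ * ∑' k : ℕ, (k.factorial : ℝ≥0∞)⁻¹ * MvPowerSeries.coeff d (p ^ k)

lemma cpLaw_eq_tsum {K : Type} (p : MvPowerSeries K ℝ≥0∞) (F : (K →₀ ℕ) → ℝ≥0∞) :
    cpLaw p F = ∑' d, cpWt p d * F d := by
  unfold cpLaw cpInt cpWt psInt
  rw [tsum_congr (fun k : ℕ => ENNReal.tsum_mul_left.symm), ENNReal.tsum_comm,
    ← ENNReal.tsum_mul_left]
  refine tsum_congr fun d => ?_
  rw [mul_assoc, ← ENNReal.tsum_mul_right]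
  simp only [mul_assoc]

variable {K : Type} [Fintype K]

lemma expMeasure_absolutelyContinuous (h : ℝ) : ProbabilityTheory.expMeasure h ≪ volume :=
  withDensity_absolutelyContinuous _ _

lemma expMeasure_Iio (h : ℝ) : ProbabilityTheory.expMeasure h (Iio 0) = 0 := by
  have h1 := ProbabilityTheory.lintegral_exponentialPDF_of_nonpos (r := h) le_rfl
  unfold ProbabilityTheory.expMeasure ProbabilityTheory.gammaMeasure
  rw [withDensity_apply _ measurableSet_Iio]
  exact h1

lemma lintegral_expMeasure {h v : ℝ} (hh : 0 < h) (hv : v < h) :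
    ∫⁻ z, ENNReal.ofReal (Real.exp (v * z)) ∂(ProbabilityTheory.expMeasure h)
      = ENNReal.ofReal (h / (h - v)) := by
  have hd : 0 < h - v := by linarith
  have h1 : ∀ z, ProbabilityTheory.gammaPDF 1 h z * ENNReal.ofReal (Real.exp (v * z))
      = ENNReal.ofReal (h / (h - v)) * ProbabilityTheory.exponentialPDF (h - v) z := by
    intro z
    change ProbabilityTheory.exponentialPDF h z * _ = _
    rcases lt_or_ge z 0 with hz | hz
    · rw [ProbabilityTheory.exponentialPDF_of_neg hz, ProbabilityTheory.exponentialPDF_of_neg hz]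
      simp
    · rw [ProbabilityTheory.exponentialPDF_of_nonneg hz, ProbabilityTheory.exponentialPDF_of_nonneg hz,
        ← ENNReal.ofReal_mul (by positivity), ← ENNReal.ofReal_mul (by positivity)]
      congr 1
      have : Real.exp (-((h - v) * z)) = Real.exp (-(h * z)) * Real.exp (v * z) := by
        rw [← Real.exp_add]; congr 1; ring
      rw [this]; field_simp
  unfold ProbabilityTheory.expMeasure ProbabilityTheory.gammaMeasure
  rw [lintegral_withDensity_eq_lintegral_mul₀]
  · simp only [Pi.mul_apply, h1]
    rw [lintegral_const_mul, ProbabilityTheory.lintegral_exponentialPDF_eq_one hd, mul_one]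
    exact (ProbabilityTheory.measurable_gammaPDFReal 1 (h - v)).ennreal_ofReal
  · exact (ProbabilityTheory.measurable_gammaPDFReal 1 h).ennreal_ofReal.aemeasurable
  · exact (by fun_prop : Measurable fun z : ℝ => ENNReal.ofReal (Real.exp (v * z))).aemeasurable

/-- The law of the field of local times. -/
def cpM (E : K → Measure ℝ) (p : MvPowerSeries K ℝ≥0∞) : Measure (K → ℝ) :=
  Measure.sum fun d => cpWt p d • (gPr E).map (gsum d)

lemma lintegral_cpM (E : K → Measure ℝ) (p : MvPowerSeries K ℝ≥0∞) (F : (K → ℝ) → ℝ≥0∞) :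
    ∫⁻ f, F f ∂(cpM E p) = cpLaw p fun d => ∫⁻ f, F f ∂((gPr E).map (gsum d)) := by
  rw [cpM, lintegral_sum_measure, cpLaw_eq_tsum]
  simp only [lintegral_smul_measure, smul_eq_mul]

variable {E : K → Measure ℝ} [∀ x, IsProbabilityMeasure (E x)]

lemma nullMeasurableSet_cpM (hE : ∀ x, E x ≪ volume) (p : MvPowerSeries K ℝ≥0∞) {S : Set (K → ℝ)}
    (hS : IsUpperSet S ∨ IsLowerSet S) : NullMeasurableSet S (cpM E p) := by
  rw [← aemeasurable_indicator_const_iff (1 : ℝ)]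
  refine AEMeasurable.sum_measure fun d => ?_
  have := (aemeasurable_indicator_const_iff (1 : ℝ)).2 (nullMeasurableSet_gsum hE hS d)
  exact this.smul_measure _

lemma cpM_apply (hE : ∀ x, E x ≪ volume) (p : MvPowerSeries K ℝ≥0∞) {S : Set (K → ℝ)}
    (hS : IsUpperSet S ∨ IsLowerSet S) : cpM E p S = cpLaw p (gF E S) := by
  rw [cpLaw_eq_tsum, cpM, Measure.sum_apply₀ _ (nullMeasurableSet_cpM hE p hS)]
  refine tsum_congr fun d => ?_
  rw [Measure.smul_apply, smul_eq_mul, gF_eq_map hE hS]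

lemma isProbabilityMeasure_cpM {p : MvPowerSeries K ℝ≥0∞} (hp : psMass p ≠ ⊤) :
    IsProbabilityMeasure (cpM E p) := by
  refine ⟨?_⟩
  have h1 : cpM E p univ = ∫⁻ _, 1 ∂(cpM E p) := by simp
  rw [h1, lintegral_cpM]
  have h2 : ∀ d : K →₀ ℕ, ∫⁻ _, 1 ∂((gPr E).map (gsum d)) = 1 := fun d => by
    have := Measure.isProbabilityMeasure_map (μ := gPr E) (measurable_gsum d).aemeasurable
    simp
  simp only [h2]
  exact cpLaw_one hp

end ExponentialVisits

section LawOfField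

variable {K : Type} [Fintype K] {G A : K → K → ℝ}

/-- The law of a field satisfying the interlacement Laplace identity, on monotone events. -/
lemma IsKilled.law (h : IsKilled G A) {Ω : Type} [MeasurableSpace Ω] {μ : Measure Ω}
    [IsProbabilityMeasure μ] {X : Ω → K → ℝ} {u ρ : ℝ} (hu : 0 < u) (hρ : 0 < ρ)
    (hX : ∀ Vf : K → ℝ, (∀ x, |Vf x| ≤ ρ) → ∃ f : K → ℝ, (∀ x, 0 ≤ f x) ∧
      (∀ x, ∑ y, A x y * f y - Vf x * f x = ∑ y, A x y) ∧
      ∫ ω, Real.exp (∑ x, Vf x * X ω x) ∂μ = Real.exp (u * ∑ x, Vf x * f x))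
    {S : Set (K → ℝ)} (hS : IsUpperSet S ∨ IsLowerSet S) :
    μ {ω | X ω ∈ S} = cpLaw (ENNReal.ofReal u • killN A)
      (gF (fun x => ProbabilityTheory.expMeasure (A x x)) S) := by
  set E : K → Measure ℝ := fun x => ProbabilityTheory.expMeasure (A x x)
  have hE : ∀ x, IsProbabilityMeasure (E x) := fun x =>
    ProbabilityTheory.isProbabilityMeasure_expMeasure (h.diag_pos x)
  have hEac : ∀ x, E x ≪ volume := fun x => expMeasure_absolutelyContinuous _
  set p := ENNReal.ofReal u • killN A with hp
  have hpm : psMass p = ENNReal.ofReal (u * ∑ x, ∑ y, A x y) := by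
    rw [ENNReal.ofReal_mul hu.le, ← h.psMass_killN]
    exact psInt_smul _ _ _
  have hpt : psMass p ≠ ⊤ := by rw [hpm]; exact ENNReal.ofReal_ne_top
  have := isProbabilityMeasure_cpM (E := E) hpt
  set g : ℝ := 1 + ∑ x, ∑ y, G x y with hg
  have hG0 : ∀ x, 0 ≤ ∑ y, G x y := fun x => Finset.sum_nonneg fun y _ => h.green_nonneg x y
  have hG00 : 0 ≤ ∑ x, ∑ y, G x y := Finset.sum_nonneg fun x _ => hG0 x
  have hg0 : 0 < g := by linarith
  have hGg : ∀ x y, G x y ≤ g := fun x y => by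
    have h1 := Finset.single_le_sum (fun z _ => h.green_nonneg x z) (Finset.mem_univ y)
    have h2 := Finset.single_le_sum (fun z _ => hG0 z) (Finset.mem_univ x)
    linarith
  set r : ℝ := min ρ (1 / (2 * g)) with hr
  have hr0 : 0 < r := lt_min hρ (by positivity)
  have hrg : r * g ≤ 1 / 2 := by
    calc r * g ≤ 1 / (2 * g) * g := mul_le_mul_of_nonneg_right (min_le_right _ _) hg0.le
      _ = 1 / 2 := by field_simp
  have hAg : ∀ x, r < A x x := by
    intro x
    have h1 := h.one_le_diag x
    have h2 : A x x * G x x ≤ A x x * g := mul_le_mul_of_nonneg_left (hGg x x) (h.diag_pos x).le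
    by_contra hc
    have h3 := mul_le_mul_of_nonneg_right (not_lt.1 hc) hg0.le
    linarith
  have hinj : ∀ Vf : K → ℝ, (∀ x, |Vf x| ≤ r) → ∀ f : K → ℝ,
      (∀ x, ∑ y, A x y * f y = Vf x * f x) → ∀ x, f x = 0 := by
    intro Vf hV f hf
    have h1 : ∀ x, f x = ∑ z, G x z * (Vf z * f z) := by
      intro x
      have : ∑ z, G x z * (Vf z * f z) = ∑ y, (∑ z, G x z * A z y) * f y := by
        simp only [← hf, Finset.mul_sum, Finset.sum_mul]
        rw [Finset.sum_comm]
        simp only [mul_assoc]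
      rw [this]
      simp only [h.inv_right]
      simp
    have h2 : ∀ x, |f x| ≤ (∑ y, G x y) * (r * ∑ z, |f z|) := by
      intro x
      rw [h1 x, Finset.sum_mul]
      refine (Finset.abs_sum_le_sum_abs _ _).trans (Finset.sum_le_sum fun z _ => ?_)
      rw [abs_mul, abs_mul, abs_of_nonneg (h.green_nonneg x z)]
      refine mul_le_mul_of_nonneg_left (mul_le_mul (hV z) ?_ (abs_nonneg _) hr0.le) (h.green_nonneg x z)
      exact Finset.single_le_sum (fun y _ => abs_nonneg (f y)) (Finset.mem_univ z)
    have h3 : ∑ x, |f x| ≤ (∑ x, ∑ y, G x y) * (r * ∑ z, |f z|) := by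
      rw [Finset.sum_mul]; exact Finset.sum_le_sum fun x _ => h2 x
    have h4 : 0 ≤ ∑ x, |f x| := Finset.sum_nonneg fun x _ => abs_nonneg _
    have h5 : (∑ x, ∑ y, G x y) * (r * ∑ z, |f z|) ≤ 1 / 2 * ∑ x, |f x| := by
      rw [← mul_assoc]
      refine mul_le_mul_of_nonneg_right ?_ h4
      have : (∑ x, ∑ y, G x y) * r ≤ g * r := mul_le_mul_of_nonneg_right (by linarith) hr0.le
      linarith
    intro x
    have h6 := Finset.single_le_sum (fun y _ => abs_nonneg (f y)) (Finset.mem_univ x)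
    exact abs_eq_zero.1 (le_antisymm (by linarith) (abs_nonneg _))
  have hexpint : ∀ Vf : K → ℝ, (∀ x, |Vf x| ≤ r) → Integrable (fun ω => Real.exp (∑ x, Vf x * X ω x)) μ := by
    intro Vf hV
    obtain ⟨f, -, -, hf⟩ := hX Vf fun x => (hV x).trans (min_le_left _ _)
    refine Integrable.of_integral_ne_zero ?_
    rw [hf]; exact (Real.exp_pos _).ne'
  have hXm : AEMeasurable X μ := by
    refine aemeasurable_pi_lambda _ fun x => ?_
    have h1 := (hexpint (Pi.single x r) fun y => by
      by_cases hy : y = x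
      · subst hy; simp [abs_of_pos hr0]
      · simp [hy, hr0.le]).aestronglyMeasurable.aemeasurable
    have h2 := (Real.measurable_log.comp_aemeasurable h1).const_mul r⁻¹
    refine h2.congr (Eventually.of_forall fun ω => ?_)
    simp only [Function.comp, Real.log_exp, Pi.single_apply, ite_mul, zero_mul,
      Finset.sum_ite_eq', Finset.mem_univ, if_true]
    field_simp
  have hlap : ∀ Vf : K → ℝ, (∀ x, |Vf x| ≤ r) →
      ∫⁻ f, ENNReal.ofReal (Real.exp (∑ x, Vf x * f x)) ∂(μ.map X)
      = ∫⁻ f, ENNReal.ofReal (Real.exp (∑ x, Vf x * f x)) ∂(cpM E p) ∧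
      ∫⁻ f, ENNReal.ofReal (Real.exp (∑ x, Vf x * f x)) ∂(μ.map X) ≠ ⊤ := by
    intro Vf hV
    obtain ⟨f, hf0, hfe, hf⟩ := hX Vf fun x => (hV x).trans (min_le_left _ _)
    have hVA : ∀ x, Vf x < A x x := fun x => ((le_abs_self _).trans (hV x)).trans_lt (hAg x)
    have h1 : ∫⁻ f, ENNReal.ofReal (Real.exp (∑ x, Vf x * f x)) ∂(μ.map X)
        = ENNReal.ofReal (Real.exp (u * ∑ x, Vf x * f x)) := by
      rw [lintegral_map' (by fun_prop : Measurable fun f : K → ℝ =>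
        ENNReal.ofReal (Real.exp (∑ x, Vf x * f x))).aemeasurable hXm, ← hf, ofReal_integral_eq_lintegral_ofReal (hexpint Vf hV)
        (Eventually.of_forall fun ω => (Real.exp_pos _).le)]
    refine ⟨?_, by rw [h1]; exact ENNReal.ofReal_ne_top⟩
    rw [h1, lintegral_cpM]
    simp only [lintegral_gsum]
    have h2 : (fun d : K →₀ ℕ => ∏ x, (∫⁻ z, ENNReal.ofReal (Real.exp (Vf x * z)) ∂(E x)) ^ d x)
        = wtF fun x => A x x / (A x x - Vf x) := by
      ext d
      simp only [E, wtF]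
      refine Finset.prod_congr rfl fun x _ => ?_
      rw [lintegral_expMeasure (h.diag_pos x) (hVA x)]
    rw [h2, cpLaw, cpInt_of_multiplicative (wtF_add _) (wtF_zero _), hpm, hp, psInt_smul,
      h.psInt_killN hVA hf0 hfe (hinj Vf hV), ← ENNReal.ofReal_mul hu.le,
      eexp_ofReal (mul_nonneg hu.le (Finset.sum_nonneg fun x _ => h.esc_nonneg x)),
      eexp_ofReal (mul_nonneg hu.le (Finset.sum_nonneg fun x _ => mul_nonneg (h.esc_nonneg x) (hf0 x))),
      ← ENNReal.ofReal_inv_of_pos (Real.exp_pos _),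
      ← ENNReal.ofReal_mul (inv_nonneg.2 (Real.exp_pos _).le), ← Real.exp_neg, ← Real.exp_add]
    congr 2
    have h3 : ∑ x, (∑ y, A x y) * f x = ∑ x, ∑ y, A x y * f y := by
      simp only [Finset.sum_mul]
      rw [Finset.sum_comm]
      refine Finset.sum_congr rfl fun x _ => Finset.sum_congr rfl fun y _ => ?_
      rw [h.symm]
    have h4 : ∑ x, ∑ y, A x y = ∑ x, ∑ y, A x y * f y - ∑ x, Vf x * f x := by
      rw [← Finset.sum_sub_distrib]
      exact Finset.sum_congr rfl fun x _ => (hfe x).symm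
    rw [h3, h4]; ring
  have : IsProbabilityMeasure (μ.map X) := Measure.isProbabilityMeasure_map hXm
  have key : μ.map X = cpM E p :=
    ext_of_exp_moments hr0 (fun Vf hV => (hlap Vf hV).2) fun Vf hV => (hlap Vf hV).1
  rw [← cpM_apply hEac p hS, ← key]
  refine (Measure.map_apply₀ hXm ?_).symm
  rw [key]
  exact nullMeasurableSet_cpM hEac p hS

/-- Decoupling of monotone events for a field satisfying the interlacement Laplace identity. -/
lemma IsKilled.decoupling_field (h : IsKilled G A) {Ω : Type} [MeasurableSpace Ω] {μ : Measure Ω}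
    [IsProbabilityMeasure μ] {X : ℝ → Ω → K → ℝ}  {ρ : ℝ} (hρ : 0 < ρ)
    (hX : ∀ u, 0 < u → ∀ Vf : K → ℝ, (∀ x, |Vf x| ≤ ρ) → ∃ f : K → ℝ, (∀ x, 0 ≤ f x) ∧
      (∀ x, ∑ y, A x y * f y - Vf x * f x = ∑ y, A x y) ∧
      ∫ ω, Real.exp (∑ x, Vf x * X u ω x) ∂μ = Real.exp (u * ∑ x, Vf x * f x))
    {η κ u u' e : ℝ} {T : Set K} (hη : 0 ≤ η)
    (hA : ∀ x y, ¬(x ∈ T ↔ y ∈ T) → -A x y ≤ η * ((∑ z, A x z) * ∑ z, A y z))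
    (hκ : ∑ x, ∑ y, A x y = κ) (hκ0 : 0 < κ) (he : 0 < e) (he' : e ≤ 1 / 4) (hθ : η * κ ≤ e / 8)
    (hu' : 0 < u') (hu : (1 + 4 * e) * u' ≤ u) {S₁ S₂ : Set (K → ℝ)}
    (h₁ : ∀ f f' : K → ℝ, (∀ x ∈ T, f x = f' x) → f ∈ S₁ → f' ∈ S₁)
    (h₂ : ∀ f f' : K → ℝ, (∀ x ∉ T, f x = f' x) → f ∈ S₂ → f' ∈ S₂) :
    (IsUpperSet S₁ → IsUpperSet S₂ → μ {ω | X u' ω ∈ S₁ ∩ S₂} ≤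
      μ {ω | X u ω ∈ S₁} * μ {ω | X u ω ∈ S₂} +
        ENNReal.ofReal (9 * Real.exp (-(u' * κ * e ^ 2 / 8)))) ∧
    (IsLowerSet S₁ → IsLowerSet S₂ → μ {ω | X u ω ∈ S₁ ∩ S₂} ≤
      μ {ω | X u' ω ∈ S₁} * μ {ω | X u' ω ∈ S₂} +
        ENNReal.ofReal (9 * Real.exp (-(u' * κ * e ^ 2 / 8)))) := by
  have hu0 : 0 < u := by nlinarith
  set E : K → Measure ℝ := fun x => ProbabilityTheory.expMeasure (A x x) with hEdef
  have hE : ∀ x, IsProbabilityMeasure (E x) := fun x =>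
    ProbabilityTheory.isProbabilityMeasure_expMeasure (h.diag_pos x)
  have hE0 : ∀ x, E x (Iio 0) = 0 := fun x => expMeasure_Iio _
  have key := h.decoupling hη hA hκ hκ0 he he' hθ hu'.le hu (F₁ := gF E S₁) (F₂ := gF E S₂)
    (fun d d' hd => gF_congr h₁ hd)
    (fun d d' hd => gF_congr (T := Tᶜ) h₂ hd)
    (gF_le_one S₁) (gF_le_one S₂)
  have hi : gF E (S₁ ∩ S₂) = fun d => gF E S₁ d * gF E S₂ d := funext (gF_inter h₁ h₂)
  refine ⟨fun k₁ k₂ => ?_, fun k₁ k₂ => ?_⟩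
  · rw [h.law hu' hρ (hX u' hu') (Or.inl (k₁.inter k₂)), h.law hu0 hρ (hX u hu0) (Or.inl k₁),
      h.law hu0 hρ (hX u hu0) (Or.inl k₂), ← hEdef, hi]
    exact key.1 (gF_mono hE0 k₁) (gF_mono hE0 k₂)
  · rw [h.law hu0 hρ (hX u hu0) (Or.inr (k₁.inter k₂)), h.law hu' hρ (hX u' hu') (Or.inr k₁),
      h.law hu' hρ (hX u' hu') (Or.inr k₂), ← hEdef, hi]
    exact key.2 (gF_anti hE0 k₁) (gF_anti hE0 k₂)

end LawOfField

section LocalTimeDecoupling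

variable {G : Type} {lam dd g : G → G → ℝ} {m : G → ℝ} {nb : G → Finset G}
  {α ν c C J : ℝ} {S : Finset G} {A : G → G → ℝ}

lemma IsGreenInv.inv' (hA : IsGreenInv g S A) (hg : ∀ x y, g x y = g y x) {x y : G} (hx : x ∈ S)
    (hy : y ∈ S) : ∑ z ∈ S, A x z * g z y = if x = y then 1 else 0 := by
  rw [← if_congr (eq_comm (a := y) (b := x)) rfl rfl, ← hA.inv y hy x hx]
  exact Finset.sum_congr rfl fun z _ => by rw [hg z y, hA.symm x z, mul_comm]

lemma PotData.isKilled (h : PotData lam dd g m nb α ν c C J) (hA : IsGreenInv g S A) :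
    IsKilled (fun x y : S => g x y) (fun x y : S => A x y) where
  symm x y := hA.symm x y
  green_nonneg x y := (h.g_pos x y).le
  inv_left x y := by
    rw [Finset.sum_coe_sort S (fun z => A x z * g z y), hA.inv' h.g_symm x.2 y.2]
    simp only [Subtype.ext_iff]
  inv_right x y := by
    rw [Finset.sum_coe_sort S (fun z => g x z * A z y), hA.inv x x.2 y y.2]
    simp only [Subtype.ext_iff]
  offdiag x y hxy := h.inv_offdiag hA y.2 x.2 fun h' => hxy (Subtype.ext h')
  esc_nonneg x := by
    rw [Finset.sum_coe_sort S (fun z => A x z)]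
    exact h.eqm_nonneg hA x.2

lemma GVop_eq_sum {Vf : G → ℝ} (hV : ∀ x ∉ S, Vf x = 0) (f : G → ℝ) (x : G) :
    GVop g Vf f x = ∑ y ∈ S, g x y * Vf y * f y :=
  tsum_eq_sum fun y hy => by rw [hV y hy]; ring

/-- The Neumann series of `GV` applied to the constant `1`. -/
lemma exists_neumann {Vf : G → ℝ} (hV : ∀ x ∉ S, Vf x = 0)
    (hb : ∀ x, ∑ y ∈ S, |g x y * Vf y| ≤ 1 / 2) {F : G → ℝ}
    (hF : F = fun x => ∑' n : ℕ, (GVop g Vf)^[n] (fun _ => 1) x) :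
    (∀ x, 0 ≤ F x) ∧ ∀ x, F x = 1 + ∑ y ∈ S, g x y * Vf y * F y := by
  set T : ℕ → G → ℝ := fun n => (GVop g Vf)^[n] (fun _ => 1) with hT
  have hsucc : ∀ n x, T (n + 1) x = ∑ y ∈ S, g x y * Vf y * T n y := fun n x => by
    rw [hT, ← GVop_eq_sum hV]; simp only [Function.iterate_succ_apply']
  have hbd : ∀ n x, |T n x| ≤ (1 / 2) ^ n := by
    intro n
    induction n with
    | zero => intro x; simp [hT]
    | succ n ih =>
      intro x
      rw [hsucc]
      calc |∑ y ∈ S, g x y * Vf y * T n y| ≤ ∑ y ∈ S, |g x y * Vf y| * (1 / 2) ^ n :=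
            (Finset.abs_sum_le_sum_abs _ _).trans (Finset.sum_le_sum fun y _ => by
              rw [abs_mul]; exact mul_le_mul_of_nonneg_left (ih y) (abs_nonneg _))
        _ ≤ 1 / 2 * (1 / 2) ^ n := by
            rw [← Finset.sum_mul]; exact mul_le_mul_of_nonneg_right (hb x) (by positivity)
        _ = (1 / 2) ^ (n + 1) := by rw [pow_succ]; ring
  have hs : ∀ x, Summable fun n => T n x := fun x =>
    Summable.of_norm_bounded summable_geometric_two fun n => hbd n x
  have hF2 : ∀ x, |F x| ≤ 2 := fun x => by
    rw [hF]
    have := tsum_of_norm_bounded (f := fun n => T n x) hasSum_geometric_two (fun n => hbd n x)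
    simpa using this
  have heq : ∀ x, F x = 1 + ∑ y ∈ S, g x y * Vf y * F y := by
    intro x
    have h1 : F x = T 0 x + ∑' n, T (n + 1) x := by rw [hF]; exact (hs x).tsum_eq_zero_add
    rw [h1]
    congr 1
    simp_rw [hsucc]
    rw [Summable.tsum_finsetSum fun y _ => (hs y).mul_left _]
    exact Finset.sum_congr rfl fun y _ => by rw [tsum_mul_left, hF]
  refine ⟨fun x => ?_, heq⟩
  have : |∑ y ∈ S, g x y * Vf y * F y| ≤ 1 := by
    calc |∑ y ∈ S, g x y * Vf y * F y| ≤ ∑ y ∈ S, |g x y * Vf y| * 2 :=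
          (Finset.abs_sum_le_sum_abs _ _).trans (Finset.sum_le_sum fun y _ => by
            rw [abs_mul]; exact mul_le_mul_of_nonneg_left (hF2 y) (abs_nonneg _))
      _ ≤ 1 := by rw [← Finset.sum_mul]; linarith [hb x]
  rw [heq x]
  linarith [neg_le_of_abs_le this]

variable {Ω : Type} [MeasurableSpace Ω] {μ : Measure Ω} {ℓ : G → ℝ → Ω → ℝ}

/-- The Laplace functional of the local times restricted to a finite set. -/
lemma PotData.laplace_finset (h : PotData lam dd g m nb α ν c C J) (hA : IsGreenInv g S A)
    (hℓ : LocalTimes μ g ℓ) {ρ : ℝ} (hρ : S.card * (C * ρ) ≤ 1 / 2) {u : ℝ} (hu : 0 < u)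
    (Vf : S → ℝ) (hVf : ∀ x, |Vf x| ≤ ρ) :
    ∃ f : S → ℝ, (∀ x, 0 ≤ f x) ∧
      (∀ x : S, ∑ y : S, A x y * f y - Vf x * f x = ∑ y : S, A x y) ∧
      ∫ ω, Real.exp (∑ x : S, Vf x * ℓ x u ω) ∂μ = Real.exp (u * ∑ x, Vf x * f x) := by
  set V' : G → ℝ := fun x => if hx : x ∈ S then Vf ⟨x, hx⟩ else 0 with hV'
  have hV0 : ∀ x ∉ S, V' x = 0 := fun x hx => by simp [hV', hx]
  have hVS : ∀ x : S, V' x = Vf x := fun x => by simp [hV']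
  have hVρ : ∀ x ∈ S, |V' x| ≤ ρ := fun x hx => by rw [hVS ⟨x, hx⟩]; exact hVf _
  have hb : ∀ x, ∑ y ∈ S, |g x y * V' y| ≤ 1 / 2 := fun x => by
    refine le_trans (Finset.sum_le_card_nsmul _ _ (C * ρ) fun y hy => ?_) (by simpa using hρ)
    rw [abs_mul, abs_of_pos (h.g_pos x y)]
    exact mul_le_mul (h.green_le x y) (hVρ y hy) (abs_nonneg _) h.C_pos.le
  obtain ⟨F, hF⟩ : ∃ F : G → ℝ, F = fun x => ∑' n : ℕ, (GVop g V')^[n] (fun _ => 1) x := ⟨_, rfl⟩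
  obtain ⟨hF0, hFe⟩ := exists_neumann hV0 hb hF
  refine ⟨fun x => F x, fun x => hF0 x, fun x => ?_, ?_⟩
  · rw [Finset.sum_coe_sort S (fun y => A x y * F y), Finset.sum_coe_sort S (fun y => A x y)]
    have h1 : ∑ y ∈ S, A x y * F y =
        ∑ y ∈ S, A x y + ∑ z ∈ S, (∑ y ∈ S, A x y * g y z) * (V' z * F z) := by
      simp only [Finset.sum_mul]
      rw [Finset.sum_comm, ← Finset.sum_add_distrib]
      refine Finset.sum_congr rfl fun y _ => ?_
      conv_lhs => rw [hFe y, mul_add, mul_one, Finset.mul_sum]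
      congr 1
      exact Finset.sum_congr rfl fun z _ => by ring
    have h2 : ∑ z ∈ S, (∑ y ∈ S, A x y * g y z) * (V' z * F z) = Vf x * F x := by
      rw [Finset.sum_congr rfl fun z hz => congrArg (· * (V' z * F z)) (hA.inv' h.g_symm x.2 hz)]
      simp [hVS]
    rw [h1, h2]; ring
  · have key := hℓ.laplace u hu V' (S.finite_toSet.subset fun x hx => by
      by_contra h'; exact hx (hV0 x h')) ⟨1 / 2, by norm_num, fun x => by
        rw [tsum_eq_sum (s := S) fun y hy => by simp [hV0 y hy]]; exact hb x⟩
    have h1 : ∀ φ : G → ℝ, ∑' x, V' x * φ x = ∑ x : S, Vf x * φ x := fun φ => by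
      rw [tsum_eq_sum (s := S) fun y hy => by simp [hV0 y hy],
        ← Finset.sum_coe_sort S (fun y => V' y * φ y)]
      exact Finset.sum_congr rfl fun x _ => by rw [hVS]
    simp only [h1] at key
    rw [hF]
    exact key

/-- Decoupling of monotone events depending on the local times in two distant balls, at the price
of a small change of the level. -/
theorem PotData.exists_decoupling (h : PotData lam dd g m nb α ν c C J) [IsProbabilityMeasure μ]
    (hℓ : LocalTimes μ g ℓ) :
    ∃ a b : ℝ, 0 < a ∧ 0 < b ∧ ∀ (x₁ x₂ : G) (r D e u u' : ℝ), 1 ≤ r → J ≤ r → 10 * r ≤ D →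
      D ≤ dd x₁ x₂ → 0 < e → e ≤ 1 / 4 → a * (r / D) ^ ν ≤ e → 0 < u' → (1 + 4 * e) * u' ≤ u →
      ∀ S₁ S₂ : Set (G → ℝ),
      (∀ f f' : G → ℝ, (∀ x, dd x₁ x ≤ r → f x = f' x) → f ∈ S₁ → f' ∈ S₁) →
      (∀ f f' : G → ℝ, (∀ x, dd x₂ x ≤ r → f x = f' x) → f ∈ S₂ → f' ∈ S₂) →
      (IsUpperSet S₁ → IsUpperSet S₂ →
        μ {ω | (fun x => ℓ x u' ω) ∈ S₁ ∩ S₂} ≤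
          μ {ω | (fun x => ℓ x u ω) ∈ S₁} * μ {ω | (fun x => ℓ x u ω) ∈ S₂} +
          ENNReal.ofReal (9 * Real.exp (-(b * (u' * r ^ ν * e ^ 2))))) ∧
      (IsLowerSet S₁ → IsLowerSet S₂ →
        μ {ω | (fun x => ℓ x u ω) ∈ S₁ ∩ S₂} ≤
          μ {ω | (fun x => ℓ x u' ω) ∈ S₁} * μ {ω | (fun x => ℓ x u' ω) ∈ S₂} +
          ENNReal.ofReal (9 * Real.exp (-(b * (u' * r ^ ν * e ^ 2))))) := by
  obtain ⟨Kc, hKc, hcap⟩ := h.exists_le_cap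
  have hC := h.C_pos
  have hc := h.c_pos
  have h20 : (0:ℝ) < 20 ^ ν := Real.rpow_pos_of_pos (by norm_num) _
  refine ⟨64 * C / c * 20 ^ ν, Kc / 8, by positivity, by positivity, ?_⟩
  intro x₁ x₂ r D e u u' hr hJr hrD hDx he he' hae hu' hu S₁ S₂ hS₁ hS₂
  set S : Finset G := (h.finite_ball x₁ r).toFinset ∪ (h.finite_ball x₂ r).toFinset with hSdef
  have hmem : ∀ x, x ∈ S ↔ dd x₁ x ≤ r ∨ dd x₂ x ≤ r := fun x => by
    simp [hSdef, vball]
  obtain ⟨A, hAs, hAi⟩ := h.exists_inverse S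
  have hA : IsGreenInv g S A := ⟨hAs, hAi⟩
  have hk := h.isKilled hA
  have hSb : ∀ x ∈ S, dd x₁ x ≤ r ∨ dd x₂ x ≤ r := fun x hx => (hmem x).1 hx
  have hκu := h.cap_le hA hr hSb
  have hκl := hcap S A hA x₁ r hr fun x hx => (hmem x).2 (Or.inl hx)
  set κ := ∑ x ∈ S, eqm S A x with hκ
  have hD : 0 < D := by linarith
  have hrν : 0 < r ^ ν := Real.rpow_pos_of_pos (by linarith) _
  have hκ0 : 0 < κ := (mul_pos hKc hrν).trans_le hκl
  have hρr : r ≤ D / 5 / 2 := by linarith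
  have hρJ : J ≤ D / 5 / 2 := by linarith
  have hsm : 64 * C / c * (20 * r / D) ^ ν ≤ e := by
    rw [mul_div_assoc 20 r D, Real.mul_rpow (by norm_num) (by positivity)]
    linarith
  have hcomp : ∀ t : ℝ, 0 < t → t ≤ 10 → C * (D / t) ^ (-ν) * κ ≤ 2 * (C / c * (20 * r / D) ^ ν) := by
    intro t ht ht'
    have h1 : (D / t) ^ (-ν) * (2 * r) ^ ν ≤ (20 * r / D) ^ ν := by
      rw [Real.rpow_neg (by positivity), ← Real.inv_rpow (by positivity),
        ← Real.mul_rpow (by positivity) (by positivity)]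
      refine Real.rpow_le_rpow (by positivity) ?_ h.nu_pos.le
      rw [inv_div, div_mul_eq_mul_div, div_le_div_iff_of_pos_right hD]
      nlinarith
    have h0 : 0 < (D / t) ^ (-ν) := Real.rpow_pos_of_pos (by positivity) _
    calc C * (D / t) ^ (-ν) * κ ≤ C * (D / t) ^ (-ν) * (2 * (c⁻¹ * (2 * r) ^ ν)) :=
          mul_le_mul_of_nonneg_left hκu (by positivity)
      _ = 2 * (C / c * ((D / t) ^ (-ν) * (2 * r) ^ ν)) := by field_simp
      _ ≤ _ := by gcongr
  have hcap' : C * (D / 5 / 2) ^ (-ν) * ∑ x ∈ S, eqm S A x ≤ 1 / 2 := by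
    have := hcomp 10 (by norm_num) le_rfl
    rw [show D / 5 / 2 = D / 10 by ring]
    have h3 : 64 * C / c * (20 * r / D) ^ ν = 64 * (C / c * (20 * r / D) ^ ν) := by ring
    linarith
  have hoff := fun {z y : G} => h.neg_inv_le hA hρr hρJ hSb (by linarith : 5 * (D / 5) ≤ dd x₁ x₂)
    hcap' (z := z) (y := y)
  set T : Set S := {x | dd x₁ x ≤ r} with hT
  have hT2 : ∀ x : S, x ∉ T → dd x₂ x ≤ r := fun x hx => by
    rw [hT, mem_ofPred_eq] at hx
    exact (hSb x x.2).resolve_left hx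
  have heq : ∀ x : S, ∑ y : S, A x y = eqm S A x := fun x => Finset.sum_coe_sort S (fun y => A x y)
  have hAT : ∀ x y : S, ¬(x ∈ T ↔ y ∈ T) → -A x y ≤
      4 * C * (D / 5) ^ (-ν) * ((∑ z : S, A x z) * ∑ z : S, A y z) := by
    intro x y hxy
    rw [heq, heq]
    by_cases hx : x ∈ T
    · have hy : y ∉ T := fun hy => hxy ⟨fun _ => hy, fun _ => hx⟩
      exact hoff x.2 hx y.2 (hT2 y hy)
    · have hy : y ∈ T := by by_contra hy; exact hxy ⟨fun h' => (hx h').elim, fun h' => (hy h').elim⟩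
      rw [hA.symm, mul_comm (eqm S A x)]
      exact hoff y.2 hy x.2 (hT2 x hx)
  have hκ' : ∑ x : S, ∑ y : S, A x y = κ := by
    simp only [heq]; exact Finset.sum_coe_sort S (fun x => eqm S A x)
  have hρpos : 0 < 1 / (2 * ((S.card + 1) * C)) := by positivity
  have hρle : S.card * (C * (1 / (2 * ((S.card + 1) * C)))) ≤ 1 / 2 := by
    have : (0:ℝ) ≤ S.card := Nat.cast_nonneg _
    field_simp
    linarith
  have hθ : 4 * C * (D / 5) ^ (-ν) * κ ≤ e / 8 := by
    have := hcomp 5 (by norm_num) (by norm_num)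
    have h3 : 64 * C / c * (20 * r / D) ^ ν = 64 * (C / c * (20 * r / D) ^ ν) := by ring
    linarith
  set ex : (S → ℝ) → G → ℝ := fun f x => if hx : x ∈ S then f ⟨x, hx⟩ else 0 with hex
  have hexm : Monotone ex := fun f f' hf x => by
    simp only [hex]; split_ifs with hx
    · exact hf _
    · exact le_rfl
  have hexS : ∀ (f : S → ℝ) (x : G) (hx : x ∈ S), ex f x = f ⟨x, hx⟩ := fun f x hx => by
    simp [hex, hx]
  have hev₁ : ∀ u ω, (fun x : S => ℓ x u ω) ∈ ex ⁻¹' S₁ ↔ (fun x => ℓ x u ω) ∈ S₁ := fun u ω =>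
    ⟨hS₁ _ _ fun x hx => hexS (fun x : S => ℓ x u ω) x ((hmem x).2 (Or.inl hx)),
      hS₁ _ _ fun x hx => (hexS (fun x : S => ℓ x u ω) x ((hmem x).2 (Or.inl hx))).symm⟩
  have hev₂ : ∀ u ω, (fun x : S => ℓ x u ω) ∈ ex ⁻¹' S₂ ↔ (fun x => ℓ x u ω) ∈ S₂ := fun u ω =>
    ⟨hS₂ _ _ fun x hx => hexS (fun x : S => ℓ x u ω) x ((hmem x).2 (Or.inr hx)),
      hS₂ _ _ fun x hx => (hexS (fun x : S => ℓ x u ω) x ((hmem x).2 (Or.inr hx))).symm⟩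
  have key := hk.decoupling_field (X := fun u ω (x : S) => ℓ x u ω) (μ := μ) hρpos
    (fun u hu Vf hVf => h.laplace_finset hA hℓ hρle hu Vf hVf)
    (η := 4 * C * (D / 5) ^ (-ν)) (T := T) (by positivity) hAT hκ' hκ0 he he' hθ hu' hu
    (S₁ := ex ⁻¹' S₁) (S₂ := ex ⁻¹' S₂)
    (fun f f' hf => hS₁ _ _ fun x hx => by
      have hx' := (hmem x).2 (Or.inl hx)
      rw [hexS _ x hx', hexS _ x hx']; exact hf _ hx)
    (fun f f' hf => hS₂ _ _ fun x hx => by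
      have hx' := (hmem x).2 (Or.inr hx)
      rw [hexS _ x hx', hexS _ x hx']
      refine hf _ fun hx1 => ?_
      rw [hT, mem_ofPred_eq] at hx1
      linarith [h.dd_triangle x₁ x x₂, h.dd_symm x x₂])
  simp only [mem_inter_iff, hev₁, hev₂] at key
  have herr : ENNReal.ofReal (9 * Real.exp (-(u' * κ * e ^ 2 / 8))) ≤
      ENNReal.ofReal (9 * Real.exp (-(Kc / 8 * (u' * r ^ ν * e ^ 2)))) := by
    refine ENNReal.ofReal_le_ofReal (mul_le_mul_of_nonneg_left (Real.exp_le_exp.2 ?_) (by norm_num))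
    have : u' * e ^ 2 * (Kc * r ^ ν) ≤ u' * e ^ 2 * κ :=
      mul_le_mul_of_nonneg_left hκl (by positivity)
    linarith
  exact ⟨fun k₁ k₂ => (key.1 (k₁.preimage hexm) (k₂.preimage hexm)).trans
      (add_le_add_right herr _),
    fun k₁ k₂ => (key.2 (k₁.preimage hexm) (k₂.preimage hexm)).trans (add_le_add_right herr _)⟩

end LocalTimeDecoupling

section Walk

variable {V : Type} [MeasurableSpace V] {lam dd : V → V → ℝ} {P : V → Measure (ℕ → V)}
  {α ν c₃ C₃ : ℝ}

/-- The finite set of neighbours of a vertex. -/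
def Standing.nbs (h : Standing lam dd P α ν c₃ C₃) (x : V) : Finset V := (h.locFin x).toFinset

lemma Standing.mem_nbs (h : Standing lam dd P α ν c₃ C₃) {x y : V} : y ∈ h.nbs x ↔ 0 < lam x y := by
  simp [Standing.nbs]

lemma Standing.lam_eq_zero (h : Standing lam dd P α ν c₃ C₃) {x y : V} (hy : y ∉ h.nbs x) :
    lam x y = 0 :=
  le_antisymm (not_lt.1 fun h' => hy (h.mem_nbs.2 h')) (h.lam_nonneg x y)

lemma Standing.lamTot_eq_sum (h : Standing lam dd P α ν c₃ C₃) (x : V) :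
    lamTot lam x = ∑ y ∈ h.nbs x, lam x y :=
  tsum_eq_sum fun _ hy => h.lam_eq_zero hy

lemma Standing.lamTot_pos (h : Standing lam dd P α ν c₃ C₃) (x : V) : 0 < lamTot lam x := by
  refine lt_of_le_of_ne (tsum_nonneg fun y => h.lam_nonneg x y) fun h0 => ?_
  obtain ⟨c₂, C₂, hc₂, -, hg, -⟩ := h.greenBounds
  have := (hg x).1
  rw [green, ← h0, inv_zero, zero_mul] at this
  linarith

lemma Standing.exists_nbr (h : Standing lam dd P α ν c₃ C₃) (x : V) : ∃ y, 0 < lam x y := by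
  by_contra hc
  push Not at hc
  have := h.lamTot_pos x
  rw [h.lamTot_eq_sum] at this
  exact absurd this (not_lt.2 (Finset.sum_nonpos fun y _ => hc y))

lemma Standing.tsum_step (h : Standing lam dd P α ν c₃ C₃) (x : V) :
    ∑' y, ENNReal.ofReal (lam x y / lamTot lam x) = 1 := by
  rw [tsum_eq_sum (s := h.nbs x) fun y hy => by simp [h.lam_eq_zero hy],
    ← ENNReal.ofReal_sum_of_nonneg fun y _ => div_nonneg (h.lam_nonneg x y) (h.lamTot_pos x).le,
    ← Finset.sum_div, ← h.lamTot_eq_sum, div_self (h.lamTot_pos x).ne', ENNReal.ofReal_one]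

/-- The one-step transition probabilities force the σ-algebra to separate points. -/
lemma Standing.measurableSingletonClass (h : Standing lam dd P α ν c₃ C₃) :
    MeasurableSingletonClass V := by
  have hcount := h.countable
  refine ⟨fun y => ?_⟩
  suffices hC : measurableAtom y = {y} by
    rw [← hC]; exact MeasurableSet.measurableAtom_of_countable y
  refine Subset.antisymm (fun y' hy' => ?_) (singleton_subset_iff.2 (mem_measurableAtom_self y))
  by_contra hne
  rw [mem_singleton_iff] at hne
  obtain ⟨z, hz⟩ := h.exists_nbr y'
  have hprob := h.prob z
  have hpos : 0 < lam z y' := by rw [h.lam_symm]; exact hz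
  set E := toMeasurable (P z) {ω : ℕ → V | ω 1 = y} with hE
  have hEm : MeasurableSet E := measurableSet_toMeasurable _ _
  have hEs : {ω : ℕ → V | ω 1 = y'} ⊆ E := by
    intro ω hω
    rw [mem_ofPred_eq] at hω
    have hm : MeasurableSet ((fun v => Function.update ω 1 v) ⁻¹' E) :=
      (measurable_update ω) hEm
    have hy : y ∈ (fun v => Function.update ω 1 v) ⁻¹' E :=
      subset_toMeasurable (P z) {ω : ℕ → V | ω 1 = y} (by simp)
    have := mem_of_mem_measurableAtom hy' hm hy
    rwa [mem_preimage, ← hω, Function.update_eq_self] at this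
  have h1 : (1 : ℝ≥0∞) ≤ ∑' v, if v = y' then 0 else ENNReal.ofReal (lam z v / lamTot lam z) := by
    calc (1 : ℝ≥0∞) = P z univ := measure_univ.symm
      _ ≤ P z (⋃ v, if v = y' then ∅ else toMeasurable (P z) {ω : ℕ → V | ω 1 = v}) := by
          refine measure_mono fun ω _ => ?_
          rw [mem_iUnion]
          by_cases hω : ω 1 = y'
          · exact ⟨y, by rw [if_neg (Ne.symm hne)]; exact hEs hω⟩
          · exact ⟨ω 1, by rw [if_neg hω]; exact subset_toMeasurable _ _ rfl⟩
      _ ≤ _ := by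
          refine (measure_iUnion_le _).trans (ENNReal.tsum_le_tsum fun v => ?_)
          split_ifs with hv
          · simp
          · rw [measure_toMeasurable, h.step]
  have h2 := h.tsum_step z
  rw [ENNReal.tsum_eq_add_tsum_ite y'] at h2
  have hq : 0 < ENNReal.ofReal (lam z y' / lamTot lam z) :=
    ENNReal.ofReal_pos.2 (div_pos hpos (h.lamTot_pos z))
  set T := ∑' v, if v = y' then 0 else ENNReal.ofReal (lam z v / lamTot lam z) with hT
  have hT1 : T ≠ ⊤ := ne_top_of_le_ne_top ENNReal.one_ne_top (h2 ▸ le_add_self)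
  have : T < ENNReal.ofReal (lam z y' / lamTot lam z) + T := by
    rw [add_comm]; exact ENNReal.lt_add_right hT1 hq.ne'
  rw [h2] at this
  exact absurd h1 (not_le.2 this)

/-- The `k`-step transition probabilities. -/
def stepP (P : V → Measure (ℕ → V)) (k : ℕ) (x y : V) : ℝ := (P x {ω | ω k = y}).toReal

lemma Standing.measurableSet_eval (h : Standing lam dd P α ν c₃ C₃) (k : ℕ) (y : V) :
    MeasurableSet {ω : ℕ → V | ω k = y} := by
  have := h.measurableSingletonClass
  exact (measurable_pi_apply (X := fun _ : ℕ => V) k) (measurableSet_singleton y)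

lemma stepP_nonneg (k : ℕ) (x y : V) : 0 ≤ stepP P k x y := ENNReal.toReal_nonneg

lemma Standing.stepP_zero (h : Standing lam dd P α ν c₃ C₃) (x y : V) :
    stepP P 0 x y = if x = y then 1 else 0 := by
  have := h.prob x
  split_ifs with hxy
  · rw [← hxy, stepP, h.start, ENNReal.toReal_one]
  · have h1 : P x {ω | ω 0 = x}ᶜ = 0 :=
      (prob_compl_eq_zero_iff (h.measurableSet_eval 0 x)).2 (h.start x)
    have h2 : {ω : ℕ → V | ω 0 = y} ⊆ {ω | ω 0 = x}ᶜ := fun ω hω h' => hxy (h'.symm.trans hω)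
    rw [stepP, measure_mono_null h2 h1, ENNReal.toReal_zero]

lemma Standing.stepP_add (h : Standing lam dd P α ν c₃ C₃) (j k : ℕ) (x y : V) :
    P x {ω | ω (j + k) = y} = ∑' z, P x {ω | ω j = z} * P z {ω | ω k = y} := by
  have := h.countable
  have h1 : {ω : ℕ → V | ω (j + k) = y} =
      ⋃ z, ({ω | ω j = z} ∩ {ω | (fun n => ω (j + n)) ∈ {ω : ℕ → V | ω k = y}}) := by
    ext ω; simp
  rw [h1, measure_iUnion]
  · exact tsum_congr fun z => h.markov x z j _ (h.measurableSet_eval k y)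
  · intro z z' hz
    refine Set.disjoint_left.2 fun ω hω hω' => hz ?_
    exact hω.1.symm.trans hω'.1
  · exact fun z => (h.measurableSet_eval j z).inter (h.measurableSet_eval (j + k) y)

lemma Standing.stepP_succ (h : Standing lam dd P α ν c₃ C₃) (k : ℕ) (x y : V) :
    stepP P (k + 1) x y = ∑ z ∈ h.nbs x, lam x z / lamTot lam x * stepP P k z y := by
  have hp := h.prob
  rw [stepP, add_comm k 1, h.stepP_add, tsum_eq_sum (s := h.nbs x) fun z hz => by
    rw [h.step, h.lam_eq_zero hz]; simp]
  rw [ENNReal.toReal_sum fun z _ => ENNReal.mul_ne_top (measure_ne_top _ _) (measure_ne_top _ _)]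
  refine Finset.sum_congr rfl fun z _ => ?_
  rw [ENNReal.toReal_mul, h.step, ENNReal.toReal_ofReal
    (div_nonneg (h.lam_nonneg x z) (h.lamTot_pos x).le), stepP]

lemma Standing.stepP_succ' (h : Standing lam dd P α ν c₃ C₃) (k : ℕ) (x y : V) :
    stepP P (k + 1) x y = ∑ z ∈ h.nbs y, stepP P k x z * (lam z y / lamTot lam z) := by
  have hp := h.prob
  rw [stepP, h.stepP_add, tsum_eq_sum (s := h.nbs y) fun z hz => by
    rw [h.step, h.lam_symm, h.lam_eq_zero hz]; simp]
  rw [ENNReal.toReal_sum fun z _ => ENNReal.mul_ne_top (measure_ne_top _ _) (measure_ne_top _ _)]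
  refine Finset.sum_congr rfl fun z _ => ?_
  rw [ENNReal.toReal_mul, h.step, ENNReal.toReal_ofReal
    (div_nonneg (h.lam_nonneg z y) (h.lamTot_pos z).le), stepP]

lemma Standing.stepP_symm (h : Standing lam dd P α ν c₃ C₃) (k : ℕ) (x y : V) :
    lamTot lam x * stepP P k x y = lamTot lam y * stepP P k y x := by
  induction k generalizing x y with
  | zero =>
    rw [h.stepP_zero, h.stepP_zero]
    by_cases hxy : x = y
    · rw [hxy]
    · rw [if_neg hxy, if_neg (Ne.symm hxy)]; simp
  | succ k ih =>
    rw [h.stepP_succ, h.stepP_succ', Finset.mul_sum, Finset.mul_sum]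
    refine Finset.sum_congr rfl fun z _ => ?_
    have hx := h.lamTot_pos x
    have hz := h.lamTot_pos z
    have hi := ih z y
    rw [h.lam_symm z x]
    field_simp
    linear_combination lam x z * hi

lemma Standing.green_pos (h : Standing lam dd P α ν c₃ C₃) (x y : V) : 0 < green lam P x y := by
  obtain ⟨c₂, C₂, hc₂, -, hg, hg'⟩ := h.greenBounds
  by_cases hxy : x = y
  · rw [hxy]; exact hc₂.trans_le (hg y).1
  · exact (mul_pos hc₂ (Real.rpow_pos_of_pos (h.dd_pos x y hxy) _)).trans_le (hg' x y hxy).1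

lemma Standing.summable_stepP (h : Standing lam dd P α ν c₃ C₃) (x y : V) :
    Summable fun k => stepP P k x y := by
  by_contra hs
  have := h.green_pos x y
  rw [green] at this
  simp only [stepP] at hs
  rw [tsum_eq_zero_of_not_summable hs] at this
  simp at this

lemma Standing.green_symm (h : Standing lam dd P α ν c₃ C₃) (x y : V) :
    green lam P x y = green lam P y x := by
  rw [green, green, ← tsum_mul_left, ← tsum_mul_left]
  refine tsum_congr fun k => ?_
  have hx := h.lamTot_pos x
  have hy := h.lamTot_pos y
  have := h.stepP_symm k x y
  simp only [stepP] at this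
  field_simp
  linarith

lemma Standing.lap_green (h : Standing lam dd P α ν c₃ C₃) (x y : V) :
    lap lam h.nbs (fun z => green lam P z y) x = if x = y then 1 else 0 := by
  have hx := h.lamTot_pos x
  have hy := h.lamTot_pos y
  have h1 : ∑' k, stepP P k x y = stepP P 0 x y + ∑ z ∈ h.nbs x, lam x z / lamTot lam x *
      ∑' k, stepP P k z y := by
    rw [(h.summable_stepP x y).tsum_eq_zero_add]
    congr 1
    simp_rw [h.stepP_succ]
    rw [Summable.tsum_finsetSum fun z _ => (h.summable_stepP z y).mul_left _]
    exact Finset.sum_congr rfl fun z _ => tsum_mul_left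
  have hgr : ∀ z, green lam P z y = (lamTot lam y)⁻¹ * ∑' k, stepP P k z y := fun z => rfl
  have h2 : ∑ z ∈ h.nbs x, lam x z / lamTot lam x * ∑' k, stepP P k z y =
      (lamTot lam x)⁻¹ * ∑ z ∈ h.nbs x, lam x z * ∑' k, stepP P k z y := by
    rw [Finset.mul_sum]
    exact Finset.sum_congr rfl fun z _ => by ring
  have h3 : ∑ z ∈ h.nbs x, lam x z * ((lamTot lam y)⁻¹ * ∑' k, stepP P k z y) =
      (lamTot lam y)⁻¹ * ∑ z ∈ h.nbs x, lam x z * ∑' k, stepP P k z y := by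
    rw [Finset.mul_sum]
    exact Finset.sum_congr rfl fun z _ => by ring
  simp only [lap, mul_sub, Finset.sum_sub_distrib, ← Finset.sum_mul, ← h.lamTot_eq_sum, hgr]
  rw [h3, h1, h2, h.stepP_zero]
  split_ifs with hxy
  · subst hxy; field_simp; ring
  · field_simp; ring

lemma Standing.dd_nonneg (h : Standing lam dd P α ν c₃ C₃) (x y : V) : 0 ≤ dd x y := by
  by_cases hxy : x = y
  · rw [hxy, h.dd_self]
  · exact (h.dd_pos x y hxy).le

lemma Standing.exists_lamTot_ge (h : Standing lam dd P α ν c₃ C₃) :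
    ∃ a : ℝ, 0 < a ∧ ∀ x, a ≤ lamTot lam x := by
  obtain ⟨c₂, C₂, hc₂, hcC, hg, -⟩ := h.greenBounds
  have hC₂ : 0 < C₂ := hc₂.trans_le hcC
  refine ⟨C₂⁻¹, inv_pos.2 hC₂, fun x => ?_⟩
  have h1 : 1 ≤ ∑' k, stepP P k x x := by
    have := (h.summable_stepP x x).le_tsum 0 fun k _ => stepP_nonneg k x x
    rwa [h.stepP_zero, if_pos rfl] at this
  have h2 : (lamTot lam x)⁻¹ * ∑' k, stepP P k x x ≤ C₂ := (hg x).2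
  rw [inv_le_comm₀ hC₂ (h.lamTot_pos x)]
  nlinarith [inv_pos.2 (h.lamTot_pos x)]

lemma Standing.summable_ball (h : Standing lam dd P α ν c₃ C₃) (x : V) {r : ℝ} (hr : 1 ≤ r) :
    Summable fun y : vball dd x r => lamTot lam y := by
  obtain ⟨c₁, C₁, hc₁, -, hv⟩ := h.vol
  by_contra hs
  have := (hv x r hr).1
  rw [tsum_eq_zero_of_not_summable hs] at this
  exact absurd this (not_le.2 (mul_pos hc₁ (Real.rpow_pos_of_pos (by linarith) _)))

lemma Standing.finite_vball (h : Standing lam dd P α ν c₃ C₃) (x : V) (r : ℝ) :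
    (vball dd x r).Finite := by
  obtain ⟨a, ha, hal⟩ := h.exists_lamTot_ge
  have hs := (h.summable_ball x (le_max_left 1 r)).tendsto_cofinite_zero
  have hev := hs.eventually (gt_mem_nhds ha)
  rw [Filter.eventually_cofinite] at hev
  have hfin : (univ : Set (vball dd x (max 1 r))).Finite :=
    hev.subset fun y _ => by rw [mem_ofPred_eq]; exact not_lt.2 (hal y)
  have := Set.finite_univ_iff.1 hfin
  have hf : (vball dd x (max 1 r)).Finite := Set.toFinite _
  exact hf.subset fun y hy => by
    rw [vball, mem_ofPred_eq] at hy ⊢; exact hy.trans (le_max_right _ _)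

lemma Standing.exists_jump (h : Standing lam dd P α ν c₃ C₃) :
    ∃ J : ℝ, 1 ≤ J ∧ ∀ x y, 0 < lam x y → dd x y ≤ J := by
  obtain ⟨c₂, C₂, hc₂, hcC, hg, hg'⟩ := h.greenBounds
  obtain ⟨c, hc, hp⟩ := h.p0
  have hC₂ : 0 < C₂ := hc₂.trans_le hcC
  refine ⟨max 1 ((C₂ / (c * c₂)) ^ ν⁻¹), le_max_left _ _, fun x y hxy => ?_⟩
  have hne : x ≠ y := fun h' => by rw [h', h.lam_diag] at hxy; exact hxy.false
  have hd := h.dd_pos x y hne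
  have h1 := h.lap_green x y
  rw [if_neg hne] at h1
  simp only [lap, mul_sub, Finset.sum_sub_distrib, ← Finset.sum_mul, ← h.lamTot_eq_sum] at h1
  have h2 : lam x y * green lam P y y ≤ ∑ z ∈ h.nbs x, lam x z * green lam P z y :=
    Finset.single_le_sum (f := fun z => lam x z * green lam P z y)
      (fun z _ => mul_nonneg (h.lam_nonneg x z) (h.green_pos z y).le) (h.mem_nbs.2 hxy)
  have hx := h.lamTot_pos x
  have h3 := hp x y hxy
  rw [le_div_iff₀ hx] at h3
  have h4 : c * c₂ ≤ green lam P x y := by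
    have : c * lamTot lam x * c₂ ≤ lamTot lam x * green lam P x y := by
      calc c * lamTot lam x * c₂ ≤ lam x y * green lam P y y :=
            mul_le_mul h3 (hg y).1 hc₂.le hxy.le
        _ ≤ _ := by linarith
    nlinarith
  have h5 := h4.trans (hg' x y hne).2
  rw [Real.rpow_neg hd.le] at h5
  have hdν : 0 < dd x y ^ ν := Real.rpow_pos_of_pos hd _
  refine le_trans ?_ (le_max_right _ _)
  rw [Real.le_rpow_inv_iff_of_pos hd.le (by positivity) h.nu_pos, le_div_iff₀ (by positivity)]
  field_simp at h5
  linarith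

/-- The standing assumptions provide potential-theoretic data. -/
lemma Standing.exists_potData (h : Standing lam dd P α ν c₃ C₃) :
    ∃ c C J : ℝ, PotData lam dd (green lam P) (lamTot lam) h.nbs α ν c C J := by
  obtain ⟨J, hJ, hjump⟩ := h.exists_jump
  obtain ⟨c₂, C₂, hc₂, hcC, hg, hg'⟩ := h.greenBounds
  obtain ⟨c₁, C₁, hc₁, hcC₁, hv⟩ := h.vol
  have hνα : ν < α := by linarith [h.nu_le]
  have hsum : ∀ x r, ∑ y ∈ (h.finite_vball x r).toFinset, lamTot lam y =
      ∑' y : vball dd x r, lamTot lam y := fun x r => by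
    rw [tsum_subtype (vball dd x r) (lamTot lam), tsum_eq_sum (s := (h.finite_vball x r).toFinset)
      fun y hy => indicator_of_notMem (by simpa using hy) _]
    exact Finset.sum_congr rfl fun y hy => (indicator_of_mem (by simpa using hy) _).symm
  refine ⟨min c₁ c₂, max C₁ C₂, J, {
    mem_nb := fun x y => h.mem_nbs
    lam_symm := h.lam_symm
    dd_nonneg := h.dd_nonneg
    dd_self := h.dd_self
    dd_symm := h.dd_symm
    dd_triangle := h.dd_triangle
    finite_ball := h.finite_vball
    one_le_J := hJ
    jump := hjump
    g_symm := h.green_symm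
    g_pos := h.green_pos
    g_diag := fun x => (hg x).2.trans (le_max_right _ _)
    g_far := fun x y D hD hxy => ?_
    g_near := fun x y D hD hxy => ?_
    lap_g := h.lap_green
    m_nonneg := fun x => (h.lamTot_pos x).le
    vol_ge := fun x r hr => ?_
    vol_le := fun x r hr => ?_
    nu_pos := h.nu_pos
    nu_lt := hνα
    c_pos := lt_min hc₁ hc₂
    c_le := (min_le_left _ _).trans (hcC₁.trans (le_max_left _ _)) }⟩
  · have hne : x ≠ y := fun h' => by rw [h', h.dd_self] at hxy; linarith
    refine (hg' x y hne).2.trans (mul_le_mul (le_max_right _ _) ?_ (by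
      have := h.dd_nonneg x y; positivity) ((hc₂.le.trans hcC).trans (le_max_right _ _)))
    exact Real.rpow_le_rpow_of_nonpos hD hxy (by linarith [h.nu_pos])
  · have hD0 : 0 < D := by linarith
    by_cases hne : x = y
    · rw [← hne]
      refine le_trans ?_ (hg x).1
      calc min c₁ c₂ * D ^ (-ν) ≤ c₂ * 1 := mul_le_mul (min_le_right _ _)
            (Real.rpow_le_one_of_one_le_of_nonpos hD (by linarith [h.nu_pos])) (by positivity) hc₂.le
        _ = c₂ := mul_one _
    · refine le_trans (mul_le_mul (min_le_right _ _) ?_ (by positivity) hc₂.le) (hg' x y hne).1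
      exact Real.rpow_le_rpow_of_nonpos (h.dd_pos x y hne) hxy (by linarith [h.nu_pos])
  · rw [hsum]
    exact (mul_le_mul_of_nonneg_right (min_le_left _ _) (by positivity)).trans (hv x r hr).1
  · rw [hsum]
    exact (hv x r hr).2.trans (mul_le_mul_of_nonneg_right (le_max_left _ _) (by positivity))

end Walk

section Crossing

/-- First passage of a sequence with bounded increments above a level. -/
lemma exists_first_passage {φ : ℕ → ℝ} {s m : ℕ} {J t : ℝ}
    (hstep : ∀ i, s ≤ i → i < m → φ (i + 1) ≤ φ i + J) (hs : s ≤ m) (h0 : φ s ≤ t + J)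
    (hm : t ≤ φ m) :
    ∃ τ, s ≤ τ ∧ τ ≤ m ∧ t ≤ φ τ ∧ (∀ i, s ≤ i → t ≤ φ i → τ ≤ i) ∧
      ∀ i, s ≤ i → i ≤ τ → φ i ≤ t + J := by
  have hne : ∃ i, s ≤ i ∧ t ≤ φ i := ⟨m, hs, hm⟩
  refine ⟨Nat.find hne, (Nat.find_spec hne).1, Nat.find_min' hne ⟨hs, hm⟩, (Nat.find_spec hne).2,
    fun i hi hi' => Nat.find_min' hne ⟨hi, hi'⟩, fun i hi hi' => ?_⟩
  rcases hi.eq_or_lt with rfl | hlt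
  · exact h0
  · obtain ⟨j, rfl⟩ : ∃ j, i = j + 1 := ⟨i - 1, by omega⟩
    have hj := Nat.find_min hne (m := j) (by omega)
    have h1 : φ j < t := by
      by_contra h'
      exact hj ⟨by omega, not_lt.1 h'⟩
    have hjm : j < m := lt_of_lt_of_le (by omega) (Nat.find_min' hne ⟨hs, hm⟩)
    linarith [hstep j (by omega) hjm]

variable {G : Type} {dd : G → G → ℝ}

/-- Decomposition of a long path with bounded jumps into disjoint crossings of shells of width
`W`. -/
lemma exists_shells (hself : ∀ x, dd x x = 0) (htri : ∀ x y z, dd x z ≤ dd x y + dd y z)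
    {W J : ℝ} (hW : 0 ≤ W) (hJ : 0 ≤ J) {γ : ℕ → G} {p q n : ℕ} (hpq : p ≤ q)
    (hstep : ∀ i, p ≤ i → i < q → dd (γ i) (γ (i + 1)) ≤ J)
    (hend : n * (W + J) ≤ dd (γ p) (γ q)) :
    ∃ σ τ : ℕ → ℕ, (∀ j < n, p ≤ σ j ∧ σ j ≤ τ j ∧ τ j ≤ q ∧ j * (W + J) ≤ dd (γ p) (γ (σ j)) ∧
      dd (γ p) (γ (σ j)) ≤ j * (W + J) + J ∧ W ≤ dd (γ (σ j)) (γ (τ j)) ∧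
      ∀ i, σ j ≤ i → i ≤ τ j → dd (γ (σ j)) (γ i) ≤ W + J) ∧
      ∀ j j', j < j' → j' < n → τ j ≤ σ j' := by
  have hWJ : 0 ≤ W + J := add_nonneg hW hJ
  have hσ : ∀ j : ℕ, ∃ σ, j < n → p ≤ σ ∧ σ ≤ q ∧ j * (W + J) ≤ dd (γ p) (γ σ) ∧
      (∀ i, p ≤ i → j * (W + J) ≤ dd (γ p) (γ i) → σ ≤ i) ∧
      dd (γ p) (γ σ) ≤ j * (W + J) + J := by
    intro j
    by_cases hj : j < n
    · have hjn : (j:ℝ) * (W + J) ≤ n * (W + J) :=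
        mul_le_mul_of_nonneg_right (by exact_mod_cast hj.le) hWJ
      obtain ⟨σ, h1, h2, h3, h4, h5⟩ := exists_first_passage (φ := fun i => dd (γ p) (γ i)) (s := p)
        (m := q) (t := j * (W + J)) (J := J) (fun i hi hi' => by
          linarith [htri (γ p) (γ i) (γ (i + 1)), hstep i hi hi']) hpq
        (by simp only [hself]; positivity) (hjn.trans hend)
      exact ⟨σ, fun _ => ⟨h1, h2, h3, h4, h5 σ h1 le_rfl⟩⟩
    · exact ⟨0, fun h' => (hj h').elim⟩
  choose σ hσ using hσ
  have hτ : ∀ j : ℕ, ∃ τ, j < n → σ j ≤ τ ∧ τ ≤ q ∧ W ≤ dd (γ (σ j)) (γ τ) ∧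
      (∀ i, σ j ≤ i → W ≤ dd (γ (σ j)) (γ i) → τ ≤ i) ∧
      ∀ i, σ j ≤ i → i ≤ τ → dd (γ (σ j)) (γ i) ≤ W + J := by
    intro j
    by_cases hj : j < n
    · obtain ⟨h1, h2, h3, h4, h5⟩ := hσ j hj
      have hjn : ((j:ℝ) + 1) * (W + J) ≤ n * (W + J) :=
        mul_le_mul_of_nonneg_right (by exact_mod_cast hj) hWJ
      obtain ⟨τ, k1, k2, k3, k4, k5⟩ := exists_first_passage (φ := fun i => dd (γ (σ j)) (γ i))
        (s := σ j) (m := q) (t := W) (J := J) (fun i hi hi' => by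
          linarith [htri (γ (σ j)) (γ i) (γ (i + 1)), hstep i (h1.trans hi) hi']) h2
        (by simp only [hself]; positivity)
        (by linarith [htri (γ p) (γ (σ j)) (γ q)])
      exact ⟨τ, fun _ => ⟨k1, k2, k3, k4, k5⟩⟩
    · exact ⟨0, fun h' => (hj h').elim⟩
  choose τ hτ using hτ
  refine ⟨σ, τ, fun j hj => ?_, fun j j' hjj' hj' => ?_⟩
  · obtain ⟨h1, h2, h3, h4, h5⟩ := hσ j hj
    obtain ⟨k1, k2, k3, k4, k5⟩ := hτ j hj
    exact ⟨h1, k1, k2, h3, h5, k3, k5⟩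
  · obtain ⟨h1, h2, h3, h4, h5⟩ := hσ j (hjj'.trans hj')
    obtain ⟨h1', h2', h3', h4', h5'⟩ := hσ j' hj'
    obtain ⟨k1, k2, k3, k4, k5⟩ := hτ j (hjj'.trans hj')
    have hle : ((j:ℝ) + 1) * (W + J) ≤ j' * (W + J) :=
      mul_le_mul_of_nonneg_right (by exact_mod_cast hjj') hWJ
    refine k4 _ (h4 _ h1' (by linarith)) ?_
    linarith [htri (γ p) (γ (σ j)) (γ (σ j'))]

/-- Counting over disjoint intervals. -/
lemma sum_card_shells_le {σ τ : ℕ → ℕ} {p q n : ℕ} (hb : ∀ j < n, p ≤ σ j ∧ τ j ≤ q)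
    (hd : ∀ j j', j < j' → j' < n → τ j ≤ σ j') (Q : ℕ → Prop)
    [DecidablePred Q] :
    ∑ j ∈ Finset.range n, ((Finset.Ico (σ j) (τ j)).filter Q).card ≤
      ((Finset.Ico p q).filter Q).card := by
  rw [← Finset.card_biUnion]
  · refine Finset.card_le_card fun i hi => ?_
    simp only [Finset.mem_biUnion, Finset.mem_range, Finset.mem_filter, Finset.mem_Ico] at hi ⊢
    obtain ⟨j, hj, ⟨h1, h2⟩, h3⟩ := hi
    obtain ⟨h4, h5⟩ := hb j hj
    exact ⟨⟨by omega, by omega⟩, h3⟩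
  · intro j hj j' hj' hne
    rw [Finset.mem_coe, Finset.mem_range] at hj hj'
    refine Finset.disjoint_left.2 fun i hi hi' => ?_
    simp only [Finset.mem_filter, Finset.mem_Ico] at hi hi'
    rcases lt_or_gt_of_ne hne with h | h
    · have := hd j j' h hj'; omega
    · have := hd j' j h hj; omega

/-- If the sum of `n` counts is less than `(n - b) * a`, two indices at distance at least `b` have
counts less than `a`. -/
lemma exists_far_pair {n a b : ℕ} (hbn : b ≤ n) {c : ℕ → ℕ}
    (hc : ∑ j ∈ Finset.range n, c j < (n - b) * a) :
    ∃ j j', j + b ≤ j' ∧ j' < n ∧ c j < a ∧ c j' < a := by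
  set T := (Finset.range n).filter (fun j => c j < a) with hT
  have h1 : ((Finset.range n).filter (fun j => ¬ c j < a)).card * a ≤ ∑ j ∈ Finset.range n, c j := by
    calc _ ≤ ∑ j ∈ (Finset.range n).filter (fun j => ¬ c j < a), c j := by
          rw [← smul_eq_mul]
          exact Finset.card_nsmul_le_sum _ _ _ fun j hj => not_lt.1 (Finset.mem_filter.1 hj).2
      _ ≤ _ := Finset.sum_le_sum_of_subset (Finset.filter_subset _ _)
  have h2 : T.card + ((Finset.range n).filter (fun j => ¬ c j < a)).card = n := by
    rw [hT, Finset.card_filter_add_card_filter_not, Finset.card_range]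
  have h3 : ((Finset.range n).filter (fun j => ¬ c j < a)).card < n - b :=
    lt_of_mul_lt_mul_right (h1.trans_lt hc) (Nat.zero_le a)
  have hTne : T.Nonempty := Finset.card_pos.1 (by omega)
  have hsub : T ⊆ Finset.Icc (T.min' hTne) (T.max' hTne) := fun j hj =>
    Finset.mem_Icc.2 ⟨T.min'_le j hj, T.le_max' j hj⟩
  have h4 := Finset.card_le_card hsub
  rw [Nat.card_Icc] at h4
  have h5 := Finset.mem_filter.1 (T.min'_mem hTne)
  have h6 := Finset.mem_filter.1 (T.max'_mem hTne)
  exact ⟨T.min' hTne, T.max' hTne, by omega, Finset.mem_range.1 h6.1, h5.2, h6.2⟩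

/-- The event that some path with jumps at most `J`, started near `x`, crosses a distance `W`
while visiting fewer than `a` good sites. -/
def crossEv (dd : G → G → ℝ) (J : ℝ) (Bad : (G → ℝ) → G → Prop) (W : ℝ) (a : ℕ) (x : G) :
    Set (G → ℝ) :=
  {f | ∃ (γ : ℕ → G) (p q : ℕ), p ≤ q ∧ (∀ i, p ≤ i → i < q → dd (γ i) (γ (i + 1)) ≤ J) ∧
    dd x (γ p) ≤ W ∧ (∀ i, p ≤ i → i ≤ q → dd (γ p) (γ i) ≤ W + J) ∧ W ≤ dd (γ p) (γ q) ∧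
    ((Finset.Ico p q).filter (fun i => ¬ Bad f (γ i))).card < a}

variable {J W : ℝ} {Bad : (G → ℝ) → G → Prop} {a : ℕ} {x : G}

lemma isLowerSet_crossEv (hBad : ∀ f f' z, f ≤ f' → Bad f' z → Bad f z) :
    IsLowerSet (crossEv dd J Bad W a x) := by
  rintro f f' hf ⟨γ, p, q, h1, h2, h3, h4, h5, h6⟩
  refine ⟨γ, p, q, h1, h2, h3, h4, h5, lt_of_le_of_lt (Finset.card_le_card ?_) h6⟩
  exact Finset.monotone_filter_right _ fun i _ h hb => h (hBad _ _ _ hf hb)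

lemma isUpperSet_crossEv (hBad : ∀ f f' z, f ≤ f' → Bad f z → Bad f' z) :
    IsUpperSet (crossEv dd J Bad W a x) := by
  rintro f f' hf ⟨γ, p, q, h1, h2, h3, h4, h5, h6⟩
  refine ⟨γ, p, q, h1, h2, h3, h4, h5, lt_of_le_of_lt (Finset.card_le_card ?_) h6⟩
  exact Finset.monotone_filter_right _ fun i _ h hb => h (hBad _ _ _ hf hb)

lemma crossEv_local (htri : ∀ x y z, dd x z ≤ dd x y + dd y z) {R : ℝ}
    (hBad : ∀ f f' z, (∀ y, dd z y ≤ 3 * R → f y = f' y) → Bad f z → Bad f' z) {r : ℝ}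
    (hr : 2 * W + J + 3 * R ≤ r) {f f' : G → ℝ} (hf : ∀ y, dd x y ≤ r → f y = f' y)
    (h : f ∈ crossEv dd J Bad W a x) : f' ∈ crossEv dd J Bad W a x := by
  obtain ⟨γ, p, q, h1, h2, h3, h4, h5, h6⟩ := h
  refine ⟨γ, p, q, h1, h2, h3, h4, h5, lt_of_le_of_lt (Finset.card_le_card ?_) h6⟩
  intro i hi
  rw [Finset.mem_filter, Finset.mem_Ico] at hi ⊢
  refine ⟨hi.1, fun hb => hi.2 (hBad _ _ _ (fun y hy => hf y ?_) hb)⟩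
  linarith [htri x (γ p) y, htri (γ p) (γ i) y, h4 i hi.1.1 hi.1.2.le]

/-- A crossing at the larger scale with few good sites contains two distant crossings at the smaller
scale with few good sites. -/
lemma crossEv_succ (hself : ∀ x, dd x x = 0) (hsymm : ∀ x y, dd x y = dd y x)
    (htri : ∀ x y z, dd x z ≤ dd x y + dd y z) (hW : 0 ≤ W) (hJ : 0 ≤ J) {Λ : Set G}
    (hΛ : ∀ x, ∃ y ∈ Λ, dd y x ≤ W) {b N : ℕ} (hb : 1 ≤ b) (hbN : b ≤ N) {f : G → ℝ}
    (h : f ∈ crossEv dd J Bad (N * (W + J)) ((N - b) * a) x) :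
    ∃ x₁ ∈ Λ, ∃ x₂ ∈ Λ, dd x x₁ ≤ 4 * (N * (W + J)) ∧ dd x x₂ ≤ 4 * (N * (W + J)) ∧
      (b - 2) * W ≤ dd x₁ x₂ ∧ f ∈ crossEv dd J Bad W a x₁ ∩ crossEv dd J Bad W a x₂ := by
  obtain ⟨γ, p, q, h1, h2, h3, h4, h5, h6⟩ := h
  obtain ⟨σ, τ, hs, hd⟩ := exists_shells hself htri hW hJ h1 h2 h5
  have hsum : ∑ j ∈ Finset.range N,
      ((Finset.Ico (σ j) (τ j)).filter (fun i => ¬ Bad f (γ i))).card < (N - b) * a :=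
    lt_of_le_of_lt (sum_card_shells_le (fun j hj => ⟨(hs j hj).1, (hs j hj).2.2.1⟩) hd _) h6
  obtain ⟨j, j', hjj, hj', hcj, hcj'⟩ := exists_far_pair hbN hsum
  have hN : (1:ℝ) ≤ N := by exact_mod_cast hb.trans hbN
  have hWJ : W + J ≤ N * (W + J) := le_mul_of_one_le_left (by linarith) hN
  have hev : ∀ j < N, ((Finset.Ico (σ j) (τ j)).filter (fun i => ¬ Bad f (γ i))).card < a →
      ∃ y ∈ Λ, dd x y ≤ 4 * (N * (W + J)) ∧ dd y (γ (σ j)) ≤ W ∧ f ∈ crossEv dd J Bad W a y := by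
    intro j hj hc
    obtain ⟨k1, k2, k3, k4, k5, k6, k7⟩ := hs j hj
    obtain ⟨y, hy, hyd⟩ := hΛ (γ (σ j))
    refine ⟨y, hy, ?_, hyd, γ, σ j, τ j, k2, fun i hi hi' => h2 i (k1.trans hi) (hi'.trans_le k3),
      hyd, k7, k6, hc⟩
    have := h4 (σ j) k1 (k2.trans k3)
    linarith [htri x (γ p) y, htri (γ p) (γ (σ j)) y, hsymm y (γ (σ j))]
  obtain ⟨x₁, hx₁, e1, e2, e3⟩ := hev j (by omega) hcj
  obtain ⟨x₂, hx₂, e1', e2', e3'⟩ := hev j' hj' hcj'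
  refine ⟨x₁, hx₁, x₂, hx₂, e1, e1', ?_, e3, e3'⟩
  have k := (hs j (by omega)).2.2.2.2.1
  have k' := (hs j' hj').2.2.2.1
  have hjb : ((j:ℝ) + b) * (W + J) ≤ j' * (W + J) :=
    mul_le_mul_of_nonneg_right (by exact_mod_cast hjj) (by linarith)
  have hbJ : J ≤ b * J := le_mul_of_one_le_left hJ (by exact_mod_cast hb)
  linarith [htri (γ p) (γ (σ j)) (γ (σ j')), htri (γ (σ j)) x₁ (γ (σ j')), htri x₁ x₂ (γ (σ j')),
    hsymm x₁ (γ (σ j))]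

end Crossing

section Scales

/-- Number of shells used at scale `k`. -/
def scaleN (b B : ℕ) (k : ℕ) : ℕ := b * B ^ k * 2 ^ (k + 3)

/-- Geometric scales. -/
def scaleW (b B : ℕ) (J W₀ : ℝ) : ℕ → ℝ
  | 0 => W₀
  | k + 1 => scaleN b B k * (scaleW b B J W₀ k + J)

/-- Number of good sites on a crossing at scale `k`. -/
def scaleA (b B : ℕ) : ℕ → ℕ
  | 0 => 1
  | k + 1 => (scaleN b B k - b * B ^ k) * scaleA b B k

variable {b B : ℕ} {J W₀ : ℝ}

lemma le_scaleN (hB : 1 ≤ B) (k : ℕ) : b ≤ scaleN b B k :=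
  (Nat.le_mul_of_pos_right b (pow_pos hB k)).trans
    (Nat.le_mul_of_pos_right _ (by positivity))

lemma mul_pow_le_scaleN (k : ℕ) : b * B ^ k ≤ scaleN b B k :=
  Nat.le_mul_of_pos_right _ (by positivity)

lemma mul_scaleW_le (hB : 1 ≤ B) (hJ : 0 ≤ J) (k : ℕ) (hk : 0 ≤ scaleW b B J W₀ k) :
    b * scaleW b B J W₀ k ≤ scaleW b B J W₀ (k + 1) := by
  have h1 : (b:ℝ) ≤ scaleN b B k := by exact_mod_cast le_scaleN hB k
  change _ ≤ (scaleN b B k : ℝ) * (scaleW b B J W₀ k + J)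
  exact mul_le_mul h1 (by linarith) hk (Nat.cast_nonneg _)

lemma pow_mul_le_scaleW (hB : 1 ≤ B) (hJ : 0 ≤ J) (hW₀ : 0 ≤ W₀) (k : ℕ) :
    (b:ℝ) ^ k * W₀ ≤ scaleW b B J W₀ k := by
  induction k with
  | zero => simp [scaleW]
  | succ k ih =>
    have h0 : 0 ≤ (b:ℝ) ^ k * W₀ := by positivity
    calc (b:ℝ) ^ (k + 1) * W₀ = b * ((b:ℝ) ^ k * W₀) := by ring
      _ ≤ b * scaleW b B J W₀ k := by gcongr
      _ ≤ _ := mul_scaleW_le hB hJ k (h0.trans ih)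

lemma le_scaleW (hb : 1 ≤ b) (hB : 1 ≤ B) (hJ : 0 ≤ J) (hW₀ : 0 ≤ W₀) (k : ℕ) :
    W₀ ≤ scaleW b B J W₀ k := by
  refine le_trans ?_ (pow_mul_le_scaleW hB hJ hW₀ k)
  exact le_mul_of_one_le_left hW₀ (one_le_pow₀ (by exact_mod_cast hb))

lemma scaleW_succ_le (hb : 1 ≤ b) (hB : 1 ≤ B) (hJ : 0 ≤ J) (hW₀ : 0 ≤ W₀) (hJW : J ≤ W₀)
    (k : ℕ) :
    scaleW b B J W₀ (k + 1) ≤ 16 * b * (2 * B) ^ k * scaleW b B J W₀ k := by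
  have h1 := le_scaleW hb hB hJ hW₀ k
  have h2 : (scaleN b B k : ℝ) = b * B ^ k * 2 ^ (k + 3) := by simp [scaleN]
  calc scaleW b B J W₀ (k + 1) = scaleN b B k * (scaleW b B J W₀ k + J) := rfl
    _ ≤ scaleN b B k * (scaleW b B J W₀ k + scaleW b B J W₀ k) := by gcongr; linarith
    _ = _ := by rw [h2, mul_pow, pow_add]; ring

lemma scaleW_le_scaleA (hb : 2 ≤ b) (hB : 1 ≤ B) (hJ : 0 ≤ J) (hW₀ : 0 ≤ W₀) (hJW : 8 * J ≤ W₀)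
    (k : ℕ) :
    scaleW b B J W₀ k * (1 + (1 / 2) ^ k) / 2 ≤ scaleA b B k * W₀ := by
  induction k with
  | zero => simp only [scaleW, scaleA, pow_zero, Nat.cast_one]; linarith
  | succ k ih =>
    set x : ℝ := (1 / 2) ^ (k + 3) with hx
    have hx0 : 0 < x := by positivity
    have hx1 : x ≤ 1 / 8 := by
      calc x ≤ (1 / 2) ^ 3 := pow_le_pow_of_le_one (by norm_num) (by norm_num) (by omega)
        _ = 1 / 8 := by norm_num
    have e1 : (1 / 2 : ℝ) ^ k = 8 * x := by rw [hx, pow_add]; ring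
    have e2 : (1 / 2 : ℝ) ^ (k + 1) = 4 * x := by rw [hx, pow_add, pow_add]; ring
    have hN : (scaleN b B k : ℝ) * x = b * B ^ k := by
      have : (2:ℝ) ^ (k + 3) * x = 1 := by rw [hx, ← mul_pow]; norm_num
      simp only [scaleN, Nat.cast_mul, Nat.cast_pow, Nat.cast_ofNat]
      rw [mul_assoc _ _ x, this, mul_one]
    have hW := pow_mul_le_scaleW (b := b) hB hJ hW₀ k
    have hWn : 0 ≤ scaleW b B J W₀ k := le_trans (by positivity) hW
    have hJx : J ≤ x * scaleW b B J W₀ k := by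
      have h2 : (2:ℝ) ^ k * W₀ ≤ scaleW b B J W₀ k :=
        le_trans (by gcongr; exact_mod_cast hb) hW
      have h3 : x * (2 ^ k * W₀) = W₀ / 8 := by
        have h5 : (1 / 2 : ℝ) ^ k * 2 ^ k = 1 := by rw [← mul_pow]; norm_num
        calc x * (2 ^ k * W₀) = ((1 / 2 : ℝ) ^ k * 2 ^ k) * W₀ / 8 := by rw [hx, pow_add]; ring
          _ = W₀ / 8 := by rw [h5, one_mul]
      have h4 := mul_le_mul_of_nonneg_left h2 hx0.le
      linarith
    have hA : (scaleA b B (k + 1) : ℝ) = scaleN b B k * (1 - x) * scaleA b B k := by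
      simp only [scaleA, Nat.cast_mul]
      rw [Nat.cast_sub (mul_pow_le_scaleN k)]
      push_cast
      rw [← hN]; ring
    rw [e1] at ih
    rw [e2, hA]
    change (scaleN b B k : ℝ) * (scaleW b B J W₀ k + J) * (1 + 4 * x) / 2 ≤ _
    have hNn : (0:ℝ) ≤ scaleN b B k := Nat.cast_nonneg _
    calc (scaleN b B k : ℝ) * (scaleW b B J W₀ k + J) * (1 + 4 * x) / 2
        ≤ (scaleN b B k : ℝ) * (scaleW b B J W₀ k + x * scaleW b B J W₀ k) * (1 + 4 * x) / 2 := by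
          gcongr
      _ = (scaleN b B k : ℝ) * scaleW b B J W₀ k * ((1 + x) * (1 + 4 * x)) / 2 := by ring
      _ ≤ (scaleN b B k : ℝ) * scaleW b B J W₀ k * ((1 - x) * (1 + 8 * x)) / 2 := by
          gcongr ?_ * ?_ / _
          nlinarith
      _ = (scaleN b B k : ℝ) * (1 - x) * (scaleW b B J W₀ k * (1 + 8 * x) / 2) := by ring
      _ ≤ (scaleN b B k : ℝ) * (1 - x) * (scaleA b B k * W₀) := by
          have : 0 ≤ 1 - x := by linarith
          gcongr
      _ = _ := by ring

/-- Factor between the initial level and the level at scale `k`. -/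
def levelFac (ε : ℝ) (k : ℕ) : ℝ := 1 + ε * (1 - (1 / 2) ^ k)

/-- Sprinkling parameter between the levels at scales `k` and `k + 1`. -/
def levelGap (ε : ℝ) (k : ℕ) : ℝ := ε * (1 / 2) ^ k / 16

variable {ε : ℝ}

lemma half_pow_mem (k : ℕ) : 0 < (1 / 2 : ℝ) ^ k ∧ (1 / 2 : ℝ) ^ k ≤ 1 :=
  ⟨by positivity, pow_le_one₀ (by norm_num) (by norm_num)⟩

lemma one_le_levelFac (hε : 0 ≤ ε) (k : ℕ) : 1 ≤ levelFac ε k := by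
  have := mul_nonneg hε (sub_nonneg.2 (half_pow_mem k).2)
  unfold levelFac; linarith

lemma levelFac_le (hε : 0 ≤ ε) (k : ℕ) : levelFac ε k ≤ 1 + ε := by
  have := mul_nonneg hε (half_pow_mem k).1.le
  unfold levelFac; linarith

lemma levelFac_succ (hε : 0 ≤ ε) (hε2 : ε ≤ 1 / 2) (k : ℕ) :
    (1 + 4 * levelGap ε k) * levelFac ε k ≤ levelFac ε (k + 1) := by
  have h1 := levelFac_le hε k
  have h2 := mul_nonneg hε (half_pow_mem k).1.le
  have h3 : levelFac ε (k + 1) = levelFac ε k + ε * (1 / 2) ^ k / 2 := by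
    unfold levelFac; rw [pow_succ]; ring
  rw [h3]
  unfold levelGap
  nlinarith

/-- The level at scale `k`. -/
def level (inc : Bool) (ε u : ℝ) (k : ℕ) : ℝ :=
  if inc then u * levelFac ε k else u / levelFac ε k

variable {u : ℝ} {inc : Bool}

lemma level_zero : level inc ε u 0 = u := by
  cases inc <;> simp [level, levelFac]

lemma half_le_level (hε : 0 ≤ ε) (hε2 : ε ≤ 1 / 2) (hu : 0 ≤ u) (k : ℕ) :
    u / 2 ≤ level inc ε u k := by
  have h1 := levelFac_le hε k
  have h2 := one_le_levelFac hε k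
  cases inc
  · simp only [level, Bool.false_eq_true, if_false]
    gcongr; linarith
  · simp only [level, if_true]
    nlinarith

lemma level_inc_succ (hε : 0 ≤ ε) (hε2 : ε ≤ 1 / 2) (hu : 0 ≤ u) (k : ℕ) :
    (1 + 4 * levelGap ε k) * level true ε u k ≤ level true ε u (k + 1) := by
  simp only [level, if_true]
  calc _ = u * ((1 + 4 * levelGap ε k) * levelFac ε k) := by ring
    _ ≤ _ := by gcongr; exact levelFac_succ hε hε2 k

lemma level_dec_succ (hε : 0 ≤ ε) (hε2 : ε ≤ 1 / 2) (hu : 0 ≤ u) (k : ℕ) :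
    (1 + 4 * levelGap ε k) * level false ε u (k + 1) ≤ level false ε u k := by
  have h1 := one_le_levelFac hε k
  have h2 := one_le_levelFac hε (k + 1)
  simp only [level, Bool.false_eq_true, if_false]
  rw [mul_div_assoc', div_le_div_iff₀ (by linarith) (by linarith)]
  calc _ = u * ((1 + 4 * levelGap ε k) * levelFac ε k) := by ring
    _ ≤ _ := by gcongr; exact levelFac_succ hε hε2 k

lemma level_inc_le {v : ℝ} (hε : 0 ≤ ε) (hu : 0 ≤ u) (huv : u < v)
    (h : ε * v ≤ |u - v|) (k : ℕ) : level true ε u k ≤ v := by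
  rw [abs_of_neg (by linarith)] at h
  have h1 := levelFac_le hε k
  simp only [level, if_true]
  nlinarith

lemma le_level_dec {v : ℝ} (hε : 0 ≤ ε) (hv : 0 ≤ v) (huv : v < u)
    (h : ε * v ≤ |u - v|) (k : ℕ) : v ≤ level false ε u k := by
  rw [abs_of_pos (by linarith)] at h
  have h1 := levelFac_le hε k
  have h2 := one_le_levelFac hε k
  simp only [level, Bool.false_eq_true, if_false]
  rw [le_div_iff₀ (by linarith)]
  nlinarith

/-- Decay of the decoupling error along the scales. -/
lemma scale_error_le {ν δ c : ℝ} (hν : 0 < ν) (hb : 1 ≤ b) (hB : 1 ≤ B) (hbν : 8 ≤ (b:ℝ) ^ ν)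
    (hJ : 0 ≤ J) (hW₀ : 0 < W₀) (hδ : 0 < δ) (hδ1 : δ ≤ 1) (hu : 0 ≤ u) (hc : 0 ≤ c)
    (hW : 1024 * Real.log (1 / δ) ≤ c * ε ^ 2 * (u * W₀ ^ ν)) (k : ℕ) :
    9 * Real.exp (-(c * (u / 2 * (3 * scaleW b B J W₀ k) ^ ν * levelGap ε k ^ 2))) ≤
      9 * (δ ^ 2) ^ (k + 1) := by
  have hlog : 0 ≤ Real.log (1 / δ) := Real.log_nonneg (by rw [le_div_iff₀ hδ]; linarith)
  have h1 := pow_mul_le_scaleW (b := b) hB hJ hW₀.le k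
  have h2 : (8:ℝ) ^ k * W₀ ^ ν ≤ (3 * scaleW b B J W₀ k) ^ ν := by
    calc (8:ℝ) ^ k * W₀ ^ ν ≤ ((b:ℝ) ^ ν) ^ k * W₀ ^ ν := by gcongr
      _ = ((b:ℝ) ^ k * W₀) ^ ν := by
        rw [Real.mul_rpow (by positivity) hW₀.le, ← Real.rpow_natCast, ← Real.rpow_mul (by positivity),
          mul_comm, ← Real.rpow_natCast, ← Real.rpow_mul (by positivity), mul_comm (k:ℝ) ν, mul_comm]
      _ ≤ _ := by
        have : (0:ℝ) ≤ (b:ℝ) ^ k * W₀ := by positivity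
        exact Real.rpow_le_rpow this (by linarith) hν.le
  have h3 : (k:ℝ) + 1 ≤ 2 ^ k := by exact_mod_cast Nat.lt_two_pow_self (n := k)
  have h4 : (2 * ((k:ℝ) + 1)) * Real.log (1 / δ) ≤
      c * (u / 2 * (3 * scaleW b B J W₀ k) ^ ν * levelGap ε k ^ 2) := by
    have e : (8:ℝ) ^ k * ((1 / 2) ^ k) ^ 2 = 2 ^ k := by
      rw [← pow_mul, mul_comm k 2, pow_mul, ← mul_pow]; norm_num
    calc (2 * ((k:ℝ) + 1)) * Real.log (1 / δ) ≤ (2 * 2 ^ k) * Real.log (1 / δ) := by gcongr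
      _ = 2 ^ k / 512 * (1024 * Real.log (1 / δ)) := by ring
      _ ≤ 2 ^ k / 512 * (c * ε ^ 2 * (u * W₀ ^ ν)) := by gcongr
      _ = c * (u / 2 * (8 ^ k * W₀ ^ ν) * levelGap ε k ^ 2) := by
        rw [← e]; unfold levelGap; ring
      _ ≤ _ := by gcongr
  have h5 : (δ ^ 2) ^ (k + 1) = Real.exp (-((2 * ((k:ℝ) + 1)) * Real.log (1 / δ))) := by
    rw [one_div, Real.log_inv, mul_neg, neg_neg, mul_comm, ← Real.rpow_def_of_pos hδ, ← pow_mul,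
      ← Real.rpow_natCast]
    push_cast
    rfl
  rw [h5]
  gcongr

/-- The recursive inequality satisfied by the crossing probabilities. -/
lemma scale_recursion {P Z Q δ : ℝ} (hP : 1 ≤ P) (hZ : 1 ≤ Z) (hδ : 0 < δ) (hδQ : δ ≤ Q)
    (hPQ : 2 * (P * Q * Z) ≤ 1) (hPδ : 18 * (P * Z * δ) ≤ 1) (k : ℕ) :
    P * Z ^ k * ((Q / Z ^ k) ^ 2 + 9 * (δ ^ 2) ^ (k + 1)) ≤ Q / Z ^ (k + 1) := by
  have hZ0 : 0 < Z := by linarith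
  have hZk : 0 < Z ^ k := by positivity
  have hQ : 0 < Q := hδ.trans_le hδQ
  have h1 : P * Z ^ k * (Q / Z ^ k) ^ 2 ≤ Q / Z ^ (k + 1) / 2 := by
    have : P * Z ^ k * (Q / Z ^ k) ^ 2 = Q / Z ^ (k + 1) / 2 * (2 * (P * Q * Z)) := by
      rw [pow_succ]; field_simp; ring
    rw [this]
    exact mul_le_of_le_one_right (by positivity) hPQ
  have hZδ : Z * δ ≤ 1 := by
    have : 0 < Z * δ := by positivity
    nlinarith
  have h2 : P * Z ^ k * (9 * (δ ^ 2) ^ (k + 1)) ≤ Q / Z ^ (k + 1) / 2 := by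
    rw [div_div, le_div_iff₀ (by positivity)]
    calc P * Z ^ k * (9 * (δ ^ 2) ^ (k + 1)) * (Z ^ (k + 1) * 2)
        = (18 * (P * Z * δ)) * ((Z * δ) ^ k * (Z * δ) ^ k) * δ := by
          rw [mul_pow]; ring
      _ ≤ 1 * (1 * 1) * Q := by
          have := pow_le_one₀ (n := k) (by positivity) hZδ
          gcongr
      _ = Q := by ring
  rw [mul_add]; linarith

end Scales

section Recursion

/-- Decoupling of monotone local events at distant places after sprinkling. -/
def HasDecoupling {G Ω : Type} [MeasurableSpace Ω] (μ : Measure Ω) (dd : G → G → ℝ)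
    (ℓ : G → ℝ → Ω → ℝ) (J ν a b : ℝ) : Prop :=
  ∀ (x₁ x₂ : G) (r D e u u' : ℝ), 1 ≤ r → J ≤ r → 10 * r ≤ D → D ≤ dd x₁ x₂ → 0 < e → e ≤ 1 / 4 →
    a * (r / D) ^ ν ≤ e → 0 < u' → (1 + 4 * e) * u' ≤ u → ∀ S₁ S₂ : Set (G → ℝ),
    (∀ f f', (∀ x, dd x₁ x ≤ r → f x = f' x) → f ∈ S₁ → f' ∈ S₁) →
    (∀ f f', (∀ x, dd x₂ x ≤ r → f x = f' x) → f ∈ S₂ → f' ∈ S₂) →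
    (IsUpperSet S₁ → IsUpperSet S₂ →
      μ {ω | (fun x => ℓ x u' ω) ∈ S₁ ∩ S₂} ≤
        μ {ω | (fun x => ℓ x u ω) ∈ S₁} * μ {ω | (fun x => ℓ x u ω) ∈ S₂} +
          ENNReal.ofReal (9 * Real.exp (-(b * (u' * r ^ ν * e ^ 2))))) ∧
    (IsLowerSet S₁ → IsLowerSet S₂ →
      μ {ω | (fun x => ℓ x u ω) ∈ S₁ ∩ S₂} ≤
        μ {ω | (fun x => ℓ x u' ω) ∈ S₁} * μ {ω | (fun x => ℓ x u' ω) ∈ S₂} +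
          ENNReal.ofReal (9 * Real.exp (-(b * (u' * r ^ ν * e ^ 2)))))

variable {G Ω : Type} [MeasurableSpace Ω] {μ : Measure Ω} {dd : G → G → ℝ} {ℓ : G → ℝ → Ω → ℝ}

/-- Union bound over pairs in a finite set. -/
lemma measure_pairs_le {Λ : Set G} (hΛ : Λ.Finite) {K : ℝ} (hK : (Λ.ncard : ℝ) ≤ K)
    {E : Set Ω} {F : G → G → Set Ω} {p : ℝ}
    (hE : E ⊆ {ω | ∃ x₁ ∈ Λ, ∃ x₂ ∈ Λ, ω ∈ F x₁ x₂})
    (hF : ∀ x₁ ∈ Λ, ∀ x₂ ∈ Λ, μ (F x₁ x₂) ≤ ENNReal.ofReal p) :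
    μ E ≤ ENNReal.ofReal (K ^ 2 * p) := by
  have hK0 : 0 ≤ K := (Nat.cast_nonneg _).trans hK
  rw [Set.ncard_eq_toFinset_card _ hΛ] at hK
  calc μ E ≤ μ (⋃ x₁ ∈ hΛ.toFinset, ⋃ x₂ ∈ hΛ.toFinset, F x₁ x₂) := by
        refine measure_mono fun ω hω => ?_
        obtain ⟨x₁, h1, x₂, h2, h3⟩ := hE hω
        simp only [Set.mem_iUnion, Set.Finite.mem_toFinset]
        exact ⟨x₁, h1, x₂, h2, h3⟩
    _ ≤ ∑ x₁ ∈ hΛ.toFinset, ∑ x₂ ∈ hΛ.toFinset, μ (F x₁ x₂) :=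
        (measure_biUnion_finset_le _ _).trans
          (Finset.sum_le_sum fun _ _ => measure_biUnion_finset_le _ _)
    _ ≤ ∑ x₁ ∈ hΛ.toFinset, ∑ x₂ ∈ hΛ.toFinset, ENNReal.ofReal p :=
        Finset.sum_le_sum fun x₁ h1 => Finset.sum_le_sum fun x₂ h2 =>
          hF x₁ (hΛ.mem_toFinset.1 h1) x₂ (hΛ.mem_toFinset.1 h2)
    _ = ENNReal.ofReal ((hΛ.toFinset.card : ℝ)) * ENNReal.ofReal ((hΛ.toFinset.card : ℝ)) *
          ENNReal.ofReal p := by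
        simp only [Finset.sum_const, nsmul_eq_mul, ENNReal.ofReal_natCast, mul_assoc]
    _ ≤ ENNReal.ofReal K * ENNReal.ofReal K * ENNReal.ofReal p := by gcongr
    _ = ENNReal.ofReal (K ^ 2 * p) := by
        rw [ENNReal.ofReal_mul (by positivity), pow_two, ENNReal.ofReal_mul hK0]

/-- Union bound over a finite set. -/
lemma measure_exists_le {Λ : Set G} (hΛ : Λ.Finite) {K : ℝ} (hK : (Λ.ncard : ℝ) ≤ K)
    {E : Set Ω} {F : G → Set Ω} {p : ℝ} (hE : E ⊆ {ω | ∃ x ∈ Λ, ω ∈ F x})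
    (hF : ∀ x ∈ Λ, μ (F x) ≤ ENNReal.ofReal p) :
    μ E ≤ ENNReal.ofReal (K * p) := by
  have hK0 : 0 ≤ K := (Nat.cast_nonneg _).trans hK
  rw [Set.ncard_eq_toFinset_card _ hΛ] at hK
  calc μ E ≤ μ (⋃ x ∈ hΛ.toFinset, F x) := by
        refine measure_mono fun ω hω => ?_
        obtain ⟨x, h1, h3⟩ := hE hω
        simp only [Set.mem_iUnion, Set.Finite.mem_toFinset]
        exact ⟨x, h1, h3⟩
    _ ≤ ∑ x ∈ hΛ.toFinset, μ (F x) := measure_biUnion_finset_le _ _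
    _ ≤ ∑ x ∈ hΛ.toFinset, ENNReal.ofReal p :=
        Finset.sum_le_sum fun x h1 => hF x (hΛ.mem_toFinset.1 h1)
    _ = ENNReal.ofReal ((hΛ.toFinset.card : ℝ)) * ENNReal.ofReal p := by
        simp only [Finset.sum_const, nsmul_eq_mul, ENNReal.ofReal_natCast]
    _ ≤ ENNReal.ofReal K * ENNReal.ofReal p := by gcongr
    _ = ENNReal.ofReal (K * p) := by rw [ENNReal.ofReal_mul hK0]

variable {J₀ J R ν A c W K e p η : ℝ} {Bad : (G → ℝ) → G → Prop} {a b N : ℕ} {Λ : Set G}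

/-- One step of the renormalisation. -/
lemma measure_crossEv_succ_le (h : HasDecoupling μ dd ℓ J₀ ν A c) (hself : ∀ x, dd x x = 0)
    (hsymm : ∀ x y, dd x y = dd y x) (htri : ∀ x y z, dd x z ≤ dd x y + dd y z)
    (hlocal : ∀ f f' z, (∀ y, dd z y ≤ 3 * R → f y = f' y) → Bad f z → Bad f' z)
    (hJ : 0 ≤ J) (hJW : J + 3 * R ≤ W) (hW : 1 ≤ W) (hJ₀ : J₀ ≤ W)
    (hΛ : ∀ x, ∃ y ∈ Λ, dd y x ≤ W) (hb : 32 ≤ b) (hbN : b ≤ N)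
    (hK : ∀ x, (Λ ∩ vball dd x (4 * (N * (W + J)))).Finite ∧
      ((Λ ∩ vball dd x (4 * (N * (W + J)))).ncard : ℝ) ≤ K)
    (he : 0 < e) (he4 : e ≤ 1 / 4) (hAe : A * (3 * W / ((b - 2) * W)) ^ ν ≤ e)
    {inc : Bool} {w w' w₀ : ℝ} (hw₀ : 0 < w₀) (hw : w₀ ≤ w) (hw' : w₀ ≤ w')
    (hlevel : if inc then (∀ f f' z, f ≤ f' → Bad f' z → Bad f z) ∧ (1 + 4 * e) * w ≤ w'
      else (∀ f f' z, f ≤ f' → Bad f z → Bad f' z) ∧ (1 + 4 * e) * w' ≤ w)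
    (hc : 0 ≤ c) (hη : 9 * Real.exp (-(c * (w₀ * (3 * W) ^ ν * e ^ 2))) ≤ η) (hp : 0 ≤ p)
    (hmain : ∀ x, μ {ω | (fun y => ℓ y w ω) ∈ crossEv dd J Bad W a x} ≤ ENNReal.ofReal p) (x : G) :
    μ {ω | (fun y => ℓ y w' ω) ∈ crossEv dd J Bad (N * (W + J)) ((N - b) * a) x} ≤
      ENNReal.ofReal (K ^ 2 * (p ^ 2 + η)) := by
  have hbr : (32:ℝ) ≤ b := by exact_mod_cast hb
  have hη0 : 0 ≤ η := le_trans (by positivity) hη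
  refine measure_pairs_le (hK x).1 (hK x).2
    (F := fun x₁ x₂ => {ω | (b - 2) * W ≤ dd x₁ x₂ ∧
      (fun y => ℓ y w' ω) ∈ crossEv dd J Bad W a x₁ ∩ crossEv dd J Bad W a x₂}) ?_ ?_
  · intro ω hω
    obtain ⟨x₁, h1, x₂, h2, h3, h4, h5, h6⟩ := crossEv_succ hself hsymm htri (by linarith) hJ hΛ
      (by omega) hbN hω
    exact ⟨x₁, ⟨h1, h3⟩, x₂, ⟨h2, h4⟩, h5, h6⟩
  · intro x₁ _ x₂ _
    by_cases hd : ((b:ℝ) - 2) * W ≤ dd x₁ x₂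
    swap
    · simp [hd]
    have hloc : ∀ z, ∀ f f' : G → ℝ, (∀ y, dd z y ≤ 3 * W → f y = f' y) →
        f ∈ crossEv dd J Bad W a z → f' ∈ crossEv dd J Bad W a z := fun z f f' hf hh =>
      crossEv_local htri hlocal (by linarith) hf hh
    have hsub : {ω | ((b:ℝ) - 2) * W ≤ dd x₁ x₂ ∧
        (fun y => ℓ y w' ω) ∈ crossEv dd J Bad W a x₁ ∩ crossEv dd J Bad W a x₂} =
        {ω | (fun y => ℓ y w' ω) ∈ crossEv dd J Bad W a x₁ ∩ crossEv dd J Bad W a x₂} := by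
      ext ω; simp [hd]
    have hfin : ∀ w₁, w₀ ≤ w₁ →
        ENNReal.ofReal p * ENNReal.ofReal p +
          ENNReal.ofReal (9 * Real.exp (-(c * (w₁ * (3 * W) ^ ν * e ^ 2)))) ≤
        ENNReal.ofReal (p ^ 2 + η) := by
      intro w₁ hw₁
      rw [← ENNReal.ofReal_mul hp, ← ENNReal.ofReal_add (by positivity) (by positivity)]
      refine ENNReal.ofReal_le_ofReal ?_
      rw [← pow_two]
      refine add_le_add le_rfl (le_trans ?_ hη)
      gcongr
    rw [hsub]
    have key : ∀ (u u' : ℝ), 0 < u' → (1 + 4 * e) * u' ≤ u → _ := fun u u' hu' huu' =>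
      h x₁ x₂ (3 * W) ((b - 2) * W) e u u' (by linarith) (by linarith) (by nlinarith) hd he he4 hAe
        hu' huu' _ _ (hloc x₁) (hloc x₂)
    cases inc
    · simp only [Bool.false_eq_true, if_false] at hlevel
      refine ((key w w' (hw₀.trans_le hw') hlevel.2).1 (isUpperSet_crossEv hlevel.1)
        (isUpperSet_crossEv hlevel.1)).trans (le_trans ?_ (hfin w' hw'))
      gcongr
      · exact hmain x₁
      · exact hmain x₂
    · simp only [if_true] at hlevel
      refine ((key w' w (hw₀.trans_le hw) hlevel.2).2 (isLowerSet_crossEv hlevel.1)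
        (isLowerSet_crossEv hlevel.1)).trans (le_trans ?_ (hfin w hw))
      gcongr
      · exact hmain x₁
      · exact hmain x₂

end Recursion

section Scaling

lemma levelGap_le {ε : ℝ} (hε2 : ε ≤ 1 / 2) (k : ℕ) : levelGap ε k ≤ 1 / 4 := by
  have := mul_le_mul hε2 (half_pow_mem k).2 (half_pow_mem k).1.le (by norm_num)
  unfold levelGap; linarith

lemma levelGap_pos {ε : ℝ} (hε : 0 < ε) (k : ℕ) : 0 < levelGap ε k := by
  unfold levelGap; positivity

/-- Smallness of the interaction between distant crossings at scale `k`. -/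
lemma mul_ratio_rpow_le {b B : ℕ} {A ν ε W : ℝ} (hν : 0 < ν) (hA : 0 ≤ A) (hb : 32 ≤ b)
    (hB : 1 ≤ B) (hBν : 2 ≤ (B:ℝ) ^ ν) (hAb : A * 4 ^ ν ≤ ε / 16 * (b:ℝ) ^ ν) (hε : 0 ≤ ε)
    (hW : 0 < W) (k : ℕ) :
    A * (3 * W / (((b * B ^ k : ℕ) - 2 : ℝ) * W)) ^ ν ≤ levelGap ε k := by
  have hb' : (32:ℝ) ≤ b := by exact_mod_cast hb
  have hBk : (1:ℝ) ≤ (B:ℝ) ^ k := one_le_pow₀ (by exact_mod_cast hB)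
  have hB0 : (0:ℝ) < B := by exact_mod_cast hB
  have hb0 : (0:ℝ) < b := by linarith
  have hbk : 32 ≤ (b:ℝ) * B ^ k := by nlinarith
  have h1 : 3 * W / (((b * B ^ k : ℕ) - 2 : ℝ) * W) ≤ 4 / ((b:ℝ) * B ^ k) := by
    push_cast
    rw [mul_div_mul_right _ _ hW.ne', div_le_div_iff₀ (by linarith) (by linarith)]
    linarith
  have h0 : 0 ≤ 3 * W / (((b * B ^ k : ℕ) - 2 : ℝ) * W) := by
    push_cast
    rw [mul_div_mul_right _ _ hW.ne']
    exact div_nonneg (by norm_num) (by linarith)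
  have h2 : (2:ℝ) ^ k ≤ ((B:ℝ) ^ k) ^ ν := by
    rw [← Real.rpow_natCast (B:ℝ), ← Real.rpow_mul hB0.le, mul_comm, Real.rpow_mul hB0.le,
      Real.rpow_natCast]
    gcongr
  have hbν : 0 < (b:ℝ) ^ ν := Real.rpow_pos_of_pos hb0 _
  calc A * (3 * W / (((b * B ^ k : ℕ) - 2 : ℝ) * W)) ^ ν
      ≤ A * (4 / ((b:ℝ) * B ^ k)) ^ ν := by gcongr
    _ = (A * 4 ^ ν) / ((b:ℝ) ^ ν * ((B:ℝ) ^ k) ^ ν) := by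
        rw [Real.div_rpow (by norm_num) (by positivity), Real.mul_rpow hb0.le (by positivity)]
        ring
    _ ≤ (ε / 16 * (b:ℝ) ^ ν) / ((b:ℝ) ^ ν * 2 ^ k) := by gcongr
    _ = levelGap ε k := by
        unfold levelGap
        rw [div_pow, one_pow]
        field_simp

variable {G Ω : Type} [MeasurableSpace Ω] {μ : Measure Ω} {dd : G → G → ℝ} {ℓ : G → ℝ → Ω → ℝ}
  {Lam : ℝ → Set G} {J₀ J R ν α A c W₀ ε u δ CΛ Q : ℝ} {Bad : (G → ℝ) → G → Prop} {b B : ℕ}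

/-- Number of boxes of scale `k` in a ball comparable to the next scale. -/
lemma ncard_boxes_le (hcard : ∀ L : ℝ, 1 ≤ L → ∀ (x : G) (N : ℝ), 1 ≤ N →
      (Lam L ∩ vball dd x (L * N)).Finite ∧
        ((Lam L ∩ vball dd x (L * N)).ncard : ℝ) ≤ CΛ * N ^ α)
    (hb : 1 ≤ b) (hB : 1 ≤ B) (hJ : 0 ≤ J) (hJW : J ≤ W₀)
    (hW₀ : 1 ≤ W₀) {k : ℕ} {T : ℝ} (hT : T ≤ 6 * scaleW b B J W₀ (k + 1)) (x : G) :
    (Lam (scaleW b B J W₀ k) ∩ vball dd x T).Finite ∧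
      ((Lam (scaleW b B J W₀ k) ∩ vball dd x T).ncard : ℝ) ≤
        max 1 (CΛ * (96 * b) ^ α) * ((2 * B : ℝ) ^ α) ^ k := by
  have hW := le_scaleW (b := b) hb hB hJ (by linarith : (0:ℝ) ≤ W₀) k
  have hWs := scaleW_succ_le hb hB hJ (by linarith : (0:ℝ) ≤ W₀) hJW k
  have hb' : (1:ℝ) ≤ b := by exact_mod_cast hb
  have hB' : (1:ℝ) ≤ B := by exact_mod_cast hB
  set N : ℝ := 96 * b * (2 * B) ^ k with hN
  have hN1 : 1 ≤ N := by
    have : (1:ℝ) ≤ (2 * B) ^ k := one_le_pow₀ (by linarith)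
    nlinarith
  have hsub : Lam (scaleW b B J W₀ k) ∩ vball dd x T ⊆
      Lam (scaleW b B J W₀ k) ∩ vball dd x (scaleW b B J W₀ k * N) := by
    refine Set.inter_subset_inter_right _ fun y hy => ?_
    refine le_trans (show dd x y ≤ T from hy) ?_
    rw [hN]; linarith
  obtain ⟨h1, h2⟩ := hcard (scaleW b B J W₀ k) (by linarith) x N hN1
  refine ⟨h1.subset hsub, ?_⟩
  calc ((Lam (scaleW b B J W₀ k) ∩ vball dd x T).ncard : ℝ)
      ≤ (Lam (scaleW b B J W₀ k) ∩ vball dd x (scaleW b B J W₀ k * N)).ncard := by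
        exact_mod_cast Set.ncard_le_ncard hsub h1
    _ ≤ CΛ * N ^ α := h2
    _ = (CΛ * (96 * b) ^ α) * ((2 * B : ℝ) ^ α) ^ k := by
        rw [hN, Real.mul_rpow (by positivity) (by positivity), ← Real.rpow_natCast,
          ← Real.rpow_natCast, ← Real.rpow_mul (by positivity), ← Real.rpow_mul (by positivity),
          mul_comm (k:ℝ) α, mul_assoc]
    _ ≤ _ := by
        gcongr
        exact le_max_right _ _

/-- Crossings with few good sites are unlikely, uniformly over all scales. -/
lemma measure_crossEv_le (h : HasDecoupling μ dd ℓ J₀ ν A c) (hself : ∀ x, dd x x = 0)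
    (hsymm : ∀ x y, dd x y = dd y x) (htri : ∀ x y z, dd x z ≤ dd x y + dd y z)
    (hlocal : ∀ f f' z, (∀ y, dd z y ≤ 3 * R → f y = f' y) → Bad f z → Bad f' z)
    (hcover : ∀ L : ℝ, 1 ≤ L → ∀ x, ∃ y ∈ Lam L, dd y x ≤ L)
    (hcard : ∀ L : ℝ, 1 ≤ L → ∀ (x : G) (N : ℝ), 1 ≤ N →
      (Lam L ∩ vball dd x (L * N)).Finite ∧
        ((Lam L ∩ vball dd x (L * N)).ncard : ℝ) ≤ CΛ * N ^ α)
    (hα : 0 ≤ α) (hν : 0 < ν) (hA : 0 ≤ A) (hc : 0 ≤ c)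
    (hJ : 0 ≤ J) (hJR : J + 3 * R ≤ W₀) (hJW : J ≤ W₀) (hW₀ : 1 ≤ W₀) (hJ₀ : J₀ ≤ W₀)
    (hb : 32 ≤ b) (hB : 1 ≤ B) (hBν : 2 ≤ (B:ℝ) ^ ν) (hbν : 8 ≤ (b:ℝ) ^ ν)
    (hAb : A * 4 ^ ν ≤ ε / 16 * (b:ℝ) ^ ν) (hε : 0 < ε) (hε2 : ε ≤ 1 / 2) (hu : 0 < u)
    {inc : Bool} (hmono : if inc then ∀ f f' z, f ≤ f' → Bad f' z → Bad f z
      else ∀ f f' z, f ≤ f' → Bad f z → Bad f' z)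
    (hδ : 0 < δ) (hδ1 : δ ≤ 1) (hδQ : δ ≤ Q)
    (hW : 1024 * Real.log (1 / δ) ≤ c * ε ^ 2 * (u * W₀ ^ ν))
    (hPQ : 2 * (max 1 (CΛ * (96 * b) ^ α) ^ 2 * Q * ((2 * B : ℝ) ^ α) ^ 2) ≤ 1)
    (hPδ : 18 * (max 1 (CΛ * (96 * b) ^ α) ^ 2 * ((2 * B : ℝ) ^ α) ^ 2 * δ) ≤ 1)
    (hbase : ∀ x, μ {ω | ∃ z, dd x z ≤ W₀ ∧ Bad (fun y => ℓ y u ω) z} ≤ ENNReal.ofReal Q)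
    (k : ℕ) (x : G) :
    μ {ω | (fun y => ℓ y (level inc ε u k) ω) ∈
        crossEv dd J Bad (scaleW b B J W₀ k) (scaleA b B k) x} ≤
      ENNReal.ofReal (Q / (((2 * B : ℝ) ^ α) ^ 2) ^ k) := by
  have hB' : (1:ℝ) ≤ B := by exact_mod_cast hB
  have hZ : 1 ≤ (2 * B : ℝ) ^ α := Real.one_le_rpow (by linarith) hα
  set P₁ := max 1 (CΛ * (96 * b) ^ α) with hP₁
  set Y := (2 * B : ℝ) ^ α with hY
  have hP1 : 1 ≤ P₁ := le_max_left _ _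
  have hQ : 0 < Q := hδ.trans_le hδQ
  induction k generalizing x with
  | zero =>
    rw [level_zero, pow_zero, div_one]
    refine (measure_mono fun ω hω => ?_).trans (hbase x)
    obtain ⟨γ, p, q, h1, h2, h3, h4, h5, h6⟩ := hω
    have hpq : p < q := by
      refine lt_of_le_of_ne h1 fun hpq => ?_
      rw [hpq, hself] at h5
      simp only [scaleW] at h5
      linarith
    refine ⟨γ p, h3, ?_⟩
    rw [scaleA, Nat.lt_one_iff, Finset.card_eq_zero, Finset.filter_eq_empty_iff] at h6
    exact not_not.1 (h6 (Finset.mem_Ico.2 ⟨le_rfl, hpq⟩))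
  | succ k ih =>
    have hWk := le_scaleW (b := b) (by omega) hB hJ (by linarith : (0:ℝ) ≤ W₀) k
    have hbk : 32 ≤ b * B ^ k := hb.trans (Nat.le_mul_of_pos_right b (pow_pos hB k))
    have hstep := measure_crossEv_succ_le (W := scaleW b B J W₀ k) (a := scaleA b B k)
      (N := scaleN b B k) (b := b * B ^ k) (K := P₁ * Y ^ k) (e := levelGap ε k)
      (w := level inc ε u k) (w' := level inc ε u (k + 1)) (w₀ := u / 2) (inc := inc)
      (η := 9 * (δ ^ 2) ^ (k + 1)) (p := Q / (Y ^ 2) ^ k)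
      h hself hsymm htri hlocal hJ (by linarith) (by linarith) (by linarith)
      (hcover _ (by linarith)) hbk (mul_pow_le_scaleN k)
      (fun x => ncard_boxes_le hcard (by omega) hB hJ hJW hW₀ (by
        change 4 * scaleW b B J W₀ (k + 1) ≤ _
        have := le_scaleW (b := b) (by omega) hB hJ (by linarith : (0:ℝ) ≤ W₀) (k + 1)
        linarith) x)
      (levelGap_pos hε k) (levelGap_le hε2 k)
      (mul_ratio_rpow_le hν hA hb hB hBν hAb hε.le (by linarith) k)
      (by linarith) (half_le_level hε.le hε2 hu.le k) (half_le_level hε.le hε2 hu.le (k + 1))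
      (by
        cases inc
        · simp only [Bool.false_eq_true, if_false] at hmono ⊢
          exact ⟨hmono, level_dec_succ hε.le hε2 hu.le k⟩
        · simp only [if_true] at hmono ⊢
          exact ⟨hmono, level_inc_succ hε.le hε2 hu.le k⟩)
      hc (scale_error_le hν (by omega) hB hbν hJ (by linarith) hδ hδ1 hu.le hc hW k)
      (by positivity) ih x
    refine hstep.trans (ENNReal.ofReal_le_ofReal ?_)
    have := scale_recursion (P := P₁ ^ 2) (Z := Y ^ 2) (one_le_pow₀ hP1) (one_le_pow₀ hZ) hδ hδQ
      hPQ hPδ k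
    calc (P₁ * Y ^ k) ^ 2 * ((Q / (Y ^ 2) ^ k) ^ 2 + 9 * (δ ^ 2) ^ (k + 1))
        = P₁ ^ 2 * (Y ^ 2) ^ k * ((Q / (Y ^ 2) ^ k) ^ 2 + 9 * (δ ^ 2) ^ (k + 1)) := by ring
      _ ≤ _ := this

end Scaling

section Passage

/-- A lower bound on the first passage distance from the number of good sites on paths. -/
lemma ofReal_lt_fppDistAnn {G Ω : Type} {lam dd : G → G → ℝ} {Lam : ℝ → Set G}
    {t : G → ℝ → Ω → ℝ} {R v : ℝ} {ω : Ω} {x : G} {L N s q : ℝ} {n : ℕ} (hn : 1 ≤ n) (hs : 0 ≤ s)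
    (hq : q ≤ n * s) {F : Set G} (hF : F.Finite)
    (hpath : ∀ γ m, IsLPath lam dd Lam R γ m → dd x (γ 0) ≤ L → ¬ dd x (γ m) ≤ N →
      n ≤ ((Finset.range (m + 1)).filter (fun i => γ i ∈ F ∧ s < t (γ i) v ω)).card) :
    ENNReal.ofReal q < fppDistAnn lam dd Lam t R v ω x L N := by
  obtain ⟨s', hs', hmin⟩ : ∃ s', s < s' ∧ ∀ z ∈ F, s < t z v ω → s' ≤ t z v ω := by
    set T := (hF.toFinset.filter (fun z => s < t z v ω)).image (fun z => t z v ω) with hT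
    have hmem : ∀ z ∈ F, s < t z v ω → t z v ω ∈ T := fun z hz hz' =>
      Finset.mem_image.2 ⟨z, Finset.mem_filter.2 ⟨hF.mem_toFinset.2 hz, hz'⟩, rfl⟩
    by_cases hne : T.Nonempty
    · refine ⟨T.min' hne, ?_, fun z hz hz' => T.min'_le _ (hmem z hz hz')⟩
      obtain ⟨z, hz, hz'⟩ := Finset.mem_image.1 (T.min'_mem hne)
      rw [← hz']
      exact (Finset.mem_filter.1 hz).2
    · exact ⟨s + 1, by linarith, fun z hz hz' => (hne ⟨_, hmem z hz hz'⟩).elim⟩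
  have hn' : (1:ℝ) ≤ n := by exact_mod_cast hn
  have hlt : ENNReal.ofReal q < ENNReal.ofReal (n * s') := by
    have h1 : (n:ℝ) * s < n * s' := by gcongr
    refine (ENNReal.ofReal_lt_ofReal_iff ?_).2 (hq.trans_lt h1)
    exact lt_of_le_of_lt (by positivity) h1
  refine hlt.trans_le ?_
  refine le_iInf fun y => le_iInf fun hy => le_iInf fun z => le_iInf fun hz => ?_
  refine le_iInf fun γ => le_iInf fun m => le_iInf fun hγ => ?_
  obtain ⟨h1, h2, h3⟩ := hγ
  have hcard := hpath γ m h1 (by rw [h2]; exact hy.2) (by rw [h3]; exact hz.2)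
  set S := (Finset.range (m + 1)).filter (fun i => γ i ∈ F ∧ s < t (γ i) v ω) with hS
  calc ENNReal.ofReal (n * s') = (n : ℝ≥0∞) * ENNReal.ofReal s' := by
        rw [ENNReal.ofReal_mul (by positivity), ENNReal.ofReal_natCast]
    _ ≤ (S.card : ℝ≥0∞) * ENNReal.ofReal s' := by gcongr
    _ = ∑ i ∈ S, ENNReal.ofReal s' := by rw [Finset.sum_const, nsmul_eq_mul]
    _ ≤ ∑ i ∈ S, ENNReal.ofReal (t (γ i) v ω) := by
        refine Finset.sum_le_sum fun i hi => ENNReal.ofReal_le_ofReal ?_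
        have := (Finset.mem_filter.1 hi).2
        exact hmin _ this.1 this.2
    _ ≤ _ := Finset.sum_le_sum_of_subset (Finset.filter_subset _ _)

/-- Paths at scale `R` have bounded jumps. -/
lemma IsLPath.dd_le {G : Type} {lam dd : G → G → ℝ} {Lam : ℝ → Set G} {R J₀ : ℝ} (hJ₀ : 0 ≤ J₀)
    (hR : 1 ≤ R) (hsymm : ∀ x y, dd x y = dd y x) (htri : ∀ x y z, dd x z ≤ dd x y + dd y z)
    (hjump : ∀ x y, 0 < lam x y → dd x y ≤ J₀) {γ : ℕ → G} {m : ℕ}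
    (h : IsLPath lam dd Lam R γ m) {i : ℕ} (hi : i < m) :
    dd (γ i) (γ (i + 1)) ≤ (2 + J₀) * R := by
  rcases h.2 i hi with ⟨-, a, b, h1, h2, h3⟩ | ⟨-, h1⟩
  · have := hjump a b h3
    nlinarith [htri (γ i) a (γ (i + 1)), htri a b (γ (i + 1)), hsymm (γ (i + 1)) b]
  · have := hjump _ _ h1
    nlinarith

/-- If no box near `x` has a crossing with few good sites, every path crossing the annulus
visits many good sites. -/
lemma mul_le_card_good {G : Type} {dd : G → G → ℝ} (hself : ∀ x, dd x x = 0)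
    (hsymm : ∀ x y, dd x y = dd y x) (htri : ∀ x y z, dd x z ≤ dd x y + dd y z) {W J L : ℝ}
    (hJ : 0 ≤ J) (hJW : J ≤ W) {Bad : (G → ℝ) → G → Prop} {a n : ℕ} {Λ : Set G}
    (hΛ : ∀ x, ∃ y ∈ Λ, dd y x ≤ W) (hn : 1 ≤ n) (hnL : n * (W + J) ≤ L) {f : G → ℝ} {x : G}
    (hf : ∀ y ∈ Λ ∩ vball dd x (3 * L), f ∉ crossEv dd J Bad W a y) {γ : ℕ → G} {m : ℕ}
    (hstep : ∀ i < m, dd (γ i) (γ (i + 1)) ≤ J) (h0 : dd x (γ 0) ≤ L)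
    (hm : ¬ dd x (γ m) ≤ 2 * L) :
    n * a ≤ ((Finset.range (m + 1)).filter (fun i => dd x (γ i) ≤ 4 * L ∧ ¬ Bad f (γ i))).card := by
  have hW : 0 ≤ W := hJ.trans hJW
  obtain ⟨σ, τ, hs, hd⟩ := exists_shells (p := 0) (q := m) (n := n) hself htri hW hJ (Nat.zero_le m)
    (fun i _ hi => hstep i hi) (by linarith [htri x (γ 0) (γ m)])
  have hn' : (1:ℝ) ≤ n := by exact_mod_cast hn
  have hWL : W + J ≤ L := (le_mul_of_one_le_left (by linarith) hn').trans hnL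
  have hshell : ∀ j ∈ Finset.range n, a ≤ ((Finset.Ico (σ j) (τ j)).filter
      (fun i => dd x (γ i) ≤ 4 * L ∧ ¬ Bad f (γ i))).card := by
    intro j hj
    rw [Finset.mem_range] at hj
    obtain ⟨k1, k2, k3, k4, k5, k6, k7⟩ := hs j hj
    have hjn : ((j:ℝ) + 1) * (W + J) ≤ n * (W + J) :=
      mul_le_mul_of_nonneg_right (by exact_mod_cast hj) (by linarith)
    have hσ : dd x (γ (σ j)) ≤ 2 * L := by linarith [htri x (γ 0) (γ (σ j))]
    obtain ⟨y, hy, hyd⟩ := hΛ (γ (σ j))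
    have hyx : y ∈ Λ ∩ vball dd x (3 * L) := by
      refine ⟨hy, show dd x y ≤ 3 * L from ?_⟩
      linarith [htri x (γ (σ j)) y, hsymm y (γ (σ j))]
    by_contra hlt
    refine hf y hyx ⟨γ, σ j, τ j, k2, fun i _ hi => hstep i (hi.trans_le k3), hyd, k7, k6, ?_⟩
    refine lt_of_le_of_lt (Finset.card_le_card fun i hi => ?_) (not_le.1 hlt)
    rw [Finset.mem_filter, Finset.mem_Ico] at hi ⊢
    refine ⟨hi.1, ?_, hi.2⟩
    linarith [htri x (γ (σ j)) (γ i), k7 i hi.1.1 hi.1.2.le]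
  calc n * a = ∑ j ∈ Finset.range n, a := by rw [Finset.sum_const, Finset.card_range, smul_eq_mul]
    _ ≤ ∑ j ∈ Finset.range n, ((Finset.Ico (σ j) (τ j)).filter
          (fun i => dd x (γ i) ≤ 4 * L ∧ ¬ Bad f (γ i))).card := Finset.sum_le_sum hshell
    _ ≤ ((Finset.Ico 0 m).filter (fun i => dd x (γ i) ≤ 4 * L ∧ ¬ Bad f (γ i))).card :=
        sum_card_shells_le (fun j hj => ⟨(hs j hj).1, (hs j hj).2.2.1⟩) hd _
    _ ≤ _ := by
        refine Finset.card_le_card (Finset.filter_subset_filter _ fun i hi => ?_)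
        rw [Finset.mem_Ico] at hi
        rw [Finset.mem_range]
        omega

/-- A scale adapted to a given length. -/
lemma exists_scale {b B : ℕ} {J W₀ L : ℝ} (hb : 2 ≤ b) (hB : 1 ≤ B) (hJ : 0 ≤ J) (hW₀ : 0 < W₀)
    (hL : 2 * W₀ ≤ L) :
    ∃ k, 2 * scaleW b B J W₀ k ≤ L ∧ L < 2 * scaleW b B J W₀ (k + 1) := by
  have hex : ∃ k, L < 2 * scaleW b B J W₀ k := by
    obtain ⟨k, hk⟩ := pow_unbounded_of_one_lt (L / W₀) (show (1:ℝ) < b by exact_mod_cast hb)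
    refine ⟨k, ?_⟩
    have := pow_mul_le_scaleW (b := b) hB hJ hW₀.le k
    rw [div_lt_iff₀ hW₀] at hk
    have : 0 < (b:ℝ) ^ k * W₀ := by positivity
    linarith
  obtain ⟨j, hj⟩ : ∃ j, Nat.find hex = j + 1 := by
    refine Nat.exists_eq_succ_of_ne_zero fun h0 => ?_
    have := Nat.find_spec hex
    rw [h0] at this
    simp only [scaleW] at this
    linarith
  refine ⟨j, not_lt.1 (Nat.find_min hex (by omega)), ?_⟩
  rw [← hj]
  exact Nat.find_spec hex

end Passage

section Annulus

variable {G Ω : Type} [MeasurableSpace Ω] {μ : Measure Ω} {lam dd : G → G → ℝ}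
  {ℓ : G → ℝ → Ω → ℝ} {t : G → ℝ → Ω → ℝ}
  {Lam : ℝ → Set G} {J₀ R α W₀ CΛ Q s v L : ℝ} {Bad : (G → ℝ) → G → Prop} {b B : ℕ}

/-- The first passage distance across an annulus is large, given that crossings with few good
sites are unlikely at all scales. -/
lemma measure_fppDistAnn_le (hself : ∀ x, dd x x = 0)
    (hsymm : ∀ x y, dd x y = dd y x) (htri : ∀ x y z, dd x z ≤ dd x y + dd y z)
    (hfin : ∀ x r, (vball dd x r).Finite) (hjump : ∀ x y, 0 < lam x y → dd x y ≤ J₀)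
    (hcover : ∀ L : ℝ, 1 ≤ L → ∀ x, ∃ y ∈ Lam L, dd y x ≤ L)
    (hcard : ∀ L : ℝ, 1 ≤ L → ∀ (x : G) (N : ℝ), 1 ≤ N →
      (Lam L ∩ vball dd x (L * N)).Finite ∧
        ((Lam L ∩ vball dd x (L * N)).ncard : ℝ) ≤ CΛ * N ^ α)
    (hα : 0 ≤ α) (hJ₀ : 0 ≤ J₀) (hR : 1 ≤ R) (hJW : 8 * ((2 + J₀) * R) ≤ W₀) (hW₀ : 1 ≤ W₀)
    (hb : 32 ≤ b) (hB : 1 ≤ B) (hs : 0 ≤ s) (hQ : 0 ≤ Q)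
    (hbad : ∀ ω, ∀ z ∈ Lam R, ¬ Bad (fun y => ℓ y v ω) z → s < t z v ω)
    (hbase : ∀ x, μ {ω | ∃ z, dd x z ≤ 2 * W₀ ∧ Bad (fun y => ℓ y v ω) z} ≤ ENNReal.ofReal Q)
    (hcross : ∀ k x, μ {ω | (fun y => ℓ y v ω) ∈ crossEv dd ((2 + J₀) * R) Bad
        (scaleW b B ((2 + J₀) * R) W₀ k) (scaleA b B k) x} ≤
      ENNReal.ofReal (Q / (((2 * B : ℝ) ^ α) ^ 2) ^ k)) (x : G) :
    μ {ω | fppDistAnn lam dd Lam t R v ω x L (2 * L) ≤ ENNReal.ofReal (s * L / (8 * W₀))} ≤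
      ENNReal.ofReal (max 1 (CΛ * (96 * b) ^ α) * Q) := by
  set J : ℝ := (2 + J₀) * R with hJdef
  have hJ : 0 ≤ J := by positivity
  set P₁ := max 1 (CΛ * (96 * b) ^ α) with hP₁
  have hP1 : 1 ≤ P₁ := le_max_left _ _
  have hB' : (1:ℝ) ≤ B := by exact_mod_cast hB
  have hY : 1 ≤ (2 * B : ℝ) ^ α := Real.one_le_rpow (by linarith) hα
  rcases lt_or_ge L (2 * W₀) with hL | hL
  · refine (measure_mono fun ω hω => ?_).trans ((hbase x).trans
      (ENNReal.ofReal_le_ofReal (le_mul_of_one_le_left hQ hP1)))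
    by_contra hno
    rw [mem_ofPred_eq] at hno
    push Not at hno
    rw [mem_ofPred_eq] at hω
    refine absurd hω (not_le.2 ?_)
    refine ofReal_lt_fppDistAnn (n := 1) le_rfl hs ?_ (hfin x L) fun γ m hγ h0 hm => ?_
    · rw [div_le_iff₀ (by linarith), Nat.cast_one, one_mul]
      nlinarith
    · rw [Nat.one_le_iff_ne_zero, Finset.card_ne_zero]
      refine ⟨0, Finset.mem_filter.2 ⟨Finset.mem_range.2 (Nat.succ_pos m), h0, ?_⟩⟩
      exact hbad ω _ (hγ.1 0 (Nat.zero_le m)) (hno _ (h0.trans hL.le))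
  · obtain ⟨k, hk1, hk2⟩ := exists_scale (b := b) (by omega) hB hJ (by linarith) hL
    have hWk := le_scaleW (b := b) (by omega) hB hJ (by linarith : (0:ℝ) ≤ W₀) k
    have hAk := scaleW_le_scaleA (b := b) (by omega) hB hJ (by linarith : (0:ℝ) ≤ W₀) hJW k
    set W := scaleW b B J W₀ k with hW
    have hW0 : 0 < W := by linarith
    obtain ⟨hf1, hf2⟩ := ncard_boxes_le (b := b) (k := k) (T := 3 * L) hcard (by omega) hB hJ (by linarith)
      hW₀ (by linarith) x
    set n := ⌊L / (2 * W)⌋₊ with hn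
    have hLW : 1 ≤ L / (2 * W) := by rw [le_div_iff₀ (by linarith)]; linarith
    have hn1 : 1 ≤ n := by rwa [hn, Nat.one_le_floor_iff]
    have hnL : (n:ℝ) * (2 * W) ≤ L := by
      have := Nat.floor_le (a := L / (2 * W)) (by linarith)
      rwa [le_div_iff₀ (by linarith)] at this
    have hLn : L ≤ n * (4 * W) := by
      have h1 := Nat.lt_floor_add_one (L / (2 * W))
      rw [div_lt_iff₀ (by linarith)] at h1
      have h2 : (1:ℝ) ≤ n := by exact_mod_cast hn1
      nlinarith
    have hAW : W ≤ 2 * (scaleA b B k * W₀) := by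
      have := mul_nonneg hW0.le (half_pow_mem k).1.le
      linarith
    have ha1 : 1 ≤ scaleA b B k := by
      rw [Nat.one_le_iff_ne_zero]
      intro h0
      rw [h0] at hAW
      simp only [Nat.cast_zero, zero_mul, mul_zero] at hAW
      linarith
    have hmain := measure_exists_le (μ := μ) hf1 hf2
      (E := {ω | fppDistAnn lam dd Lam t R v ω x L (2 * L) ≤ ENNReal.ofReal (s * L / (8 * W₀))})
      (F := fun y => {ω | (fun y => ℓ y v ω) ∈ crossEv dd J Bad W (scaleA b B k) y})
      (fun ω hω => ?_) (fun y _ => hcross k y)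
    · refine hmain.trans (ENNReal.ofReal_le_ofReal ?_)
      have hYk : (1:ℝ) ≤ ((2 * B : ℝ) ^ α) ^ k := one_le_pow₀ hY
      calc P₁ * ((2 * B : ℝ) ^ α) ^ k * (Q / (((2 * B : ℝ) ^ α) ^ 2) ^ k)
          = P₁ * Q / ((2 * B : ℝ) ^ α) ^ k := by
            rw [← pow_mul, mul_comm 2 k, pow_mul]; field_simp
        _ ≤ P₁ * Q := div_le_self (by positivity) hYk
    · by_contra hno
      rw [mem_ofPred_eq] at hno
      push Not at hno
      rw [mem_ofPred_eq] at hω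
      refine absurd hω (not_le.2 ?_)
      refine ofReal_lt_fppDistAnn (n := n * scaleA b B k) (Nat.mul_pos hn1 ha1) hs ?_
        (hfin x (4 * L)) fun γ m hγ h0 hm => ?_
      · rw [div_le_iff₀ (by linarith)]
        have h1 : L ≤ (n * scaleA b B k : ℕ) * (8 * W₀) := by
          push_cast
          have : (n:ℝ) * (4 * W) ≤ n * (4 * (2 * (scaleA b B k * W₀))) := by gcongr
          linarith
        calc s * L ≤ s * ((n * scaleA b B k : ℕ) * (8 * W₀)) := by gcongr
          _ = _ := by ring
      · refine (mul_le_card_good (γ := γ) hself hsymm htri hJ (by linarith) (hcover W (by linarith)) hn1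
          ?_ hno (fun i hi => hγ.dd_le hJ₀ hR hsymm htri hjump hi) h0 hm).trans
          (Finset.card_le_card fun i hi => ?_)
        · refine le_trans ?_ hnL
          gcongr
          linarith
        · rw [Finset.mem_filter] at hi ⊢
          exact ⟨hi.1, hi.2.1, hbad ω _ (hγ.1 i (by have := Finset.mem_range.1 hi.1; omega))
            hi.2.2⟩

end Annulus

section Apriori

lemma exists_nat_rpow_ge {ν : ℝ} (hν : 0 < ν) (K : ℝ) (m : ℕ) : ∃ n : ℕ, m ≤ n ∧ K ≤ (n:ℝ) ^ ν :=
  ((eventually_ge_atTop m).and (((tendsto_rpow_atTop hν).comp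
    tendsto_natCast_atTop_atTop).eventually_ge_atTop K)).exists

/-- Powers of `log (1 / δ)` are absorbed by a square root of `δ`. -/
lemma exists_mul_log_rpow_le {α ν : ℝ} (hα : 0 < α) (hν : 0 < ν) :
    ∃ K : ℝ, 0 < K ∧ ∀ δ : ℝ, 0 < δ → δ ≤ 1 →
      δ * max 1 (Real.log (1 / δ) ^ (1 / ν)) ^ α ≤ K * √δ := by
  set r : ℝ := ν / (2 * α) with hr
  have hr0 : 0 < r := by positivity
  set k : ℝ := max 1 (r⁻¹ ^ (1 / ν)) with hk
  have hk1 : 1 ≤ k := le_max_left _ _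
  refine ⟨k ^ α, by positivity, fun δ hδ hδ1 => ?_⟩
  have hx : 1 ≤ 1 / δ := by rw [le_div_iff₀ hδ]; linarith
  have hx0 : 0 < 1 / δ := by linarith
  have h1 : max 1 (Real.log (1 / δ) ^ (1 / ν)) ≤ k * (1 / δ) ^ (1 / (2 * α)) := by
    refine max_le ?_ ?_
    · exact one_le_mul_of_one_le_of_one_le hk1 (Real.one_le_rpow hx (by positivity))
    · calc Real.log (1 / δ) ^ (1 / ν) ≤ ((1 / δ) ^ r / r) ^ (1 / ν) :=
            Real.rpow_le_rpow (Real.log_nonneg hx) (Real.log_le_rpow_div hx0.le hr0) (by positivity)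
        _ = r⁻¹ ^ (1 / ν) * (1 / δ) ^ (1 / (2 * α)) := by
            rw [div_eq_inv_mul, Real.mul_rpow (by positivity) (by positivity),
              ← Real.rpow_mul hx0.le]
            congr 2
            rw [hr]; field_simp
        _ ≤ _ := by
            gcongr
            exact le_max_right _ _
  calc δ * max 1 (Real.log (1 / δ) ^ (1 / ν)) ^ α
      ≤ δ * (k * (1 / δ) ^ (1 / (2 * α))) ^ α := by gcongr
    _ = k ^ α * (δ * (1 / δ) ^ (1 / 2 : ℝ)) := by
        rw [Real.mul_rpow (by positivity) (by positivity), ← Real.rpow_mul hx0.le]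
        have : 1 / (2 * α) * α = 1 / 2 := by field_simp
        rw [this]; ring
    _ = k ^ α * √δ := by
        rw [← Real.sqrt_eq_rpow, Real.sqrt_div zero_le_one, Real.sqrt_one, mul_one_div,
          Real.div_sqrt]

/-- Comparison of the number of boxes with the probability that a box is bad. -/
lemma count_mul_prob_le {α ν u R δ C w : ℝ} (hα : 0 ≤ α) (hu : 0 < u) (hR : 1 ≤ R)
    (hδ : 0 < δ) (hδ1 : δ ≤ 1) (hC : 0 ≤ C) (hw : 0 ≤ w) :
    C * (2 * (w * max ((u⁻¹ * Real.log (1 / δ)) ^ (1 / ν)) R) / R) ^ α *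
        (δ * min 1 (u ^ (1 / ν) * R) ^ α) ≤
      C * (2 * w) ^ α * (δ * max 1 (Real.log (1 / δ) ^ (1 / ν)) ^ α) := by
  have hlog : 0 ≤ Real.log (1 / δ) := Real.log_nonneg (by rw [le_div_iff₀ hδ]; linarith)
  set M := max ((u⁻¹ * Real.log (1 / δ)) ^ (1 / ν)) R with hM
  set m := min 1 (u ^ (1 / ν) * R) with hm
  have hR0 : 0 < R := by linarith
  have hM0 : 0 ≤ M := hR0.le.trans (le_max_right _ _)
  have hU : 0 < u ^ (1 / ν) := Real.rpow_pos_of_pos hu _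
  have hm0 : 0 ≤ m := le_min zero_le_one (by positivity)
  have hMm : M / R * m ≤ max 1 (Real.log (1 / δ) ^ (1 / ν)) := by
    rcases max_cases ((u⁻¹ * Real.log (1 / δ)) ^ (1 / ν)) R with ⟨h1, -⟩ | ⟨h1, -⟩
    · refine le_trans ?_ (le_max_right _ _)
      rw [hM, h1, Real.mul_rpow (by positivity) hlog, Real.inv_rpow hu.le]
      calc (u ^ (1 / ν))⁻¹ * Real.log (1 / δ) ^ (1 / ν) / R * m
          ≤ (u ^ (1 / ν))⁻¹ * Real.log (1 / δ) ^ (1 / ν) / R * (u ^ (1 / ν) * R) := by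
            gcongr
            exact min_le_right _ _
        _ = _ := by field_simp
    · refine le_trans ?_ (le_max_left _ _)
      rw [hM, h1, div_self hR0.ne', one_mul]
      exact min_le_left _ _
  calc C * (2 * (w * M) / R) ^ α * (δ * m ^ α)
      = C * (2 * w) ^ α * (δ * (M / R * m) ^ α) := by
        rw [show 2 * (w * M) / R = 2 * w * (M / R) by ring,
          Real.mul_rpow (by positivity) (by positivity),
          Real.mul_rpow (by positivity : 0 ≤ M / R) hm0]
        ring
    _ ≤ _ := by gcongr

/-- Sites with a small weight. -/
def badSite {G : Type} (dd : G → G → ℝ) (Λ : Set G) (R s : ℝ) (gz : G → (G → ℝ) → ℝ)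
    (f : G → ℝ) (z : G) : Prop :=
  z ∈ Λ ∧ gz z (fun y => if dd z y ≤ 3 * R then f y else 0) ≤ s

lemma badSite_local {G : Type} {dd : G → G → ℝ} {Λ : Set G} {R s : ℝ} {gz : G → (G → ℝ) → ℝ}
    (f f' : G → ℝ) (z : G) (h : ∀ y, dd z y ≤ 3 * R → f y = f' y) (hb : badSite dd Λ R s gz f z) :
    badSite dd Λ R s gz f' z := by
  have : (fun y => if dd z y ≤ 3 * R then f' y else 0) =
      fun y => if dd z y ≤ 3 * R then f y else 0 := by
    ext y
    split_ifs with hy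
    · exact (h y hy).symm
    · rfl
  exact ⟨hb.1, this ▸ hb.2⟩

lemma badSite_mono {G : Type} {dd : G → G → ℝ} {Λ : Set G} {R s : ℝ} {gz : G → (G → ℝ) → ℝ}
    {inc : Bool}
    (h : if inc then ∀ z ∈ Λ, Monotone (gz z) else ∀ z ∈ Λ, Antitone (gz z)) :
    if inc then ∀ f f' z, f ≤ f' → badSite dd Λ R s gz f' z → badSite dd Λ R s gz f z
      else ∀ f f' z, f ≤ f' → badSite dd Λ R s gz f z → badSite dd Λ R s gz f' z := by
  have hle : ∀ (f f' : G → ℝ) (z : G), f ≤ f' →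
      (fun y => if dd z y ≤ 3 * R then f y else 0) ≤
        fun y => if dd z y ≤ 3 * R then f' y else 0 := by
    intro f f' z hf y
    by_cases hy : dd z y ≤ 3 * R
    · simpa [hy] using hf y
    · simp [hy]
  cases inc
  · simp only [Bool.false_eq_true, if_false] at h ⊢
    exact fun f f' z hf hb => ⟨hb.1, (h z hb.1 (hle f f' z hf)).trans hb.2⟩
  · simp only [if_true] at h ⊢
    exact fun f f' z hf hb => ⟨hb.1, (h z hb.1 (hle f f' z hf)).trans hb.2⟩

end Apriori

/-- Proposition `pro:apriori`: a priori estimate showing that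
the FPP distance across an annulus grows linearly with probability tending to
one as the sprinkling parameter `δ` tends to zero. -/
theorem statement15
    (V : Type) [MeasurableSpace V]
    (lam dd : V → V → ℝ) (P : V → Measure (ℕ → V)) (α ν c₃ C₃ : ℝ)
    (hSt : Standing lam dd P α ν c₃ C₃)
    (Lam : ℝ → Set V) (hLam : LamFamily dd α Lam)
    (Ω : Type) [MeasurableSpace Ω] (μ : Measure Ω) [IsProbabilityMeasure μ]
    (ℓ : V → ℝ → Ω → ℝ) (hLT : LocalTimes μ (green lam P) ℓ) :
    ∀ ε : ℝ, 0 < ε → ε ≤ 1/2 →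
    ∃ c' c'' c''' : ℝ, 0 < c' ∧ 0 < c'' ∧ 0 < c''' ∧
    ∃ f : ℝ → ℝ,
      (∀ δ ∈ Set.Ico (0:ℝ) 1, f δ ∈ Set.Icc (0:ℝ) 1) ∧
      Filter.Tendsto f (nhdsWithin 0 (Set.Ioi 0)) (nhds 0) ∧
      ∀ s : ℝ, 0 ≤ s → ∀ δ : ℝ, 0 < δ → δ ≤ c' →
      ∀ R : ℝ, 1 ≤ R → ∀ L : ℝ, R ≤ L →
      ∀ (inc : Bool) (t : V → ℝ → Ω → ℝ), Admissible dd Lam ℓ R t inc →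
      ∀ u v : ℝ, (if inc then 0 < u ∧ u < v else 0 < v ∧ v < u) →
        ε * v ≤ |u - v| → c''' * Real.log (1/δ) ≤ u * L ^ ν →
        (∀ z ∈ Lam R,
          μ {ω | t z u ω ≤ s}
            ≤ ENNReal.ofReal (δ * (min 1 (u ^ (1/ν) * R)) ^ α)) →
      ∀ x ∈ Lam L,
        μ {ω | fppDistAnn lam dd Lam t R v ω x L (2 * L)
              ≤ ENNReal.ofReal (c'' * s * L /
                  max ((u⁻¹ * Real.log (1/δ)) ^ (1/ν)) R)}
          ≤ ENNReal.ofReal (f δ) := by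
  intro ε hε hε2
  obtain ⟨cp, Cp, J₀, hpot⟩ := hSt.exists_potData
  obtain ⟨A, c, hA, hc, hdec⟩ := hpot.exists_decoupling hLT
  obtain ⟨CΛ, hCΛ, hcard⟩ := hLam.card
  have hν := hSt.nu_pos
  have hα : 0 < α := by linarith [hSt.nu_le]
  have hJ₀ := hpot.one_le_J
  obtain ⟨B, hB, hBν⟩ := exists_nat_rpow_ge hν 2 1
  obtain ⟨b, hb, hbK⟩ := exists_nat_rpow_ge hν (max 8 (A * 4 ^ ν / (ε / 16))) 32
  have hbν := (le_max_left _ _).trans hbK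
  have hAb : A * 4 ^ ν ≤ ε / 16 * (b:ℝ) ^ ν := by
    have := (le_max_right _ _).trans hbK
    rw [div_le_iff₀ (by positivity)] at this
    linarith
  obtain ⟨w, hw, hwν⟩ := exists_nat_rpow_ge hν (1024 / (c * ε ^ 2)) ⌈8 * (2 + J₀)⌉₊
  have hw8 : 8 * (2 + J₀) ≤ w := (Nat.le_ceil _).trans (by exact_mod_cast hw)
  have hw0 : (0:ℝ) < w := by linarith
  rw [div_le_iff₀ (by positivity)] at hwν
  obtain ⟨Kl, hKl, hlogK⟩ := exists_mul_log_rpow_le hα hν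
  set P₁ := max 1 (CΛ * (96 * b) ^ α) with hP₁
  set Y := (2 * B : ℝ) ^ α with hYdef
  set Kq := max 1 (CΛ * (2 * w) ^ α * Kl) with hKq
  have hP1 : 1 ≤ P₁ := le_max_left _ _
  have hB' : (1:ℝ) ≤ B := by exact_mod_cast hB
  have hY1 : 1 ≤ Y := Real.one_le_rpow (by linarith) hα.le
  have hKq1 : 1 ≤ Kq := le_max_left _ _
  set D := 18 * (P₁ ^ 2 * Kq * Y ^ 2) with hD
  have hPY : 1 ≤ P₁ ^ 2 * Y ^ 2 :=
    one_le_mul_of_one_le_of_one_le (one_le_pow₀ hP1) (one_le_pow₀ hY1)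
  have hD1 : 1 ≤ D := by
    have : 1 ≤ P₁ ^ 2 * Y ^ 2 * Kq := one_le_mul_of_one_le_of_one_le hPY hKq1
    rw [hD, show 18 * (P₁ ^ 2 * Kq * Y ^ 2) = 18 * (P₁ ^ 2 * Y ^ 2 * Kq) by ring]
    linarith
  refine ⟨(1 / D) ^ 2, 1 / (8 * w), 1, by positivity, by positivity, one_pos,
    fun δ => min 1 (P₁ * (Kq * √δ)), fun δ _ => ⟨le_min zero_le_one (by positivity), min_le_left _ _⟩,
    ?_, ?_⟩
  · have h1 : Continuous fun δ : ℝ => min 1 (P₁ * (Kq * √δ)) := by fun_prop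
    have h2 := h1.tendsto 0
    simp only [Real.sqrt_zero, mul_zero, zero_le_one, min_eq_right] at h2
    exact h2.mono_left nhdsWithin_le_nhds
  intro s hs δ hδ hδc R hR L hRL inc t ht u v huv hεv _ hprob x _
  obtain ⟨gz, -, hmono, hrepr⟩ := ht.repr
  have hδs : √δ ≤ 1 / D := by
    rw [← Real.sqrt_sq (by positivity : 0 ≤ 1 / D)]
    exact Real.sqrt_le_sqrt hδc
  have hDδ : D * √δ ≤ 1 := by
    rwa [le_div_iff₀ (by linarith), mul_comm] at hδs
  have hs0 : 0 < √δ := Real.sqrt_pos.2 hδ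
  have hs1 : √δ ≤ 1 := hδs.trans ((div_le_one (by linarith)).2 hD1)
  have hδs1 : δ ≤ √δ := by
    calc δ = √δ * √δ := (Real.mul_self_sqrt hδ.le).symm
      _ ≤ √δ := mul_le_of_le_one_left hs0.le hs1
  have hδ1 : δ ≤ 1 := hδs1.trans hs1
  have hu : 0 < u := by
    cases inc
    · simp only [Bool.false_eq_true, if_false] at huv; linarith
    · simp only [if_true] at huv; exact huv.1
  have hv : 0 < v := by
    cases inc
    · simp only [Bool.false_eq_true, if_false] at huv; exact huv.1
    · simp only [if_true] at huv; linarith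
  have hlog : 0 ≤ Real.log (1 / δ) := Real.log_nonneg (by rw [le_div_iff₀ hδ]; linarith)
  set M := max ((u⁻¹ * Real.log (1 / δ)) ^ (1 / ν)) R with hM
  have hMR : R ≤ M := le_max_right _ _
  set W₀ := w * M with hW₀
  set Q := Kq * √δ with hQ
  have hwR : 8 * ((2 + J₀) * R) ≤ W₀ := by
    calc 8 * ((2 + J₀) * R) = 8 * (2 + J₀) * R := by ring
      _ ≤ w * M := by gcongr
  have hδQ : δ ≤ Q := hδs1.trans (le_mul_of_one_le_left hs0.le hKq1)
  have hQ0 : 0 ≤ Q := hδ.le.trans hδQ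
  have hJ_mul : (2 + J₀) * R = 2 * R + J₀ * R := by ring
  have hJ_le : J₀ ≤ J₀ * R := le_mul_of_one_le_right (by linarith) hR
  have hR_le : R ≤ J₀ * R := le_mul_of_one_le_left (by linarith) hJ₀
  have hRW : R ≤ W₀ := by linarith
  have hW₀1 : 1 ≤ W₀ := hR.trans hRW
  have hPQ : P₁ ^ 2 * Q * Y ^ 2 ≤ 1 / 18 := by
    have : 18 * (P₁ ^ 2 * Q * Y ^ 2) = D * √δ := by rw [hD, hQ]; ring
    linarith
  have hPδ : P₁ ^ 2 * Y ^ 2 * δ ≤ 1 / 18 := by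
    calc P₁ ^ 2 * Y ^ 2 * δ ≤ P₁ ^ 2 * Y ^ 2 * Q := by gcongr
      _ = P₁ ^ 2 * Q * Y ^ 2 := by ring
      _ ≤ 1 / 18 := hPQ
  have hWM : 1024 * Real.log (1 / δ) ≤ c * ε ^ 2 * (u * W₀ ^ ν) := by
    have h1 : u⁻¹ * Real.log (1 / δ) ≤ M ^ ν := by
      have h0 : 0 ≤ u⁻¹ * Real.log (1 / δ) := by positivity
      calc u⁻¹ * Real.log (1 / δ) = ((u⁻¹ * Real.log (1 / δ)) ^ (1 / ν)) ^ ν := by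
            rw [← Real.rpow_mul h0, one_div_mul_cancel hν.ne', Real.rpow_one]
        _ ≤ _ := Real.rpow_le_rpow (by positivity) (le_max_left _ _) hν.le
    have h2 : Real.log (1 / δ) ≤ u * M ^ ν := by
      rwa [inv_mul_le_iff₀ hu] at h1
    calc 1024 * Real.log (1 / δ) ≤ ((w:ℝ) ^ ν * (c * ε ^ 2)) * (u * M ^ ν) := by gcongr
      _ = _ := by rw [hW₀, Real.mul_rpow hw0.le (by linarith)]; ring
  set Bad := badSite dd (Lam R) R s gz with hBad
  have hBm := badSite_mono (dd := dd) (R := R) (s := s) hmono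
  have hbase : ∀ x, μ {ω | ∃ z, dd x z ≤ 2 * W₀ ∧ Bad (fun y => ℓ y u ω) z} ≤
      ENNReal.ofReal Q := by
    intro x
    have hWR : R * (2 * W₀ / R) = 2 * W₀ := by field_simp
    have h2 : 1 ≤ 2 * W₀ / R := by
      rw [le_div_iff₀ (by linarith)]
      linarith
    obtain ⟨h3, h4⟩ := hcard R hR x _ h2
    rw [hWR] at h3 h4
    refine (measure_exists_le h3 h4 (F := fun z => {ω | t z u ω ≤ s}) (fun ω hω => ?_)
      (fun z hz => hprob z hz.1)).trans (ENNReal.ofReal_le_ofReal ?_)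
    · obtain ⟨z, hz, hzR, hzb⟩ := hω
      exact ⟨z, ⟨hzR, hz⟩, (hrepr z hzR u hu ω).trans_le hzb⟩
    · refine (count_mul_prob_le hα.le hu hR hδ hδ1 hCΛ.le hw0.le).trans ?_
      calc CΛ * (2 * w) ^ α * (δ * max 1 (Real.log (1 / δ) ^ (1 / ν)) ^ α)
          ≤ CΛ * (2 * w) ^ α * (Kl * √δ) :=
            mul_le_mul_of_nonneg_left (hlogK δ hδ hδ1) (by positivity)
        _ = CΛ * (2 * w) ^ α * Kl * √δ := by ring
        _ ≤ Kq * √δ := by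
            gcongr
            exact le_max_right _ _
  have hbase' : ∀ x, μ {ω | ∃ z, dd x z ≤ W₀ ∧ Bad (fun y => ℓ y u ω) z} ≤ ENNReal.ofReal Q := by
    refine fun x => (measure_mono fun ω hω => ?_).trans (hbase x)
    obtain ⟨z, hz, hzb⟩ := hω
    exact ⟨z, by linarith, hzb⟩
  have hcross := measure_crossEv_le (Bad := Bad) (R := R) (J := (2 + J₀) * R) (inc := inc)
    (Q := Q) hdec hSt.dd_self hSt.dd_symm hSt.dd_triangle badSite_local hLam.cover hcard hα.le hν
    hA.le hc.le (by positivity) (by linarith) (by linarith) hW₀1 (by linarith) hb hB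
    hBν hbν hAb hε hε2 hu hBm hδ hδ1 hδQ hWM (by linarith) (by linarith) hbase'
  have hlev : ∀ k ω, if inc then (fun y => ℓ y (level inc ε u k) ω) ≤ fun y => ℓ y v ω
      else (fun y => ℓ y v ω) ≤ fun y => ℓ y (level inc ε u k) ω := by
    intro k ω
    have hpos : 0 < level inc ε u k :=
      lt_of_lt_of_le (by positivity) (half_le_level hε.le hε2 hu.le k)
    cases inc
    · simp only [Bool.false_eq_true, if_false] at huv ⊢
      exact fun y => hLT.mono y ω hv hpos (le_level_dec hε.le hv.le huv.2 hεv k)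
    · simp only [if_true] at huv ⊢
      exact fun y => hLT.mono y ω hpos hv (level_inc_le hε.le hu.le huv.2 hεv k)
  have hbase_v : ∀ x, μ {ω | ∃ z, dd x z ≤ 2 * W₀ ∧ Bad (fun y => ℓ y v ω) z} ≤
      ENNReal.ofReal Q := by
    refine fun x => (measure_mono fun ω hω => ?_).trans (hbase x)
    obtain ⟨z, hz, hzb⟩ := hω
    have := hlev 0 ω
    rw [level_zero] at this
    refine ⟨z, hz, ?_⟩
    cases inc
    · exact hBm _ _ z this hzb
    · exact hBm _ _ z this hzb
  have hcross_v : ∀ k x, μ {ω | (fun y => ℓ y v ω) ∈ crossEv dd ((2 + J₀) * R) Bad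
      (scaleW b B ((2 + J₀) * R) W₀ k) (scaleA b B k) x} ≤ ENNReal.ofReal (Q / (Y ^ 2) ^ k) := by
    refine fun k x => (measure_mono fun ω hω => ?_).trans (hcross k x)
    have := hlev k ω
    cases inc
    · exact isUpperSet_crossEv hBm this hω
    · exact isLowerSet_crossEv hBm this hω
  have hmain := measure_fppDistAnn_le (t := t) (L := L) hSt.dd_self hSt.dd_symm hSt.dd_triangle
    hpot.finite_ball hpot.jump hLam.cover hcard hα.le (by linarith) hR hwR hW₀1 hb hB hs
    hQ0 (fun ω z hz hnb => by
      rw [hrepr z hz v hv ω]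
      exact not_le.1 fun h => hnb ⟨hz, h⟩) hbase_v hcross_v x
  have hconst : 1 / (8 * w) * s * L / M = s * L / (8 * W₀) := by
    rw [hW₀]; field_simp
  rw [hconst]
  change _ ≤ ENNReal.ofReal (min 1 (P₁ * Q))
  rcases min_cases 1 (P₁ * Q) with ⟨h1, -⟩ | ⟨h1, -⟩
  · rw [h1, ENNReal.ofReal_one]
    exact prob_le_one
  · rw [h1]
    exact hmain

end Paper
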